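/- arXiv:2412.16753 — 5 statements merged into one kernel-verified Lean document; each statement's English description precedes it below -/
import Mathlib

section
/- Suppose |Λ|≥2 and the one-parameter family of analytic IFSs {Φ_t}_{t∈I} is non-degenerate. Then the set of parameters t∈I for which all the maps in Φ_t have a common fixed point is finite. -/
open MeasureTheory Filter Set Metric Topology

noncomputable section

/-- The unit interval `I = [0,1]`. -/
def unitI : Set ℝ := Set.Icc 0 1

/-- For a word `u = i₁…iₙ`, `compWord φ u = φ_{i₁} ∘ … ∘ φ_{iₙ}`. -/
def compWord {Λ : Type*} (φ : Λ → ℝ → ℝ) : List Λ → ℝ → ℝ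
  | [] => id
  | i :: u => φ i ∘ compWord φ u

/-- `φ_{ω₀,t} ∘ … ∘ φ_{ωₙ,t} (0)`. -/
def iterPoint {Λ : Type*} (φ : Λ → ℝ → ℝ → ℝ) (ω : ℕ → Λ) (t : ℝ) (n : ℕ) : ℝ :=
  compWord (fun i => φ i t) (List.ofFn fun j : Fin (n + 1) => ω j) 0

/-- On a compact space without isolated points, if near every point `F` either vanishes or is
nonzero off that point, and the space is connected, then `F` has finitely many zeros or is zero. -/
theorem finite_zeros_or_eq_zero {X : Type*} [TopologicalSpace X] [CompactSpace X]
    [PreconnectedSpace X] [hX : ∀ x : X, NeBot (𝓝[≠] x)] {F : X → ℝ}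
    (hF : ∀ x, (∀ᶠ y in 𝓝 x, F y = 0) ∨ ∀ᶠ y in 𝓝[≠] x, F y ≠ 0) :
    {x | F x = 0}.Finite ∨ ∀ x, F x = 0 := by
  by_contra! hcon
  obtain ⟨hinf, x₁, hx₁⟩ := hcon
  set U : Set X := {x | ∀ᶠ y in 𝓝 x, F y = 0}
  have hopen : IsOpen U := isOpen_setOfPred_eventually_nhds
  have hclosed : IsClosed U := by
    refine isClosed_of_closure_subset fun x hx => ?_
    refine (hF x).resolve_right fun h => ?_
    rw [eventually_nhdsWithin_iff, _root_.eventually_nhds_iff] at h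
    obtain ⟨V, hV, hVo, hxV⟩ := h
    obtain ⟨y, hyV, hyU⟩ := mem_closure_iff.1 hx V hVo hxV
    have h1 : ∀ᶠ z in 𝓝 y, z ∈ V ∧ F z = 0 := (hVo.eventually_mem hyV).and hyU
    by_cases hyx : y = x
    · subst hyx
      obtain ⟨z, ⟨hzV, hz⟩, hzy⟩ :=
        ((h1.filter_mono nhdsWithin_le_nhds).and (self_mem_nhdsWithin (s := {y}ᶜ))).exists
      exact hV z hzV hzy hz
    · exact hV y hyV hyx h1.self_of_nhds.2
  rcases isClopen_iff.1 ⟨hclosed, hopen⟩ with h | h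
  · obtain ⟨x, -, hx⟩ := Set.Infinite.exists_accPt_of_subset_isCompact hinf isCompact_univ
      (subset_univ _)
    rcases hF x with hz | hz
    · exact (h ▸ (show x ∈ U from hz) : x ∈ (∅ : Set X))
    · obtain ⟨y, hy, hy'⟩ := ((accPt_iff_frequently_nhdsNE.1 hx).and_eventually hz).exists
      exact hy' hy
  · have hx : x₁ ∈ U := h ▸ mem_univ x₁
    exact hx₁ hx.self_of_nhds

theorem exists_contraction_const {f : ℝ → ℝ} (hf : AnalyticOnNhd ℝ f unitI)
    (hd : ∀ x ∈ unitI, |deriv f x| < 1) :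
    ∃ K : ℝ, 0 ≤ K ∧ K < 1 ∧ ∀ x ∈ unitI, ∀ y ∈ unitI, |f y - f x| ≤ K * |y - x| := by
  have hI : unitI.Nonempty := ⟨0, by simp [unitI]⟩
  obtain ⟨z, hz, hmax⟩ := (isCompact_Icc : IsCompact unitI).exists_isMaxOn hI
    (hf.deriv.continuousOn.abs)
  refine ⟨|deriv f z|, abs_nonneg _, hd z hz, fun x hx y hy => ?_⟩
  exact Convex.norm_image_sub_le_of_norm_deriv_le (fun w hw => (hf w hw).differentiableAt)
    (fun w hw => hmax hw) (convex_Icc 0 1) hx hy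

theorem fixedPoint_unique {f : ℝ → ℝ} (hf : AnalyticOnNhd ℝ f unitI)
    (hd : ∀ x ∈ unitI, |deriv f x| < 1) {x y : ℝ} (hx : x ∈ unitI) (hy : y ∈ unitI)
    (hfx : f x = x) (hfy : f y = y) : x = y := by
  obtain ⟨K, -, hK1, hK⟩ := exists_contraction_const hf hd
  have h := hK y hy x hx
  rw [hfx, hfy] at h
  by_contra hne
  have : 0 < |x - y| := abs_pos.2 (sub_ne_zero.2 hne)
  nlinarith

theorem tendsto_iterate_fixedPoint {f : ℝ → ℝ} (hf : AnalyticOnNhd ℝ f unitI)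
    (hd : ∀ x ∈ unitI, |deriv f x| < 1) (hm : MapsTo f unitI unitI) {x y : ℝ}
    (hx : x ∈ unitI) (hy : y ∈ unitI) (hfx : f x = x) :
    Tendsto (fun n => f^[n] y) atTop (𝓝 x) := by
  obtain ⟨K, hK0, hK1, hK⟩ := exists_contraction_const hf hd
  have key : ∀ n, |f^[n] y - x| ≤ K ^ n * |y - x| := by
    intro n
    induction n with
    | zero => simp
    | succ n ih =>
      rw [Function.iterate_succ_apply', pow_succ']
      calc |f (f^[n] y) - x| = |f (f^[n] y) - f x| := by rw [hfx]
        _ ≤ K * |f^[n] y - x| := hK x hx _ (hm.iterate n hy)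
        _ ≤ K * (K ^ n * |y - x|) := by gcongr
        _ = _ := by ring
  rw [tendsto_iff_norm_sub_tendsto_zero]
  refine squeeze_zero (fun _ => norm_nonneg _) key ?_
  simpa using (tendsto_pow_atTop_nhds_zero_of_lt_one hK0 hK1).mul_const |y - x|

theorem exists_fixedPoint {f : ℝ → ℝ} (hf : AnalyticOnNhd ℝ f unitI)
    (hm : MapsTo f unitI unitI) : ∃ x ∈ unitI, f x = x :=
  exists_mem_Icc_isFixedPt_of_mapsTo hf.continuousOn zero_le_one hm

/-- Analytic dependence of a fixed point on the parameter. -/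
theorem exists_analyticAt_fixedPoint {f : ℝ × ℝ → ℝ} {t x : ℝ} (hf : AnalyticAt ℝ f (t, x))
    (hfx : f (t, x) = x) (hd : deriv (fun y => f (t, y)) x ≠ 1) :
    ∃ g : ℝ → ℝ, AnalyticAt ℝ g t ∧ g t = x ∧ ∀ᶠ s in 𝓝 t, f (s, g s) = g s := by
  set h : ℝ × ℝ → ℝ := fun q => f q - q.2
  have hh : ContDiffAt ℝ ⊤ h (t, x) := (hf.sub analyticAt_snd).contDiffAt
  have hslice : HasDerivAt (fun y : ℝ => ((t, y) : ℝ × ℝ)) (0, 1) x :=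
    (hasDerivAt_const x t).prodMk (hasDerivAt_id x)
  have h1 := (hh.differentiableAt (by simp)).hasFDerivAt.comp_hasDerivAt x hslice
  have h2 : HasDerivAt (fun y : ℝ => h (t, y)) (deriv (fun y => f (t, y)) x - 1) x := by
    have : DifferentiableAt ℝ (fun y => f (t, y)) x :=
      hf.differentiableAt.comp x hslice.differentiableAt
    exact this.hasDerivAt.sub (hasDerivAt_id x)
  have hL := h1.unique h2
  have hinv : (fderiv ℝ h (t, x) ∘L .inr ℝ ℝ ℝ).IsInvertible := by
    refine ⟨ContinuousLinearEquiv.unitsEquivAut ℝ (Units.mk0 _ (sub_ne_zero.2 hd)), ?_⟩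
    ext
    simp [← hL]
  refine ⟨hh.implicitFunction (by simp) hinv,
    (hh.contDiffAt_implicitFunction (by simp) hinv).analyticAt,
    hh.implicitFunction_apply_self (by simp) hinv, ?_⟩
  filter_upwards [hh.eventually_apply_implicitFunction (by simp) hinv] with s hs
  simp only [h, hfx, sub_self] at hs
  linarith

theorem compWord_replicate {Λ : Type*} (φ : Λ → ℝ → ℝ) (a : Λ) (n : ℕ) :
    compWord φ (List.replicate n a) = (φ a)^[n] := by
  induction n with
  | zero => rfl
  | succ n ih => rw [List.replicate_succ, compWord, ih, Function.iterate_succ']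

theorem iterPoint_const {Λ : Type*} (φ : Λ → ℝ → ℝ → ℝ) (a : Λ) (t : ℝ) (n : ℕ) :
    iterPoint φ (fun _ => a) t n = (φ a t)^[n + 1] 0 := by
  rw [iterPoint, List.ofFn_const, compWord_replicate]

theorem common_fixed_point_parameters_finite
    {Λ : Type} [Fintype Λ] (hcard : 2 ≤ Fintype.card Λ)
    (φ : Λ → ℝ → ℝ → ℝ)
    (hanal : ∀ i, AnalyticOnNhd ℝ (fun q : ℝ × ℝ => φ i q.1 q.2) (unitI ×ˢ unitI))
    (hmaps : ∀ i, ∀ t ∈ unitI, ∀ x ∈ unitI, φ i t x ∈ Set.Ioo (0 : ℝ) 1)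
    (hderiv : ∀ i, ∀ t ∈ unitI, ∀ x ∈ unitI,
      0 < |deriv (φ i t) x| ∧ |deriv (φ i t) x| < 1)
    -- non-degeneracy: for distinct ω, η the function `F_{ω,η}` is not identically zero
    (hnondeg : ∀ ω η : ℕ → Λ, ω ≠ η → ∃ t ∈ unitI,
      ¬ Tendsto (fun n : ℕ => iterPoint φ ω t n - iterPoint φ η t n) atTop (nhds 0)) :
    Set.Finite {t | t ∈ unitI ∧ ∃ x ∈ unitI, ∀ i, φ i t x = x} := by
  have hslice : ∀ i, ∀ t ∈ unitI, AnalyticOnNhd ℝ (φ i t) unitI := fun i t ht x hx =>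
    (hanal i (t, x) ⟨ht, hx⟩).comp₂ analyticAt_const analyticAt_id
  have hself : ∀ i, ∀ t ∈ unitI, MapsTo (φ i t) unitI unitI := fun i t ht x hx =>
    Ioo_subset_Icc_self (hmaps i t ht x hx)
  have hlt : ∀ i, ∀ t ∈ unitI, ∀ x ∈ unitI, |deriv (φ i t) x| < 1 := fun i t ht x hx =>
    (hderiv i t ht x hx).2
  have hex : ∀ i, ∀ t : unitI, ∃ x ∈ unitI, φ i t x = x := fun i t =>
    exists_fixedPoint (hslice i t t.2) (hself i t t.2)
  choose p hpI hp using hex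
  have hlocal : ∀ i, ∀ t : unitI, ∃ g : ℝ → ℝ, AnalyticAt ℝ g t ∧ ∀ᶠ s : unitI in 𝓝 t,
      p i s = g s := by
    intro i t
    have hne : deriv (fun y => φ i t y) (p i t) ≠ 1 := fun h => by
      have := hlt i t t.2 _ (hpI i t)
      rw [show deriv (φ i t) (p i t) = 1 from h] at this
      simp at this
    obtain ⟨g, hg, hgt, hfix⟩ := exists_analyticAt_fixedPoint (f := fun q => φ i q.1 q.2)
      (hanal i (t, p i t) ⟨t.2, hpI i t⟩) (hp i t) hne
    refine ⟨g, hg, ?_⟩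
    have hmem : ∀ᶠ s in 𝓝 (t : ℝ), g s ∈ Ioo (0 : ℝ) 1 := by
      refine hg.continuousAt.eventually_mem (isOpen_Ioo.mem_nhds ?_)
      rw [hgt, ← hp i t]
      exact hmaps i t t.2 _ (hpI i t)
    filter_upwards [continuous_subtype_val.continuousAt.eventually (hfix.and hmem)] with s hs
    exact fixedPoint_unique (hslice i s s.2) (hlt i s s.2) (hpI i s)
      (Ioo_subset_Icc_self hs.2) (hp i s) hs.1
  obtain ⟨a, b, hab⟩ := Fintype.exists_pair_of_one_lt_card (by omega : 1 < Fintype.card Λ)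
  have hdich : ∀ t : unitI, (∀ᶠ s in 𝓝 t, p a s - p b s = 0) ∨
      ∀ᶠ s in 𝓝[≠] t, p a s - p b s ≠ 0 := by
    intro t
    obtain ⟨g, hg, hpg⟩ := hlocal a t
    obtain ⟨k, hk, hpk⟩ := hlocal b t
    refine (hg.sub hk).eventually_eq_zero_or_eventually_ne_zero.imp (fun h => ?_) (fun h => ?_)
    · filter_upwards [hpg, hpk, continuous_subtype_val.continuousAt.eventually h] with s h1 h2 h3
      rw [h1, h2]
      exact h3
    · rw [eventually_nhdsWithin_iff] at h ⊢
      filter_upwards [hpg, hpk, continuous_subtype_val.continuousAt.eventually h]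
        with s h1 h2 h3 hst
      rw [h1, h2]
      exact h3 fun hs => hst (Subtype.ext hs)
  have : CompactSpace unitI := isCompact_iff_compactSpace.1 isCompact_Icc
  have : PreconnectedSpace unitI := isPreconnected_iff_preconnectedSpace.1 isPreconnected_Icc
  have : ∀ t : unitI, NeBot (𝓝[≠] t) := fun t =>
    inferInstanceAs (NeBot (𝓝[≠] (show Icc (0 : ℝ) 1 from t)))
  rcases finite_zeros_or_eq_zero hdich with hfin | hzero
  · refine (hfin.image Subtype.val).subset ?_
    rintro t ⟨ht, x, hx, hfix⟩
    have heq : ∀ i, p i ⟨t, ht⟩ = x := fun i => fixedPoint_unique (hslice i t ht) (hlt i t ht)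
      (hpI i ⟨t, ht⟩) hx (hp i ⟨t, ht⟩) (hfix i)
    exact ⟨⟨t, ht⟩, by simp [heq], rfl⟩
  · obtain ⟨t, ht, hnot⟩ := hnondeg (fun _ => a) (fun _ => b) fun h => hab (congrFun h 0)
    refine absurd ?_ hnot
    have hlim : ∀ i, Tendsto (iterPoint φ (fun _ => i) t) atTop (𝓝 (p i ⟨t, ht⟩)) := by
      intro i
      rw [funext (iterPoint_const φ i t)]
      have h0 : (0 : ℝ) ∈ unitI := left_mem_Icc.2 zero_le_one
      have h := (tendsto_iterate_fixedPoint (hslice i t ht) (hlt i t ht) (hself i t ht)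
        (hpI i ⟨t, ht⟩) h0 (hp i ⟨t, ht⟩)).comp (tendsto_add_atTop_nat 1)
      exact h
    simpa only [hzero] using (hlim a).sub (hlim b)
end
end

section
/- Let Φ={φ_i}_{i∈Λ} be an analytic IFS on I=[0,1] with 0<|φ_i'(x)|<1 for all i∈Λ and x∈I. Then there exists a constant C>1 such that: (1) |φ_u'(x)| ≤ C|φ_u'(y)| for all finite words u∈Λ* and all x,y∈I (bounded distortion); and (2) |φ_u^{(k)}(x)| ≤ k!·C^k·|φ_u'(0)| for all u∈Λ*, all integers k≥1, and all x∈I, where φ_u^{(k)} is the k-th derivative of φ_u. -/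
open MeasureTheory Filter Set Metric Topology

noncomputable section

/-- The compositions of `n + 1` correspond to the subsets of `Fin n`, the number of blocks being
one more than the cardinality of the subset. -/
theorem card_compositionAsSetEquiv {n : ℕ} (c : CompositionAsSet (n + 1)) :
    (compositionAsSetEquiv (n + 1) c).card + 1 = c.length := by
  obtain ⟨s : Finset (Fin n), rfl⟩ := (compositionAsSetEquiv (n + 1)).symm.surjective c
  rw [Equiv.apply_symm_apply]
  obtain ⟨e, he⟩ : ∃ e : Fin n ↪ Fin (n + 2), ∀ j, (e j : ℕ) = j + 1 :=
    ⟨⟨fun j => j.castSucc.succ, fun a b h => by simpa using h⟩, fun _ => rfl⟩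
  have hdef : ((compositionAsSetEquiv (n + 1)).symm s).boundaries =
      { i : Fin (n + 2) | i = 0 ∨ i = Fin.last (n + 1) ∨
        ∃ (j : Fin n) (_ : j ∈ s), (i : ℕ) = j + 1 }.toFinset := rfl
  have hinsert : ((compositionAsSetEquiv (n + 1)).symm s).boundaries =
      insert 0 (insert (Fin.last (n + 1)) (s.map e)) := by
    ext i
    have hei : ∀ j, e j = i ↔ (i : ℕ) = j + 1 := fun j => by rw [Fin.ext_iff, he, eq_comm]
    rw [hdef]
    simp [hei]
  have hlast : Fin.last (n + 1) ∉ s.map e := by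
    simp only [Finset.mem_map, not_exists, not_and]
    intro j _ hj
    have := he j
    rw [hj, Fin.val_last] at this
    omega
  have hzero : (0 : Fin (n + 2)) ∉ insert (Fin.last (n + 1)) (s.map e) := by
    simp only [Finset.mem_insert, Finset.mem_map, not_or, not_exists, not_and]
    refine ⟨(Fin.last_pos).ne, fun j _ hj => ?_⟩
    have := he j
    rw [hj, Fin.val_zero] at this
    omega
  have h := CompositionAsSet.card_boundaries_eq_succ_length ((compositionAsSetEquiv (n + 1)).symm s)
  rw [hinsert, Finset.card_insert_of_notMem hzero, Finset.card_insert_of_notMem hlast,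
    Finset.card_map] at h
  omega

theorem sum_composition_pow_mul_pow (n : ℕ) (x y : ℝ) :
    ∑ c : Composition (n + 1), x ^ (c.length - 1) * y ^ (n + 1 - c.length) = (x + y) ^ n := by
  rw [← Fin.sum_pow_mul_eq_add_pow]
  refine Fintype.sum_equiv ((compositionEquiv (n + 1)).trans (compositionAsSetEquiv (n + 1)))
    _ _ fun c => ?_
  have h := card_compositionAsSetEquiv (compositionEquiv (n + 1) c)
  have h' : (compositionEquiv (n + 1) c).length = c.length := c.toCompositionAsSet_length
  rw [h'] at h
  simp only [Equiv.trans_apply, ← h, add_tsub_cancel_right, Nat.add_sub_add_right]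

/-- The Taylor coefficients of `f` at `x` are dominated by those of `a z / (1 - M z)`. -/
def MajorizedAt (f : ℝ → ℝ) (x a M : ℝ) : Prop :=
  ∃ p : FormalMultilinearSeries ℝ ℝ ℝ, HasFPowerSeriesAt f p x ∧ ∀ n, ‖p (n + 1)‖ ≤ a * M ^ n

namespace MajorizedAt

variable {f g : ℝ → ℝ} {x a b M N : ℝ}

theorem mono (h : MajorizedAt f x a M) (ha : 0 ≤ a) (hM : 0 ≤ M) (hMN : M ≤ N) :
    MajorizedAt f x a N := by
  obtain ⟨p, hp, hb⟩ := h
  exact ⟨p, hp, fun n => (hb n).trans (by gcongr)⟩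

/-- The majorants `a z / (1 - M z)` compose as Möbius transformations. -/
theorem comp (hf : MajorizedAt f (g x) a M) (hg : MajorizedAt g x b N)
    (ha : 0 ≤ a) (hM : 0 ≤ M) :
    MajorizedAt (f ∘ g) x (a * b) (M * b + N) := by
  obtain ⟨p, hp, hpb⟩ := hf
  obtain ⟨q, hq, hqb⟩ := hg
  refine ⟨p.comp q, hp.comp hq, fun n => ?_⟩
  rw [← sum_composition_pow_mul_pow, Finset.mul_sum]
  refine (norm_sum_le _ _).trans (Finset.sum_le_sum fun c _ => ?_)
  refine (p.compAlongComposition_norm q c).trans ?_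
  have hlen : 0 < c.length := c.length_pos_of_pos n.succ_pos
  have hp' : ‖p c.length‖ ≤ a * M ^ (c.length - 1) := by
    have := hpb (c.length - 1)
    rwa [Nat.sub_add_cancel hlen] at this
  have hq' : ∏ i, ‖q (c.blocksFun i)‖ ≤ b ^ c.length * N ^ (n + 1 - c.length) := by
    calc ∏ i, ‖q (c.blocksFun i)‖ ≤ ∏ i, b * N ^ (c.blocksFun i - 1) := by
          refine Finset.prod_le_prod (fun _ _ => norm_nonneg _) fun i _ => ?_
          have := hqb (c.blocksFun i - 1)
          rwa [Nat.sub_add_cancel (c.one_le_blocksFun i)] at this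
      _ = b ^ c.length * N ^ (n + 1 - c.length) := by
          rw [Finset.prod_mul_distrib, Finset.prod_pow_eq_pow_sum,
            Finset.sum_tsub_distrib _ fun i _ => c.one_le_blocksFun i, c.sum_blocksFun]
          simp
  calc ‖p c.length‖ * ∏ i, ‖q (c.blocksFun i)‖
      ≤ (a * M ^ (c.length - 1)) * (b ^ c.length * N ^ (n + 1 - c.length)) :=
        mul_le_mul hp' hq' (Finset.prod_nonneg fun _ _ => norm_nonneg _) (by positivity)
    _ = a * b * ((M * b) ^ (c.length - 1) * N ^ (n + 1 - c.length)) := by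
        obtain ⟨l, hl⟩ := Nat.exists_eq_add_of_lt hlen
        simp only [hl, zero_add, add_tsub_cancel_right]
        ring

theorem abs_iteratedDeriv_le (h : MajorizedAt f x a M) (n : ℕ) :
    |iteratedDeriv (n + 1) f x| ≤ (n + 1).factorial * (a * M ^ n) := by
  obtain ⟨p, ⟨r, hp⟩, hb⟩ := h
  have hfac := hp.factorial_smul 1 (n + 1)
  rw [iteratedDeriv_eq_iteratedFDeriv, ← hfac, nsmul_eq_mul, abs_mul, Nat.abs_cast]
  gcongr
  refine le_trans ?_ (hb n)
  exact ((p (n + 1)).le_opNorm fun _ => 1).trans_eq (by simp)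

protected theorem id (x : ℝ) : MajorizedAt id x 1 0 := by
  refine ⟨_, (ContinuousLinearMap.id ℝ ℝ).hasFPowerSeriesAt x, fun n => ?_⟩
  cases n with
  | zero => simp [ContinuousLinearMap.fpowerSeries]
  | succ n => simp [ContinuousLinearMap.fpowerSeries]

end MajorizedAt

/-- Cauchy-type estimates for the Taylor coefficients hold uniformly near a point of analyticity. -/
theorem AnalyticAt.eventually_hasFPowerSeriesAt_norm_le {f : ℝ → ℝ} {x : ℝ}
    (hf : AnalyticAt ℝ f x) :
    ∃ A : ℝ, 1 ≤ A ∧ ∀ᶠ y in 𝓝 x, ∃ p : FormalMultilinearSeries ℝ ℝ ℝ,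
      HasFPowerSeriesAt f p y ∧ ∀ n, ‖p n‖ ≤ A ^ (n + 1) := by
  obtain ⟨p, r, hp⟩ := hf
  obtain ⟨s, hs0, hsr⟩ := ENNReal.lt_iff_exists_nnreal_btwn.1 hp.r_pos
  have hs0' : 0 < s := by exact_mod_cast hs0
  have hlt : ((s / 2 : NNReal) : ENNReal) + (s / 2 : NNReal) < p.radius := by
    rw [← ENNReal.coe_add, add_halves]
    exact hsr.trans_le hp.r_le
  have hsum := p.changeOriginSeries_summable_aux₁ hlt
  set t : NNReal := s / 2 with ht
  have ht0 : 0 < t := by positivity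
  set S := ∑' i : Σ k l : ℕ, { s : Finset (Fin (k + l)) // s.card = l },
    ‖p (i.1 + i.2.1)‖₊ * t ^ i.2.1 * t ^ i.1 with hS
  have hts : t < s := by rw [ht]; exact half_lt_self hs0'
  set A : NNReal := max (max 1 S) t⁻¹ with hA
  have hA1 : 1 ≤ A := (le_max_left _ _).trans (le_max_left _ _)
  refine ⟨A, by exact_mod_cast hA1, ?_⟩
  filter_upwards [Metric.ball_mem_nhds x (NNReal.coe_pos.2 ht0)] with y hy
  have hyt : ‖y - x‖₊ < t := by
    rw [← NNReal.coe_lt_coe, coe_nnnorm]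
    simpa [dist_eq_norm] using hy
  have hyr : ((‖y - x‖₊ : NNReal) : ENNReal) < r :=
    (ENNReal.coe_lt_coe.2 (hyt.trans hts)).trans hsr
  refine ⟨p.changeOrigin (y - x), ?_, fun n => ?_⟩
  · simpa using (hp.changeOrigin hyr).hasFPowerSeriesAt
  have h1 := p.nnnorm_changeOrigin_le n (hyr.trans_le hp.r_le)
  have htr : (t : ENNReal) < p.radius :=
    (ENNReal.coe_lt_coe.2 hts).trans (hsr.trans_le hp.r_le)
  have hmul : ‖p.changeOrigin (y - x) n‖₊ * t ^ n ≤ S := by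
    calc ‖p.changeOrigin (y - x) n‖₊ * t ^ n
        ≤ (∑' i : Σ l : ℕ, { s : Finset (Fin (n + l)) // s.card = l },
            ‖p (n + i.1)‖₊ * t ^ i.1) * t ^ n := by
          gcongr
          refine h1.trans (Summable.tsum_le_tsum (fun i => ?_)
            (p.changeOriginSeries_summable_aux₂ (hyr.trans_le hp.r_le) n)
            (p.changeOriginSeries_summable_aux₂ htr n))
          gcongr
      _ = ∑' i : Σ l : ℕ, { s : Finset (Fin (n + l)) // s.card = l },
            ‖p (n + i.1)‖₊ * t ^ i.1 * t ^ n := NNReal.tsum_mul_right _ _ |>.symm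
      _ ≤ S := by
          rw [hS, hsum.tsum_sigma' (NNReal.summable_sigma.1 hsum).1]
          exact (NNReal.summable_sigma.1 hsum).2.le_tsum' n
  have hfin : ‖p.changeOrigin (y - x) n‖₊ ≤ A ^ (n + 1) := by
    calc ‖p.changeOrigin (y - x) n‖₊ = ‖p.changeOrigin (y - x) n‖₊ * t ^ n * t⁻¹ ^ n := by
          rw [mul_assoc, ← mul_pow, mul_inv_cancel₀ ht0.ne', one_pow, mul_one]
      _ ≤ A * A ^ n := by
          gcongr
          · exact hmul.trans ((le_max_right _ _).trans (le_max_left _ _))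
          · exact le_max_right _ _
      _ = A ^ (n + 1) := by ring
  exact_mod_cast hfin

theorem IsCompact.exists_hasFPowerSeriesAt_norm_le {f : ℝ → ℝ} {K : Set ℝ} (hK : IsCompact K)
    (hf : AnalyticOnNhd ℝ f K) :
    ∃ A : ℝ, 1 ≤ A ∧ ∀ y ∈ K, ∃ p : FormalMultilinearSeries ℝ ℝ ℝ,
      HasFPowerSeriesAt f p y ∧ ∀ n, ‖p n‖ ≤ A ^ (n + 1) := by
  refine hK.induction_on ⟨1, le_rfl, by simp⟩ ?_ ?_ ?_
  · rintro s t hst ⟨A, hA, h⟩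
    exact ⟨A, hA, fun y hy => h y (hst hy)⟩
  · rintro s t ⟨A, hA, h⟩ ⟨B, hB, h'⟩
    refine ⟨max A B, hA.trans (le_max_left _ _), ?_⟩
    rintro y (hy | hy)
    · obtain ⟨p, hp, hb⟩ := h y hy
      exact ⟨p, hp, fun n => (hb n).trans (by gcongr; exact le_max_left _ _)⟩
    · obtain ⟨p, hp, hb⟩ := h' y hy
      exact ⟨p, hp, fun n => (hb n).trans (by gcongr; exact le_max_right _ _)⟩
  · intro x hx
    obtain ⟨A, hA, h⟩ := (hf x hx).eventually_hasFPowerSeriesAt_norm_le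
    exact ⟨_, mem_nhdsWithin_of_mem_nhds h, A, hA, fun y hy => hy⟩

theorem isCompact_unitI : IsCompact unitI := isCompact_Icc

theorem zero_mem_unitI : (0 : ℝ) ∈ unitI := by simp [unitI]

/-- A single analytic contraction without critical points is uniformly majorized on `unitI`. -/
theorem exists_majorizedAt_of_analyticOnNhd {f : ℝ → ℝ} (hf : AnalyticOnNhd ℝ f unitI)
    (hd : ∀ x ∈ unitI, 0 < |deriv f x| ∧ |deriv f x| < 1) :
    ∃ M r : ℝ, 0 ≤ M ∧ r < 1 ∧
      ∀ x ∈ unitI, |deriv f x| ≤ r ∧ MajorizedAt f x |deriv f x| M := by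
  have hcont : ContinuousOn (fun x => |deriv f x|) unitI := hf.deriv.continuousOn.abs
  obtain ⟨u, hu, hmax⟩ := isCompact_unitI.exists_isMaxOn ⟨0, zero_mem_unitI⟩ hcont
  obtain ⟨v, hv, hmin⟩ := isCompact_unitI.exists_isMinOn ⟨0, zero_mem_unitI⟩ hcont
  obtain ⟨A, hA, hbound⟩ := isCompact_unitI.exists_hasFPowerSeriesAt_norm_le hf
  have hA0 : 0 < A := by linarith
  set m := |deriv f v| with hm
  have hm0 : 0 < m := (hd v hv).1
  have hm1 : m ≤ 1 := (hd v hv).2.le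
  refine ⟨A ^ 3 / m, |deriv f u|, by positivity, (hd u hu).2, fun x hx => ⟨hmax hx, ?_⟩⟩
  obtain ⟨p, hp, hb⟩ := hbound x hx
  refine ⟨p, hp, fun n => ?_⟩
  cases n with
  | zero =>
    rw [hp.deriv, zero_add, FormalMultilinearSeries.norm_apply_eq_norm_coef, pow_zero, mul_one]
    exact le_of_eq rfl
  | succ n =>
    calc ‖p (n + 1 + 1)‖ ≤ A ^ (n + 1 + 1 + 1) := hb _
      _ ≤ A ^ (3 * (n + 1)) := pow_le_pow_right₀ hA (by omega)
      _ ≤ A ^ (3 * (n + 1)) / m ^ n :=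
        le_div_self (by positivity) (by positivity) (pow_le_one₀ hm0.le hm1)
      _ = m * (A ^ 3 / m) ^ (n + 1) := by
        rw [div_pow, ← pow_mul, pow_succ m]
        field_simp
      _ ≤ |deriv f x| * (A ^ 3 / m) ^ (n + 1) := by
        gcongr
        exact hmin hx

section compWord

variable {Λ : Type*} {φ : Λ → ℝ → ℝ}

theorem mapsTo_compWord (hmaps : ∀ i, Set.MapsTo (φ i) unitI unitI) (u : List Λ) :
    Set.MapsTo (compWord φ u) unitI unitI := by
  induction u with
  | nil => exact Set.mapsTo_id _
  | cons i u ih => exact (hmaps i).comp ih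

theorem analyticOnNhd_compWord (hanal : ∀ i, AnalyticOnNhd ℝ (φ i) unitI)
    (hmaps : ∀ i, Set.MapsTo (φ i) unitI unitI) (u : List Λ) :
    AnalyticOnNhd ℝ (compWord φ u) unitI := by
  induction u with
  | nil => exact analyticOnNhd_id
  | cons i u ih => exact (hanal i).comp ih (mapsTo_compWord hmaps u)

/-- If every map is majorized with constant `K * (1 - |deriv (φ i)|)`, so is every composition. -/
theorem majorizedAt_compWord {K : ℝ} (hK : 0 ≤ K) (hanal : ∀ i, AnalyticOnNhd ℝ (φ i) unitI)
    (hmaps : ∀ i, Set.MapsTo (φ i) unitI unitI)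
    (hderiv : ∀ i, ∀ x ∈ unitI, 0 < |deriv (φ i) x| ∧ |deriv (φ i) x| < 1)
    (hmaj : ∀ i, ∀ x ∈ unitI,
      MajorizedAt (φ i) x |deriv (φ i) x| (K * (1 - |deriv (φ i) x|)))
    (u : List Λ) {x : ℝ} (hx : x ∈ unitI) :
    0 < |deriv (compWord φ u) x| ∧ |deriv (compWord φ u) x| ≤ 1 ∧
      MajorizedAt (compWord φ u) x |deriv (compWord φ u) x|
        (K * (1 - |deriv (compWord φ u) x|)) := by
  induction u with
  | nil => simpa [compWord] using MajorizedAt.id x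
  | cons i u ih =>
    obtain ⟨hpos, hle, hu⟩ := ih
    have hy := mapsTo_compWord hmaps u hx
    obtain ⟨hipos, hilt⟩ := hderiv i _ hy
    have hchain : |deriv (compWord φ (i :: u)) x| =
        |deriv (φ i) (compWord φ u x)| * |deriv (compWord φ u) x| := by
      rw [compWord, deriv_comp x (hanal i _ hy).differentiableAt
        (analyticOnNhd_compWord hanal hmaps u x hx).differentiableAt, abs_mul]
    have hcomp := (hmaj i _ hy).comp hu hipos.le
      (mul_nonneg hK (sub_nonneg.2 hilt.le))
    rw [hchain]
    refine ⟨by positivity, mul_le_one₀ hilt.le hpos.le hle, ?_⟩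
    have hconst : K * (1 - |deriv (φ i) (compWord φ u x)| * |deriv (compWord φ u) x|) =
        K * (1 - |deriv (φ i) (compWord φ u x)|) * |deriv (compWord φ u) x| +
          K * (1 - |deriv (compWord φ u) x|) := by ring
    rw [hconst]
    exact hcomp

end compWord

/-- A function with nonvanishing derivative whose second derivative is bounded by `B` times the
first one has bounded distortion. -/
theorem abs_deriv_le_exp_mul_of_abs_deriv_deriv_le {f : ℝ → ℝ} {B : ℝ} (hB : 0 ≤ B)
    (hf : AnalyticOnNhd ℝ f unitI) (hpos : ∀ x ∈ unitI, 0 < |deriv f x|)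
    (hbound : ∀ x ∈ unitI, |deriv (deriv f) x| ≤ B * |deriv f x|)
    {x y : ℝ} (hx : x ∈ unitI) (hy : y ∈ unitI) :
    |deriv f x| ≤ Real.exp B * |deriv f y| := by
  have hlog : ∀ z ∈ unitI, HasDerivWithinAt (fun z => Real.log (deriv f z))
      (deriv (deriv f) z / deriv f z) unitI z := fun z hz =>
    ((hf.deriv z hz).differentiableAt.hasDerivAt.log (abs_pos.1 (hpos z hz))).hasDerivWithinAt
  have hlip := Convex.norm_image_sub_le_of_norm_hasDerivWithin_le hlog
    (fun z hz => by
      rw [Real.norm_eq_abs, abs_div, div_le_iff₀ (hpos z hz)]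
      exact hbound z hz) (convex_Icc 0 1) hy hx
  have hxy : ‖x - y‖ ≤ 1 := by
    rw [Real.norm_eq_abs, abs_le]
    constructor <;> linarith [hx.1, hx.2, hy.1, hy.2]
  have hle : Real.log |deriv f x| ≤ B + Real.log |deriv f y| := by
    rw [Real.log_abs, Real.log_abs]
    have := (le_abs_self _).trans (hlip.trans (mul_le_of_le_one_right hB hxy))
    linarith
  rw [← Real.exp_log (hpos x hx), ← Real.exp_log (hpos y hy), ← Real.exp_add]
  exact Real.exp_le_exp.2 hle

theorem bounded_distortion
    {Λ : Type} [Fintype Λ] [Nonempty Λ]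
    (φ : Λ → ℝ → ℝ)
    (hanal : ∀ i, AnalyticOnNhd ℝ (φ i) unitI)
    (hmaps : ∀ i, Set.MapsTo (φ i) unitI unitI)
    (hderiv : ∀ i, ∀ x ∈ unitI, 0 < |deriv (φ i) x| ∧ |deriv (φ i) x| < 1) :
    ∃ C : ℝ, 1 < C ∧
      (∀ u : List Λ, ∀ x ∈ unitI, ∀ y ∈ unitI,
        |deriv (compWord φ u) x| ≤ C * |deriv (compWord φ u) y|) ∧
      (∀ u : List Λ, ∀ k : ℕ, 1 ≤ k → ∀ x ∈ unitI,
        |iteratedDeriv k (compWord φ u) x| ≤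
          (k.factorial : ℝ) * C ^ k * |deriv (compWord φ u) 0|) := by
  choose M r hM hr hMr using fun i => exists_majorizedAt_of_analyticOnNhd (hanal i) (hderiv i)
  have hQ : ∀ i, 0 ≤ M i / (1 - r i) := fun i => div_nonneg (hM i) (sub_nonneg.2 (hr i).le)
  set K := ∑ i, M i / (1 - r i) with hKdef
  have hK : 0 ≤ K := Finset.sum_nonneg fun i _ => hQ i
  have hmaj : ∀ i, ∀ x ∈ unitI,
      MajorizedAt (φ i) x |deriv (φ i) x| (K * (1 - |deriv (φ i) x|)) := by
    intro i x hx
    refine (hMr i x hx).2.mono (abs_nonneg _) (hM i) ?_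
    calc M i = M i / (1 - r i) * (1 - r i) := (div_mul_cancel₀ _ (sub_pos.2 (hr i)).ne').symm
      _ ≤ K * (1 - |deriv (φ i) x|) := by
        refine mul_le_mul (Finset.single_le_sum (fun j _ => hQ j) (Finset.mem_univ i)) ?_
          (sub_nonneg.2 (hr i).le) hK
        linarith [(hMr i x hx).1]
  have hiter : ∀ u : List Λ, ∀ x ∈ unitI, ∀ n : ℕ, |iteratedDeriv (n + 1) (compWord φ u) x| ≤
      (n + 1).factorial * (|deriv (compWord φ u) x| * K ^ n) := by
    intro u x hx n
    obtain ⟨hpos, hle, h⟩ := majorizedAt_compWord hK hanal hmaps hderiv hmaj u hx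
    exact (h.mono hpos.le (mul_nonneg hK (sub_nonneg.2 hle))
      (mul_le_of_le_one_right hK (by linarith))).abs_iteratedDeriv_le n
  have hdist : ∀ u : List Λ, ∀ x ∈ unitI, ∀ y ∈ unitI,
      |deriv (compWord φ u) x| ≤ Real.exp (2 * K) * |deriv (compWord φ u) y| := by
    intro u x hx y hy
    refine abs_deriv_le_exp_mul_of_abs_deriv_deriv_le (by positivity)
      (analyticOnNhd_compWord hanal hmaps u)
      (fun z hz => (majorizedAt_compWord hK hanal hmaps hderiv hmaj u hz).1) (fun z hz => ?_) hx hy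
    have := hiter u z hz 1
    rw [iteratedDeriv_succ, iteratedDeriv_one] at this
    refine this.trans_eq ?_
    norm_num
    ring
  have hexp := Real.exp_pos (2 * K)
  refine ⟨Real.exp (2 * K) + K + 1, by linarith, fun u x hx y hy => ?_, fun u k hk x hx => ?_⟩
  · exact (hdist u x hx y hy).trans (by gcongr; linarith)
  · obtain ⟨n, rfl⟩ := Nat.exists_eq_add_of_le' hk
    calc |iteratedDeriv (n + 1) (compWord φ u) x|
        ≤ (n + 1).factorial * (|deriv (compWord φ u) x| * K ^ n) := hiter u x hx n
      _ ≤ (n + 1).factorial * ((Real.exp (2 * K) * |deriv (compWord φ u) 0|) * K ^ n) := by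
        gcongr
        exact hdist u x hx 0 zero_mem_unitI
      _ = (n + 1).factorial * (K ^ n * Real.exp (2 * K)) * |deriv (compWord φ u) 0| := by ring
      _ ≤ (n + 1).factorial * (Real.exp (2 * K) + K + 1) ^ (n + 1) *
          |deriv (compWord φ u) 0| := by
        rw [pow_succ]
        gcongr <;> linarith
end
end

section
/- For every d≥1 there is a constant K_d>0 such that the following holds. Let θ be a compactly supported Borel probability measure on ℝ^d, let C>1, and let f:supp(θ)→ℝ^d be bi-Lipschitz with constant C, i.e. C^{-1}|x−y| ≤ |f(x)−f(y)| ≤ C|x−y| for all x,y∈supp(θ). Then for every n≥0, |H(fθ, D_n) − H(θ, D_n)| ≤ K_d(1+log C). -/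
open MeasureTheory Filter Set Metric Topology

noncomputable section

/-- The level-`n` dyadic cell of `ℝ^d` indexed by `m : Fin d → ℤ`. -/
def vcell (d n : ℕ) (m : Fin d → ℤ) : Set (EuclideanSpace ℝ (Fin d)) :=
  {x | ∀ j, x j ∈ Set.Ico ((m j : ℝ) / 2 ^ n) (((m j : ℝ) + 1) / 2 ^ n)}

/-- Entropy of a measure on `ℝ^d` with respect to the level-`n` dyadic partition
(logarithms in base 2). -/
def entV (d n : ℕ) (θ : Measure (EuclideanSpace ℝ (Fin d))) : ℝ :=
  -∑' m : Fin d → ℤ,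
    (θ (vcell d n m)).toReal * Real.logb 2 (θ (vcell d n m)).toReal

/-- The topological support of a measure. -/
def msupp {X : Type*} [TopologicalSpace X] [MeasurableSpace X] (θ : Measure X) : Set X :=
  {x | ∀ U : Set X, IsOpen U → x ∈ U → θ U ≠ 0}

open Real (negMulLog)

theorem sum_negMulLog_le_of_card_support_le {β : Type*} (B : Finset β) (q : β → ℝ)
    (hq : ∀ j, 0 ≤ q j) {N : ℝ} (hN : 0 < N) (hcard : ((B.filter (q · ≠ 0)).card : ℝ) ≤ N) :
    ∑ j ∈ B, negMulLog (q j) ≤ negMulLog (∑ j ∈ B, q j) + (∑ j ∈ B, q j) * Real.log N := by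
  set F := B.filter (q · ≠ 0) with hF
  have h1 : ∑ j ∈ B, negMulLog (q j) = ∑ j ∈ F, negMulLog (q j) := by
    refine (Finset.sum_filter_of_ne (p := (q · ≠ 0)) fun j _ h h0 => h ?_).symm
    simp [h0]
  have h2 : ∑ j ∈ B, q j = ∑ j ∈ F, q j :=
    (Finset.sum_filter_of_ne (p := (q · ≠ 0)) fun j _ h => h).symm
  rw [h1, h2]
  set a := ∑ j ∈ F, q j with ha
  have ha0 : 0 ≤ a := Finset.sum_nonneg fun j _ => hq j
  have key : ∀ j ∈ F, negMulLog (q j) ≤ q j * (-Real.log a + Real.log N) + (a / N - q j) := by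
    intro j hj
    have hqj : 0 < q j := lt_of_le_of_ne (hq j) (Ne.symm (Finset.mem_filter.1 hj).2)
    have hapos : 0 < a := hqj.trans_le (Finset.single_le_sum (fun j _ => hq j) hj)
    have h := Real.log_le_sub_one_of_pos (x := a / (N * q j)) (by positivity)
    rw [Real.log_div hapos.ne' (by positivity), Real.log_mul hN.ne' hqj.ne'] at h
    have h' := mul_le_mul_of_nonneg_left h hqj.le
    have e : q j * (a / (N * q j) - 1) = a / N - q j := by field_simp
    rw [e] at h'
    unfold negMulLog
    linarith
  calc ∑ j ∈ F, negMulLog (q j)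
      ≤ ∑ j ∈ F, (q j * (-Real.log a + Real.log N) + (a / N - q j)) := Finset.sum_le_sum key
    _ = a * (-Real.log a + Real.log N) + (F.card * (a / N) - a) := by
        rw [Finset.sum_add_distrib, ← Finset.sum_mul, Finset.sum_sub_distrib]
        simp [ha]
    _ ≤ negMulLog a + a * Real.log N := by
        have : F.card * (a / N) ≤ N * (a / N) := by gcongr
        rw [mul_div_cancel₀ _ hN.ne'] at this
        unfold negMulLog
        linarith

theorem negMulLog_sum_le {α : Type*} (A : Finset α) (q : α → ℝ) (hq : ∀ i, 0 ≤ q i) :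
    negMulLog (∑ i ∈ A, q i) ≤ ∑ i ∈ A, negMulLog (q i) := by
  rw [negMulLog, neg_mul, Finset.sum_mul, ← Finset.sum_neg_distrib]
  refine Finset.sum_le_sum fun i hi => ?_
  rcases (hq i).eq_or_lt with h | h
  · simp [← h]
  · have := Real.log_le_log h (Finset.single_le_sum (fun j _ => hq j) hi)
    have := mul_le_mul_of_nonneg_left this h.le
    rw [negMulLog]
    linarith

theorem sum_negMulLog_marginal_le {α β : Type*} (A : Finset α) (B : Finset β) (q : α → β → ℝ)
    (hq : ∀ i j, 0 ≤ q i j) (hsum : ∑ i ∈ A, ∑ j ∈ B, q i j = 1) {N : ℝ} (hN : 0 < N)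
    (hcard : ∀ i ∈ A, ((B.filter (q i · ≠ 0)).card : ℝ) ≤ N) :
    ∑ j ∈ B, negMulLog (∑ i ∈ A, q i j) ≤
      ∑ i ∈ A, negMulLog (∑ j ∈ B, q i j) + Real.log N := by
  calc ∑ j ∈ B, negMulLog (∑ i ∈ A, q i j)
      ≤ ∑ j ∈ B, ∑ i ∈ A, negMulLog (q i j) :=
        Finset.sum_le_sum fun j _ => negMulLog_sum_le A (q · j) (hq · j)
    _ = ∑ i ∈ A, ∑ j ∈ B, negMulLog (q i j) := Finset.sum_comm
    _ ≤ ∑ i ∈ A, (negMulLog (∑ j ∈ B, q i j) + (∑ j ∈ B, q i j) * Real.log N) :=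
        Finset.sum_le_sum fun i hi =>
          sum_negMulLog_le_of_card_support_le B (q i) (hq i) hN (hcard i hi)
    _ = _ := by rw [Finset.sum_add_distrib, ← Finset.sum_mul, hsum, one_mul]

theorem measureReal_eq_sum_inter_fiber {Ω β : Type*} [MeasurableSpace Ω] (μ : Measure Ω)
    [IsProbabilityMeasure μ] (v : Ω → β) (hv : ∀ b, MeasurableSet (v ⁻¹' {b})) (B : Finset β)
    (hB : ∀ᵐ x ∂μ, v x ∈ B) (s : Set Ω) :
    μ.real s = ∑ b ∈ B, μ.real (s ∩ v ⁻¹' {b}) := by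
  have h := sum_measureReal_preimage_singleton (μ := μ.restrict s) B (f := v)
    (fun b _ => hv b)
  have e : (μ.restrict s).real (v ⁻¹' ↑B) = μ.real s := by
    have : MeasurableSet (v ⁻¹' (B : Set β)) := by
      rw [← Set.biUnion_preimage_singleton]
      exact B.measurableSet_biUnion fun b _ => hv b
    rw [measureReal_restrict_apply this]
    refine measureReal_congr ?_
    filter_upwards [hB] with x hx
    have hx' : x ∈ v ⁻¹' (B : Set β) := hx
    exact propext ⟨fun h => h.2, fun h => ⟨hx', h⟩⟩
  rw [← e, ← h]
  refine Finset.sum_congr rfl fun b _ => ?_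
  rw [measureReal_restrict_apply (hv b), Set.inter_comm]

/-- Entropy, with base-`2` logarithms, of the law of a countably valued map. -/
def fiberEntropy {Ω α : Type*} [MeasurableSpace Ω] (μ : Measure Ω) (u : Ω → α) : ℝ :=
  -∑' a, μ.real (u ⁻¹' {a}) * Real.logb 2 (μ.real (u ⁻¹' {a}))

theorem fiberEntropy_eq_sum {Ω α : Type*} [MeasurableSpace Ω] (μ : Measure Ω) (u : Ω → α)
    (A : Finset α) (hA : ∀ᵐ x ∂μ, u x ∈ A) :
    fiberEntropy μ u = (∑ a ∈ A, negMulLog (μ.real (u ⁻¹' {a}))) / Real.log 2 := by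
  rw [fiberEntropy, tsum_eq_sum (s := A), ← Finset.sum_neg_distrib, Finset.sum_div]
  · refine Finset.sum_congr rfl fun a _ => ?_
    rw [negMulLog, Real.logb]
    ring
  · intro a ha
    have : μ (u ⁻¹' {a}) = 0 := by
      refine measure_mono_null (fun x hx => ?_) (ae_iff.1 hA)
      have : u x = a := hx
      simpa [this] using ha
    simp [measureReal_def, this]

/-- If, off a null set, each value of `u` is compatible with at most `N` values of `v`, then the
entropy of `v` exceeds that of `u` by at most `log N`. -/
theorem fiberEntropy_le_add_logb {Ω α β : Type*} [MeasurableSpace Ω] (μ : Measure Ω)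
    [IsProbabilityMeasure μ] (u : Ω → α) (v : Ω → β) (hu : ∀ a, MeasurableSet (u ⁻¹' {a}))
    (hv : ∀ b, MeasurableSet (v ⁻¹' {b})) (A : Finset α) (B : Finset β)
    (hA : ∀ᵐ x ∂μ, u x ∈ A) (hB : ∀ᵐ x ∂μ, v x ∈ B) {N : ℝ} (hN : 0 < N)
    (hF : ∀ a, ∃ F : Finset β, (F.card : ℝ) ≤ N ∧ ∀ᵐ x ∂μ, u x = a → v x ∈ F) :
    fiberEntropy μ v ≤ fiberEntropy μ u + Real.logb 2 N := by
  have hlog : 0 < Real.log 2 := Real.log_pos one_lt_two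
  rw [fiberEntropy_eq_sum μ u A hA, fiberEntropy_eq_sum μ v B hB, Real.logb, ← add_div]
  refine div_le_div_of_nonneg_right ?_ hlog.le
  have hrow : ∀ a, μ.real (u ⁻¹' {a}) = ∑ b ∈ B, μ.real (u ⁻¹' {a} ∩ v ⁻¹' {b}) := fun a =>
    measureReal_eq_sum_inter_fiber μ v hv B hB _
  have hcol : ∀ b, μ.real (v ⁻¹' {b}) = ∑ a ∈ A, μ.real (u ⁻¹' {a} ∩ v ⁻¹' {b}) := fun b => by
    rw [measureReal_eq_sum_inter_fiber μ u hu A hA]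
    exact Finset.sum_congr rfl fun a _ => by rw [Set.inter_comm]
  simp_rw [hrow, hcol]
  refine sum_negMulLog_marginal_le A B (fun a b => μ.real (u ⁻¹' {a} ∩ v ⁻¹' {b}))
    (fun _ _ => measureReal_nonneg) ?_ hN fun a _ => ?_
  · simp_rw [← hrow]
    have := measureReal_eq_sum_inter_fiber μ u hu A hA Set.univ
    simpa using this.symm
  · obtain ⟨F, hFc, hF⟩ := hF a
    refine le_trans ?_ hFc
    refine Nat.cast_le.2 (Finset.card_le_card fun b hb => ?_)
    by_contra hbF
    refine (Finset.mem_filter.1 hb).2 ?_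
    have : μ (u ⁻¹' {a} ∩ v ⁻¹' {b}) = 0 := by
      refine measure_mono_null (fun x hx => ?_) (ae_iff.1 hF)
      obtain ⟨h1 : u x = a, h2 : v x = b⟩ := hx
      simpa [h1, h2] using hbF
    simp [measureReal_def, this]

/-- The index of the level-`n` dyadic cell containing a point. -/
def dyadicIndex (d n : ℕ) (x : EuclideanSpace ℝ (Fin d)) : Fin d → ℤ := fun j => ⌊x j * 2 ^ n⌋

theorem dyadicIndex_preimage (d n : ℕ) (m : Fin d → ℤ) :
    dyadicIndex d n ⁻¹' {m} = vcell d n m := by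
  ext x
  have h2 : (0 : ℝ) < 2 ^ n := by positivity
  simp only [Set.mem_preimage, Set.mem_singleton_iff, funext_iff, dyadicIndex, Int.floor_eq_iff,
    vcell, Set.mem_ofPred_eq, Set.mem_Ico, div_le_iff₀ h2, lt_div_iff₀ h2]

theorem measurableSet_vcell (d n : ℕ) (m : Fin d → ℤ) : MeasurableSet (vcell d n m) := by
  simp only [vcell, Set.ofPred_forall]
  refine MeasurableSet.iInter fun j => ?_
  have : Measurable fun x : EuclideanSpace ℝ (Fin d) => x j := by fun_prop
  exact this measurableSet_Ico

theorem abs_dyadicIndex_sub_le {d n : ℕ} {x y : EuclideanSpace ℝ (Fin d)} {c : ℝ}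
    (h : dist x y * 2 ^ n ≤ c) (j : Fin d) :
    |((dyadicIndex d n x j - dyadicIndex d n y j : ℤ) : ℝ)| ≤ c + 1 := by
  have h1 : |x j - y j| ≤ dist x y := by
    simpa [dist_eq_norm] using PiLp.norm_apply_le (x - y) j
  have h2 : |x j * 2 ^ n - y j * 2 ^ n| ≤ c := by
    rw [← sub_mul, abs_mul, abs_of_pos (by positivity : (0 : ℝ) < 2 ^ n)]
    exact (mul_le_mul_of_nonneg_right h1 (by positivity)).trans h
  have := Int.floor_le (x j * 2 ^ n)
  have := Int.lt_floor_add_one (x j * 2 ^ n)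
  have := Int.floor_le (y j * 2 ^ n)
  have := Int.lt_floor_add_one (y j * 2 ^ n)
  rw [abs_le] at h2 ⊢
  simp only [dyadicIndex, Int.cast_sub]
  constructor <;> linarith [h2.1, h2.2]

theorem dist_mul_two_pow_le {d n : ℕ} {x y : EuclideanSpace ℝ (Fin d)}
    (h : dyadicIndex d n x = dyadicIndex d n y) : dist x y * 2 ^ n ≤ d := by
  have hj : ∀ j, dist (x j) (y j) * 2 ^ n ≤ 1 := fun j => by
    have h' := congrFun h j
    have := Int.abs_sub_lt_one_of_floor_eq_floor h'
    rw [← sub_mul, abs_mul, abs_of_pos (by positivity : (0 : ℝ) < 2 ^ n)] at this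
    exact this.le
  have h1 : dist x y ≤ ∑ j, dist (x j) (y j) := by
    rw [EuclideanSpace.dist_eq]
    exact Real.sqrt_le_iff.2 ⟨Finset.sum_nonneg fun _ _ => dist_nonneg,
      Finset.sum_sq_le_sq_sum_of_nonneg fun _ _ => dist_nonneg⟩
  calc dist x y * 2 ^ n ≤ (∑ j, dist (x j) (y j)) * 2 ^ n := by gcongr
    _ = ∑ j, dist (x j) (y j) * 2 ^ n := Finset.sum_mul ..
    _ ≤ ∑ _j : Fin d, (1 : ℝ) := Finset.sum_le_sum fun j _ => hj j
    _ = d := by simp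

theorem mem_Icc_of_abs_sub_le {d : ℕ} {a b : Fin d → ℤ} {r : ℕ} {c : ℝ}
    (hc : c ≤ r) (h : ∀ j, |((a j - b j : ℤ) : ℝ)| ≤ c) :
    a ∈ Finset.Icc (fun j => b j - (r : ℤ)) (fun j => b j + (r : ℤ)) := by
  have h' : ∀ j, |a j - b j| ≤ (r : ℤ) := fun j => by exact_mod_cast (h j).trans hc
  rw [Finset.mem_Icc]
  constructor <;> intro j <;> have := abs_le.1 (h' j) <;> dsimp only <;> linarith

theorem exists_finset_dyadicIndex_mem {d : ℕ} (n : ℕ) {s : Set (EuclideanSpace ℝ (Fin d))}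
    (hs : Bornology.IsBounded s) : ∃ A : Finset (Fin d → ℤ), ∀ x ∈ s, dyadicIndex d n x ∈ A := by
  obtain ⟨R, hR⟩ := hs.subset_closedBall 0
  refine ⟨Finset.Icc (fun j => dyadicIndex d n 0 j - (⌈R * 2 ^ n + 1⌉₊ : ℤ))
    (fun j => dyadicIndex d n 0 j + (⌈R * 2 ^ n + 1⌉₊ : ℤ)), fun x hx => ?_⟩
  refine mem_Icc_of_abs_sub_le (Nat.le_ceil _) (abs_dyadicIndex_sub_le ?_)
  exact mul_le_mul_of_nonneg_right (hR hx) (by positivity)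

/-- If `h` is Lipschitz relative to `g` on a conull set, the dyadic entropy of the law of `h`
exceeds that of `g` by at most a multiple of `1 + log C`. -/
theorem fiberEntropy_dyadicIndex_le {Ω : Type*} [MeasurableSpace Ω] {d : ℕ} (n : ℕ)
    (μ : Measure Ω) [IsProbabilityMeasure μ] {g h : Ω → EuclideanSpace ℝ (Fin d)}
    (hg : Measurable g) (hh : Measurable h) {T : Set Ω} (hT : ∀ᵐ x ∂μ, x ∈ T)
    (hgT : Bornology.IsBounded (g '' T)) (hhT : Bornology.IsBounded (h '' T)) {C : ℝ}
    (hC : 1 < C) (hgh : ∀ x ∈ T, ∀ y ∈ T, dist (h x) (h y) ≤ C * dist (g x) (g y)) :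
    fiberEntropy μ (dyadicIndex d n ∘ h) ≤ fiberEntropy μ (dyadicIndex d n ∘ g) +
      d * (Real.logb 2 (2 * d + 5) + Real.logb 2 C) := by
  obtain ⟨A, hA⟩ := exists_finset_dyadicIndex_mem n hgT
  obtain ⟨B, hB⟩ := exists_finset_dyadicIndex_mem n hhT
  have hC0 : 0 < C := one_pos.trans hC
  have hlog : Real.logb 2 (((2 * d + 5) * C) ^ d) =
      d * (Real.logb 2 (2 * d + 5) + Real.logb 2 C) := by
    rw [Real.logb_pow, Real.logb_mul (by positivity) hC0.ne']
  rw [← hlog]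
  refine fiberEntropy_le_add_logb μ _ _ (fun a => ?_) (fun b => ?_) A B ?_ ?_ (by positivity)
    fun a => ?_
  · rw [Set.preimage_comp, dyadicIndex_preimage]
    exact hg (measurableSet_vcell d n a)
  · rw [Set.preimage_comp, dyadicIndex_preimage]
    exact hh (measurableSet_vcell d n b)
  · filter_upwards [hT] with x hx using hA _ ⟨x, hx, rfl⟩
  · filter_upwards [hT] with x hx using hB _ ⟨x, hx, rfl⟩
  by_cases hex : ∃ y ∈ T, dyadicIndex d n (g y) = a
  swap
  · refine ⟨∅, by simp; positivity, ?_⟩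
    filter_upwards [hT] with x hx hxa using (hex ⟨x, hx, hxa⟩).elim
  obtain ⟨y, hy, rfl⟩ := hex
  set r := ⌈C * d + 1⌉₊ with hr
  refine ⟨Finset.Icc (fun j => dyadicIndex d n (h y) j - (r : ℤ))
    (fun j => dyadicIndex d n (h y) j + (r : ℤ)), ?_, ?_⟩
  · have hr' : (r : ℝ) < C * d + 1 + 1 := Nat.ceil_lt_add_one (by positivity)
    have hcard : ∀ z : ℤ, z + r + 1 - (z - r) = ((2 * r + 1 : ℕ) : ℤ) := fun z => by
      push_cast; ring
    simp only [Pi.card_Icc, Int.card_Icc, hcard, Int.toNat_natCast, Finset.prod_const,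
      Finset.card_univ, Fintype.card_fin]
    push_cast
    gcongr
    nlinarith
  · filter_upwards [hT] with x hx hxa
    refine mem_Icc_of_abs_sub_le (Nat.le_ceil _) (abs_dyadicIndex_sub_le ?_)
    calc dist (h x) (h y) * 2 ^ n ≤ C * dist (g x) (g y) * 2 ^ n := by gcongr; exact hgh x hx y hy
      _ = C * (dist (g x) (g y) * 2 ^ n) := mul_assoc ..
      _ ≤ C * d := by gcongr; exact dist_mul_two_pow_le hxa

theorem entV_map {Ω : Type*} [MeasurableSpace Ω] {d : ℕ} (n : ℕ) (μ : Measure Ω)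
    {g : Ω → EuclideanSpace ℝ (Fin d)} (hg : Measurable g) :
    entV d n (μ.map g) = fiberEntropy μ (dyadicIndex d n ∘ g) := by
  simp only [entV, fiberEntropy, Set.preimage_comp, dyadicIndex_preimage, measureReal_def,
    Measure.map_apply hg (measurableSet_vcell d n _)]

theorem ae_mem_msupp {X : Type*} [TopologicalSpace X] [HereditarilyLindelofSpace X]
    [MeasurableSpace X] (θ : Measure X) : ∀ᵐ x ∂θ, x ∈ msupp θ := by
  filter_upwards [θ.support_mem_ae] with x hx U hU hxU
  exact ((Measure.mem_support_iff_forall x).1 hx U (hU.mem_nhds hxU)).ne'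

theorem entropy_dyadic_biLipschitz (d : ℕ) (hd : 1 ≤ d) :
    ∃ K : ℝ, 0 < K ∧
      ∀ θ : Measure (EuclideanSpace ℝ (Fin d)), IsProbabilityMeasure θ →
        (∃ S : Set (EuclideanSpace ℝ (Fin d)), IsCompact S ∧ θ Sᶜ = 0) →
        ∀ C : ℝ, 1 < C →
          ∀ f : EuclideanSpace ℝ (Fin d) → EuclideanSpace ℝ (Fin d), Measurable f →
            (∀ x ∈ msupp θ, ∀ y ∈ msupp θ,
              C⁻¹ * dist x y ≤ dist (f x) (f y) ∧ dist (f x) (f y) ≤ C * dist x y) →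
            ∀ n : ℕ, |entV d n (θ.map f) - entV d n θ| ≤ K * (1 + Real.logb 2 C) := by
  have hdpos : (0 : ℝ) < d := by exact_mod_cast hd
  have hL : 0 ≤ Real.logb 2 (2 * d + 5) := Real.logb_nonneg one_lt_two (by linarith)
  refine ⟨d * (Real.logb 2 (2 * d + 5) + 1), by positivity, ?_⟩
  rintro θ hθ ⟨S, hS, hSθ⟩ C hC f hf hbi n
  have hC0 : 0 < C := one_pos.trans hC
  have hT : ∀ᵐ x ∂θ, x ∈ msupp θ ∩ S :=
    (ae_mem_msupp θ).and (mem_ae_iff.2 hSθ)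
  have hbdd : Bornology.IsBounded (msupp θ ∩ S) := hS.isBounded.subset Set.inter_subset_right
  have hfbdd : Bornology.IsBounded (f '' (msupp θ ∩ S)) := by
    obtain ⟨R, hR⟩ := Metric.isBounded_iff.1 hbdd
    refine Metric.isBounded_iff.2 ⟨C * R, ?_⟩
    rintro _ ⟨x, hx, rfl⟩ _ ⟨y, hy, rfl⟩
    exact (hbi x hx.1 y hy.1).2.trans (mul_le_mul_of_nonneg_left (hR hx hy) hC0.le)
  have hid : entV d n θ = fiberEntropy θ (dyadicIndex d n ∘ id) := by
    rw [← entV_map n θ measurable_id, Measure.map_id]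
  rw [entV_map n θ hf, hid]
  have h1 := fiberEntropy_dyadicIndex_le n θ measurable_id hf hT (by simpa using hbdd) hfbdd hC
    fun x hx y hy => (hbi x hx.1 y hy.1).2
  have h2 := fiberEntropy_dyadicIndex_le n θ hf measurable_id hT hfbdd (by simpa using hbdd) hC
    fun x hx y hy => (inv_mul_le_iff₀ hC0).1 (hbi x hx.1 y hy.1).1
  have hlogC : 0 ≤ Real.logb 2 C := Real.logb_nonneg one_lt_two hC.le
  have hK : d * (Real.logb 2 (2 * d + 5) + Real.logb 2 C) ≤
      d * (Real.logb 2 (2 * d + 5) + 1) * (1 + Real.logb 2 C) := by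
    rw [mul_assoc]
    gcongr
    nlinarith [mul_nonneg hL hlogC]
  rw [abs_le]
  constructor <;> linarith
end
end

section
/- There is an absolute constant K>0 such that the following holds. Let (X,F,θ) be a probability space, let f,g:X→ℝ be measurable, let n≥0, and suppose |f(x)−g(x)| ≤ 2^{-n} for all x∈X. Then |H(fθ, D_n) − H(gθ, D_n)| ≤ K. -/
open MeasureTheory Filter Set Metric Topology

noncomputable section

/-- The level-`n` dyadic interval `[m/2^n, (m+1)/2^n)`. -/
def dyadIco (n : ℕ) (m : ℤ) : Set ℝ :=
  Set.Ico ((m : ℝ) / 2 ^ n) (((m : ℝ) + 1) / 2 ^ n)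

/-- Entropy of a measure on `ℝ` with respect to the level-`n` dyadic partition
(logarithms in base 2). -/
def ent1 (n : ℕ) (θ : Measure ℝ) : ℝ :=
  -∑' m : ℤ, (θ (dyadIco n m)).toReal * Real.logb 2 (θ (dyadIco n m)).toReal

/-- Tangent-line bound for `negMulLog` at the point `t`. -/
lemma negMulLog_le_tangent {x t : ℝ} (hx : 0 ≤ x) (ht : 0 < t) :
    Real.negMulLog x ≤ -x * Real.log t + t - x := by
  rcases hx.eq_or_lt with rfl | hx
  · simpa using ht.le
  · have h := Real.log_le_sub_one_of_pos (div_pos ht hx)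
    rw [Real.log_div ht.ne' hx.ne'] at h
    have h' := mul_le_mul_of_nonneg_left h hx.le
    have e : x * (t / x - 1) = t - x := by field_simp
    rw [e] at h'
    rw [Real.negMulLog]
    linarith

lemma negMulLog_add_le {x y : ℝ} (hx : 0 ≤ x) (hy : 0 ≤ y) :
    Real.negMulLog (x + y) ≤ Real.negMulLog x + Real.negMulLog y := by
  rcases hx.eq_or_lt with rfl | hx
  · simp
  rcases hy.eq_or_lt with rfl | hy
  · simp
  have h₁ := mul_le_mul_of_nonneg_left (Real.log_le_log hx (by linarith : x ≤ x + y)) hx.le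
  have h₂ := mul_le_mul_of_nonneg_left (Real.log_le_log hy (by linarith : y ≤ x + y)) hy.le
  simp only [Real.negMulLog]
  linarith

lemma negMulLog_sum_three_le {x y z : ℝ} (hx : 0 ≤ x) (hy : 0 ≤ y) (hz : 0 ≤ z) :
    Real.negMulLog x + Real.negMulLog y + Real.negMulLog z ≤
      Real.negMulLog (x + y + z) + (x + y + z) * Real.log 3 := by
  rcases (by positivity : 0 ≤ x + y + z).eq_or_lt with h | h
  · obtain rfl : x = 0 := by linarith
    obtain rfl : y = 0 := by linarith
    obtain rfl : z = 0 := by linarith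
    simp
  · have ht : 0 < (x + y + z) / 3 := by positivity
    have h₁ := negMulLog_le_tangent hx ht
    have h₂ := negMulLog_le_tangent hy ht
    have h₃ := negMulLog_le_tangent hz ht
    rw [Real.log_div h.ne' (by norm_num)] at h₁ h₂ h₃
    rw [Real.negMulLog.eq_def (x + y + z)]
    linarith

lemma summable_negMulLog_and_tsum_le_of_shift {a b c : ℤ → ℝ} (ha : ∀ j, 0 ≤ a j)
    (hb : ∀ j, 0 ≤ b j) (hc : ∀ j, 0 ≤ c j) (hQ : HasSum (fun j => a j + b j + c j) 1)
    (hP : ∀ i, a i + b (i - 1) + c (i + 1) ≤ 1)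
    (hs : Summable fun j => Real.negMulLog (a j + b j + c j)) :
    (Summable fun i => Real.negMulLog (a i + b (i - 1) + c (i + 1))) ∧
      ∑' i, Real.negMulLog (a i + b (i - 1) + c (i + 1)) ≤
        ∑' j, Real.negMulLog (a j + b j + c j) + Real.log 3 := by
  have hQ1 (j : ℤ) : a j + b j + c j ≤ 1 :=
    le_hasSum hQ j fun k _ => by have := ha k; have := hb k; have := hc k; positivity
  have na (j : ℤ) : 0 ≤ Real.negMulLog (a j) :=
    Real.negMulLog_nonneg (ha j) (by linarith [hQ1 j, ha j, hb j, hc j])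
  have nb (j : ℤ) : 0 ≤ Real.negMulLog (b j) :=
    Real.negMulLog_nonneg (hb j) (by linarith [hQ1 j, ha j, hb j, hc j])
  have nc (j : ℤ) : 0 ≤ Real.negMulLog (c j) :=
    Real.negMulLog_nonneg (hc j) (by linarith [hQ1 j, ha j, hb j, hc j])
  have hle (j : ℤ) := negMulLog_sum_three_le (ha j) (hb j) (hc j)
  have hR := hs.hasSum.add (hQ.mul_right (Real.log 3))
  rw [one_mul] at hR
  have sa : Summable fun j => Real.negMulLog (a j) :=
    .of_nonneg_of_le na (fun j => by linarith [hle j, nb j, nc j]) hR.summable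
  have sb : Summable fun j => Real.negMulLog (b j) :=
    .of_nonneg_of_le nb (fun j => by linarith [hle j, na j, nc j]) hR.summable
  have sc : Summable fun j => Real.negMulLog (c j) :=
    .of_nonneg_of_le nc (fun j => by linarith [hle j, na j, nb j]) hR.summable
  have hb' : HasSum (fun i => Real.negMulLog (b (i - 1))) (∑' j, Real.negMulLog (b j)) :=
    ((Equiv.subRight (1 : ℤ)).hasSum_iff (f := fun j => Real.negMulLog (b j))).mpr sb.hasSum
  have hc' : HasSum (fun i => Real.negMulLog (c (i + 1))) (∑' j, Real.negMulLog (c j)) :=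
    ((Equiv.addRight (1 : ℤ)).hasSum_iff (f := fun j => Real.negMulLog (c j))).mpr sc.hasSum
  have hT := (sa.hasSum.add hb').add hc'
  have hT' := (sa.hasSum.add sb.hasSum).add sc.hasSum
  have hle' (i : ℤ) : Real.negMulLog (a i + b (i - 1) + c (i + 1)) ≤
      Real.negMulLog (a i) + Real.negMulLog (b (i - 1)) + Real.negMulLog (c (i + 1)) := by
    have h₁ := negMulLog_add_le (add_nonneg (ha i) (hb (i - 1))) (hc (i + 1))
    have h₂ := negMulLog_add_le (ha i) (hb (i - 1))
    linarith
  have sP : Summable fun i => Real.negMulLog (a i + b (i - 1) + c (i + 1)) :=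
    .of_nonneg_of_le (fun i => Real.negMulLog_nonneg
      (add_nonneg (add_nonneg (ha _) (hb _)) (hc _)) (hP i)) hle' hT.summable
  exact ⟨sP, (hasSum_le hle' sP.hasSum hT).trans (hasSum_le hle hT' hR)⟩

section IntegerValued

variable {X : Type*} [MeasurableSpace X] {θ : Measure X} [IsProbabilityMeasure θ] {F G : X → ℤ}

lemma hasSum_measureReal_preimage_singleton (hF : Measurable F) :
    HasSum (fun i => θ.real (F ⁻¹' {i})) 1 := by
  have h : ∑' i, θ (F ⁻¹' {i}) = 1 := by
    rw [← measure_iUnion (fun i j hij => (disjoint_singleton.mpr hij).preimage F)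
      fun i => hF (measurableSet_singleton i), ← preimage_iUnion, iUnion_of_singleton]
    simp
  have h' := ENNReal.hasSum_toReal (f := fun i => θ (F ⁻¹' {i})) (by simp [h])
  rwa [← ENNReal.tsum_toReal_eq fun i => measure_ne_top _ _, h, ENNReal.toReal_one] at h'

lemma measureReal_preimage_singleton_eq_add (hF : Measurable F) (hG : Measurable G)
    (hFG : ∀ x, |F x - G x| ≤ 1) (i : ℤ) :
    θ.real (F ⁻¹' {i}) = θ.real (F ⁻¹' {i} ∩ G ⁻¹' {i}) +
      θ.real (F ⁻¹' {i} ∩ G ⁻¹' {i - 1}) + θ.real (F ⁻¹' {i} ∩ G ⁻¹' {i + 1}) := by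
  have hm (j : ℤ) : MeasurableSet (F ⁻¹' {i} ∩ G ⁻¹' {j}) :=
    (hF (measurableSet_singleton i)).inter (hG (measurableSet_singleton j))
  rw [← measureReal_union _ (hm _), ← measureReal_union _ (hm _)]
  · congr 1
    ext x
    have := abs_le.mp (hFG x)
    simp only [mem_preimage, mem_singleton_iff, mem_union, mem_inter_iff]
    omega
  · rw [Set.disjoint_left]
    simp only [mem_preimage, mem_singleton_iff, mem_union, mem_inter_iff]
    omega
  · rw [Set.disjoint_left]
    simp only [mem_preimage, mem_singleton_iff, mem_inter_iff]
    omega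

lemma summable_negMulLog_and_tsum_le_of_abs_sub_le_one (hF : Measurable F) (hG : Measurable G)
    (hFG : ∀ x, |F x - G x| ≤ 1) (hs : Summable fun j => Real.negMulLog (θ.real (G ⁻¹' {j}))) :
    (Summable fun i => Real.negMulLog (θ.real (F ⁻¹' {i}))) ∧
      ∑' i, Real.negMulLog (θ.real (F ⁻¹' {i})) ≤
        ∑' j, Real.negMulLog (θ.real (G ⁻¹' {j})) + Real.log 3 := by
  have hP := measureReal_preimage_singleton_eq_add (θ := θ) hF hG hFG
  have hQ (j : ℤ) : θ.real (G ⁻¹' {j}) = θ.real (F ⁻¹' {j} ∩ G ⁻¹' {j}) +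
      θ.real (F ⁻¹' {j + 1} ∩ G ⁻¹' {j}) + θ.real (F ⁻¹' {j - 1} ∩ G ⁻¹' {j}) := by
    rw [measureReal_preimage_singleton_eq_add hG hF (fun x => abs_sub_comm (F x) (G x) ▸ hFG x) j]
    simp only [inter_comm (G ⁻¹' {j})]
    ring
  have h1 := hasSum_measureReal_preimage_singleton (θ := θ) hG
  have key := summable_negMulLog_and_tsum_le_of_shift
    (a := fun j => θ.real (F ⁻¹' {j} ∩ G ⁻¹' {j}))
    (b := fun j => θ.real (F ⁻¹' {j + 1} ∩ G ⁻¹' {j}))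
    (c := fun j => θ.real (F ⁻¹' {j - 1} ∩ G ⁻¹' {j}))
    (fun _ => measureReal_nonneg) (fun _ => measureReal_nonneg) (fun _ => measureReal_nonneg)
  simp only [← hQ, sub_add_cancel, add_sub_cancel_right, ← hP] at key
  exact key h1 (fun _ => measureReal_le_one) hs

lemma abs_tsum_negMulLog_sub_le_log_three (hF : Measurable F) (hG : Measurable G)
    (hFG : ∀ x, |F x - G x| ≤ 1) :
    |∑' i, Real.negMulLog (θ.real (F ⁻¹' {i})) - ∑' j, Real.negMulLog (θ.real (G ⁻¹' {j}))| ≤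
      Real.log 3 := by
  have hGF (x : X) : |G x - F x| ≤ 1 := abs_sub_comm (F x) (G x) ▸ hFG x
  by_cases hs : Summable fun j => Real.negMulLog (θ.real (G ⁻¹' {j}))
  · obtain ⟨hs', h⟩ := summable_negMulLog_and_tsum_le_of_abs_sub_le_one hF hG hFG hs
    have h' := (summable_negMulLog_and_tsum_le_of_abs_sub_le_one hG hF hGF hs').2
    rw [abs_le]
    constructor <;> linarith
  · have hs' : ¬ Summable fun i => Real.negMulLog (θ.real (F ⁻¹' {i})) := fun h =>
      hs (summable_negMulLog_and_tsum_le_of_abs_sub_le_one hG hF hGF h).1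
    rw [tsum_eq_zero_of_not_summable hs, tsum_eq_zero_of_not_summable hs']
    simpa using Real.log_nonneg (by norm_num)

end IntegerValued

lemma mem_dyadIco_iff {n : ℕ} {m : ℤ} {x : ℝ} : x ∈ dyadIco n m ↔ ⌊x * 2 ^ n⌋ = m := by
  rw [dyadIco, mem_Ico, Int.floor_eq_iff, div_le_iff₀ (by positivity), lt_div_iff₀ (by positivity)]

lemma ent1_map_eq {X : Type*} [MeasurableSpace X] {θ : Measure X} {f : X → ℝ} (hf : Measurable f)
    (n : ℕ) :
    ent1 n (θ.map f) =
      (∑' m, Real.negMulLog (θ.real ((fun x => ⌊f x * 2 ^ n⌋) ⁻¹' {m}))) / Real.log 2 := by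
  have h (m : ℤ) : θ.map f (dyadIco n m) = θ ((fun x => ⌊f x * 2 ^ n⌋) ⁻¹' {m}) := by
    rw [Measure.map_apply hf (by exact measurableSet_Ico)]
    congr 1
    ext x
    exact mem_dyadIco_iff
  rw [ent1, ← tsum_neg, ← tsum_div_const]
  refine tsum_congr fun m => ?_
  rw [h, Real.logb, Real.negMulLog, Measure.real]
  ring

lemma abs_floor_sub_floor_le_one {x y : ℝ} (h : |x - y| ≤ 1) : |⌊x⌋ - ⌊y⌋| ≤ 1 := by
  obtain ⟨h₁, h₂⟩ := abs_le.mp h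
  have h₃ := Int.floor_mono (by linarith : x ≤ y + 1)
  have h₄ := Int.floor_mono (by linarith : y ≤ x + 1)
  rw [Int.floor_add_one] at h₃ h₄
  rw [abs_le]
  omega

theorem entropy_dyadic_close_maps :
    ∃ K : ℝ, 0 < K ∧
      ∀ (X : Type) [MeasurableSpace X] (θ : Measure X), IsProbabilityMeasure θ →
        ∀ f g : X → ℝ, Measurable f → Measurable g →
          ∀ n : ℕ, (∀ x, |f x - g x| ≤ (2 : ℝ) ^ (-(n : ℤ))) →
            |ent1 n (θ.map f) - ent1 n (θ.map g)| ≤ K := by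
  have hlog2 : 0 < Real.log 2 := Real.log_pos (by norm_num)
  refine ⟨Real.log 3 / Real.log 2, div_pos (Real.log_pos (by norm_num)) hlog2, ?_⟩
  intro X _ θ _ f g hf hg n hfg
  rw [ent1_map_eq hf, ent1_map_eq hg, ← sub_div, abs_div, abs_of_pos hlog2]
  refine div_le_div_of_nonneg_right (abs_tsum_negMulLog_sub_le_log_three
    (hf.mul_const _).floor (hg.mul_const _).floor fun x => abs_floor_sub_floor_le_one ?_) hlog2.le
  rw [← sub_mul, abs_mul, abs_of_pos (by positivity : (0 : ℝ) < 2 ^ n)]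
  calc |f x - g x| * 2 ^ n ≤ 2 ^ (-(n : ℤ)) * 2 ^ n := by gcongr; exact hfg x
    _ = 1 := by simp
end
end

section
/- For every 0<ε<1 there exists η₀(ε)>0 such that for every m≥1 and 0<η<η₀(ε) there exist δ=δ(ε,m,η)>0 and N=N(ε,m,η)≥1 such that for all n≥N the following holds. Let i≥1 be an integer and let ξ,θ be compactly supported Borel probability measures on ℝ such that: (1) diam(supp ξ) ≤ ε^{-1}2^{-i} and diam(supp θ) ≤ ε^{-1}2^{-i}; (2) (1/n)H(ξ, D_{i+n}) > ε; (3) ℙ_{i≤j≤i+n}{ (1/m)H(θ_{x,j}, D_{j+m}) < 1−ε } > 1−η, where j is uniform in {i,…,i+n} and x is distributed according to θ. Then (1/n)H(ξ*θ, D_{i+n}) ≥ (1/n)H(θ, D_{i+n}) + δ. -/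
open MeasureTheory Filter Set Metric Topology

noncomputable section

/-- The level-`n` dyadic cell containing `x`. -/
def dcell (n : ℕ) (x : ℝ) : Set ℝ := dyadIco n ⌊x * 2 ^ n⌋

/-- The level-`n` component `θ_{x,n}`: `θ` conditioned on the dyadic cell of `x`. -/
def dcomp (θ : Measure ℝ) (x : ℝ) (n : ℕ) : Measure ℝ :=
  (θ (dcell n x))⁻¹ • θ.restrict (dcell n x)

/-- Convolution of two measures on `ℝ`. -/
def mconv (ξ θ : Measure ℝ) : Measure ℝ :=
  (ξ.prod θ).map fun q => q.1 + q.2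

section FiniteInformation

variable {ι α β : Type*} [Fintype α] [Fintype β]

/-- A form of Pinsker's inequality, proved through the Hellinger distance. -/
lemma sq_sum_abs_sub_le_relEntropy (S : Finset ι) (a b : ι → ℝ) (ha : ∀ i ∈ S, 0 ≤ a i)
    (hb : ∀ i ∈ S, 0 ≤ b i) (hab : ∀ i ∈ S, b i = 0 → a i = 0)
    (sa : ∑ i ∈ S, a i ≤ 1) (sb : ∑ i ∈ S, b i ≤ ∑ i ∈ S, a i) :
    (∑ i ∈ S, |a i - b i|) ^ 2 ≤ 4 * ∑ i ∈ S, a i * (Real.log (a i) - Real.log (b i)) := by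
  have h1 : ∀ i ∈ S, 2 * (a i - √(a i) * √(b i)) ≤ a i * (Real.log (a i) - Real.log (b i)) := by
    intro i hi
    rcases (ha i hi).eq_or_lt with h | h
    · simp [← h]
    · have hbi : 0 < b i := lt_of_le_of_ne (hb i hi) (fun h0 => h.ne' (hab i hi h0.symm))
      have h2 := Real.log_le_sub_one_of_pos (Real.sqrt_pos.2 (div_pos hbi h))
      rw [Real.log_sqrt (div_pos hbi h).le, Real.log_div hbi.ne' h.ne', Real.sqrt_div' _ h.le] at h2
      have h3 : a i * (√(b i) / √(a i)) = √(a i) * √(b i) := by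
        have := Real.sqrt_pos.2 h
        field_simp
        rw [Real.sq_sqrt h.le]
      have h4 := mul_le_mul_of_nonneg_left h2 h.le
      rw [mul_sub, h3] at h4
      nlinarith
  have h2 : ∑ i ∈ S, (√(a i) - √(b i)) ^ 2 ≤
      ∑ i ∈ S, a i * (Real.log (a i) - Real.log (b i)) := by
    have h3 : ∑ i ∈ S, (√(a i) - √(b i)) ^ 2 =
        ∑ i ∈ S, 2 * (a i - √(a i) * √(b i)) + (∑ i ∈ S, b i - ∑ i ∈ S, a i) := by
      rw [← Finset.sum_sub_distrib, ← Finset.sum_add_distrib]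
      refine Finset.sum_congr rfl fun i hi => ?_
      nlinarith [Real.sq_sqrt (ha i hi), Real.sq_sqrt (hb i hi)]
    have := Finset.sum_le_sum h1
    linarith
  have h3 : ∑ i ∈ S, (√(a i) + √(b i)) ^ 2 ≤ 4 := by
    have : ∑ i ∈ S, (√(a i) + √(b i)) ^ 2 ≤ ∑ i ∈ S, (2 * a i + 2 * b i) := by
      refine Finset.sum_le_sum fun i hi => ?_
      nlinarith [Real.sq_sqrt (ha i hi), Real.sq_sqrt (hb i hi), sq_nonneg (√(a i) - √(b i))]
    rw [Finset.sum_add_distrib, ← Finset.mul_sum, ← Finset.mul_sum] at this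
    linarith
  have h4 : ∑ i ∈ S, |a i - b i| = ∑ i ∈ S, |√(a i) - √(b i)| * (√(a i) + √(b i)) := by
    refine Finset.sum_congr rfl fun i hi => ?_
    rw [← abs_of_nonneg (add_nonneg (Real.sqrt_nonneg (a i)) (Real.sqrt_nonneg (b i))), ← abs_mul]
    congr 1
    nlinarith [Real.sq_sqrt (ha i hi), Real.sq_sqrt (hb i hi)]
  rw [h4]
  refine (Finset.sum_mul_sq_le_sq_mul_sq _ _ _).trans ?_
  simp only [sq_abs]
  have h5 : 0 ≤ ∑ i ∈ S, (√(a i) - √(b i)) ^ 2 := Finset.sum_nonneg fun _ _ => sq_nonneg _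
  nlinarith

/-- The mass which a weight `q` gives to the fibre of `f` above `k`. -/
def fibMass (q : β → ℝ) (f : β → ℤ) (k : ℤ) : ℝ := ∑ y, if f y = k then q y else 0

lemma fibMass_nonneg {q : β → ℝ} (hq : ∀ y, 0 ≤ q y) (f : β → ℤ) (k : ℤ) :
    0 ≤ fibMass q f k :=
  Finset.sum_nonneg fun y _ => by split_ifs <;> simp [hq]

lemma le_fibMass {q : β → ℝ} (hq : ∀ y, 0 ≤ q y) (f : β → ℤ) (y : β) :
    q y ≤ fibMass q f (f y) := by
  have := Finset.single_le_sum (f := fun z => if f z = f y then q z else 0)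
    (fun z _ => by split_ifs <;> simp [hq]) (Finset.mem_univ y)
  simpa [fibMass] using this

lemma fibMass_self_pos {q : β → ℝ} (hq : ∀ y, 0 < q y) (f : β → ℤ) (y : β) :
    0 < fibMass q f (f y) :=
  (hq y).trans_le (le_fibMass (fun z => (hq z).le) f y)

lemma fibMass_le_comp {q : β → ℝ} (hq : ∀ y, 0 ≤ q y) (f : β → ℤ) (π : ℤ → ℤ) (k : ℤ) :
    fibMass q f k ≤ fibMass q (fun y => π (f y)) (π k) := by
  refine Finset.sum_le_sum fun y _ => ?_
  by_cases h : f y = k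
  · simp [h]
  · simp only [h, if_false]
    split_ifs <;> simp [hq]

lemma sum_fibMass_mul (q : β → ℝ) (f : β → ℤ) (g : ℤ → ℝ) {S : Finset ℤ} (hS : ∀ y, f y ∈ S) :
    ∑ k ∈ S, fibMass q f k * g k = ∑ y, q y * g (f y) := by
  simp only [fibMass, Finset.sum_mul]
  rw [Finset.sum_comm]
  refine Finset.sum_congr rfl fun y _ => ?_
  simp [ite_mul, hS y]

lemma sum_fibMass (q : β → ℝ) (f : β → ℤ) {S : Finset ℤ} (hS : ∀ y, f y ∈ S) :
    ∑ k ∈ S, fibMass q f k = ∑ y, q y := by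
  simpa using sum_fibMass_mul q f (fun _ => 1) hS

lemma sum_filter_fibMass (q : β → ℝ) (f : β → ℤ) (π : ℤ → ℤ) (K : ℤ) {S : Finset ℤ}
    (hS : ∀ y, f y ∈ S) :
    ∑ k ∈ S with π k = K, fibMass q f k = fibMass q (fun y => π (f y)) K := by
  have := sum_fibMass_mul q f (fun k => if π k = K then 1 else 0) hS
  simpa [Finset.sum_filter, fibMass] using this

/-- The law of `f x y` when `x` and `y` are independent with weights `p` and `q`. -/
def mixMass (p : α → ℝ) (q : β → ℝ) (f : α → β → ℤ) (k : ℤ) : ℝ :=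
  ∑ x, p x * fibMass q (f x) k

/-- The mutual information of `x` and `f x y`, for independent `x` and `y` with weights
`p` and `q` (natural logarithms). -/
def mutInfo (p : α → ℝ) (q : β → ℝ) (f : α → β → ℤ) : ℝ :=
  ∑ x, p x * ∑ y, q y * (Real.log (fibMass q (f x) (f x y)) - Real.log (mixMass p q f (f x y)))

lemma mixMass_nonneg {p : α → ℝ} {q : β → ℝ} (hp : ∀ x, 0 ≤ p x) (hq : ∀ y, 0 ≤ q y)
    (f : α → β → ℤ) (k : ℤ) : 0 ≤ mixMass p q f k :=
  Finset.sum_nonneg fun x _ => mul_nonneg (hp x) (fibMass_nonneg hq _ _)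

lemma mul_fibMass_le_mixMass {p : α → ℝ} {q : β → ℝ} (hp : ∀ x, 0 ≤ p x) (hq : ∀ y, 0 ≤ q y)
    (f : α → β → ℤ) (x : α) (k : ℤ) : p x * fibMass q (f x) k ≤ mixMass p q f k :=
  Finset.single_le_sum (f := fun x => p x * fibMass q (f x) k)
    (fun x _ => mul_nonneg (hp x) (fibMass_nonneg hq _ _)) (Finset.mem_univ x)

lemma mixMass_pos {p : α → ℝ} {q : β → ℝ} (hp : ∀ x, 0 < p x) (hq : ∀ y, 0 ≤ q y)
    {f : α → β → ℤ} {x : α} {k : ℤ} (h : 0 < fibMass q (f x) k) : 0 < mixMass p q f k :=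
  (mul_pos (hp x) h).trans_le (mul_fibMass_le_mixMass (fun x => (hp x).le) hq f x k)

lemma sum_filter_mixMass (p : α → ℝ) (q : β → ℝ) (f : α → β → ℤ) (π : ℤ → ℤ) (K : ℤ)
    {S : Finset ℤ} (hS : ∀ x y, f x y ∈ S) :
    ∑ k ∈ S with π k = K, mixMass p q f k = mixMass p q (fun x y => π (f x y)) K := by
  simp only [mixMass]
  rw [Finset.sum_comm]
  refine Finset.sum_congr rfl fun x _ => ?_
  rw [← Finset.mul_sum, sum_filter_fibMass _ _ _ _ (hS x)]

/-- The conditional law predicted for `f x y` from `π (f x y)` alone. -/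
def predMass (p : α → ℝ) (q : β → ℝ) (f : α → β → ℤ) (π : ℤ → ℤ) (x : α) (k : ℤ) : ℝ :=
  fibMass q (fun y => π (f x y)) (π k) *
    (mixMass p q f k / mixMass p q (fun x y => π (f x y)) (π k))

lemma predMass_nonneg {p : α → ℝ} {q : β → ℝ} (hp : ∀ x, 0 ≤ p x) (hq : ∀ y, 0 ≤ q y)
    (f : α → β → ℤ) (π : ℤ → ℤ) (x : α) (k : ℤ) : 0 ≤ predMass p q f π x k :=
  mul_nonneg (fibMass_nonneg hq _ _) (div_nonneg (mixMass_nonneg hp hq _ _)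
    (mixMass_nonneg hp hq _ _))

lemma sum_mul_mixMass_div_le (p : α → ℝ) (q : β → ℝ)
    (f : α → β → ℤ) (π : ℤ → ℤ) (g : ℤ → ℝ) (hg : ∀ K, 0 ≤ g K)
    {S S' : Finset ℤ} (hS : ∀ x y, f x y ∈ S) (hS' : ∀ k ∈ S, π k ∈ S') :
    ∑ k ∈ S, g (π k) * (mixMass p q f k / mixMass p q (fun x y => π (f x y)) (π k)) ≤
      ∑ K ∈ S', g K := by
  rw [← Finset.sum_fiberwise_of_maps_to hS']
  refine Finset.sum_le_sum fun K _ => ?_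
  have h1 : ∑ k ∈ S with π k = K,
      g (π k) * (mixMass p q f k / mixMass p q (fun x y => π (f x y)) (π k)) =
      g K * ((∑ k ∈ S with π k = K, mixMass p q f k) / mixMass p q (fun x y => π (f x y)) K) := by
    rw [Finset.sum_div, Finset.mul_sum]
    refine Finset.sum_congr rfl fun k hk => ?_
    rw [(Finset.mem_filter.1 hk).2]
  rw [h1, sum_filter_mixMass _ _ _ _ _ hS]
  exact mul_le_of_le_one_right (hg K) (div_self_le_one _)

/-- Pinsker's inequality for the conditional mutual information of `x` and `f x y`
given `π (f x y)`. -/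
lemma sq_sum_abs_sub_predMass_le {p : α → ℝ} {q : β → ℝ} (hp : ∀ x, 0 < p x)
    (hq : ∀ y, 0 < q y) (sp : ∑ x, p x = 1) (sq : ∑ y, q y = 1) (f : α → β → ℤ) (π : ℤ → ℤ)
    {S : Finset ℤ} (hS : ∀ x y, f x y ∈ S) :
    (∑ x, p x * ∑ k ∈ S, |fibMass q (f x) k - predMass p q f π x k|) ^ 2 ≤
      4 * (mutInfo p q f - mutInfo p q fun x y => π (f x y)) := by
  have hp' : ∀ x, 0 ≤ p x := fun x => (hp x).le
  have hq' : ∀ y, 0 ≤ q y := fun y => (hq y).le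
  have key := sq_sum_abs_sub_le_relEntropy (Finset.univ ×ˢ S)
    (fun i : α × ℤ => p i.1 * fibMass q (f i.1) i.2)
    (fun i : α × ℤ => p i.1 * predMass p q f π i.1 i.2)
    (fun i _ => mul_nonneg (hp' _) (fibMass_nonneg hq' _ _))
    (fun i _ => mul_nonneg (hp' _) (predMass_nonneg hp' hq' _ _ _ _))
    ?_ ?_ ?_
  · rw [Finset.sum_product, Finset.sum_product] at key
    refine le_trans (le_of_eq ?_) (key.trans (le_of_eq ?_))
    · congr 1
      refine Finset.sum_congr rfl fun x _ => ?_
      rw [Finset.mul_sum]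
      refine Finset.sum_congr rfl fun k _ => ?_
      rw [← mul_sub, abs_mul, abs_of_pos (hp x)]
    · congr 1
      rw [mutInfo, mutInfo, ← Finset.sum_sub_distrib]
      refine Finset.sum_congr rfl fun x _ => ?_
      rw [← mul_sub, ← Finset.sum_sub_distrib]
      have := sum_fibMass_mul q (f x) (fun k => (Real.log (fibMass q (f x) k) -
        Real.log (mixMass p q f k)) - (Real.log (fibMass q (fun y => π (f x y)) (π k)) -
        Real.log (mixMass p q (fun x y => π (f x y)) (π k)))) (hS x)
      simp only [mul_sub] at this ⊢
      rw [← this, Finset.mul_sum, ]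
      refine Finset.sum_congr rfl fun k _ => ?_
      rcases (fibMass_nonneg hq' (f x) k).eq_or_lt with h | h
      · simp [← h]
      · have h1 := h.trans_le (fibMass_le_comp hq' (f x) π k)
        have h2 : 0 < mixMass p q f k := mixMass_pos hp hq' h
        have h3 : 0 < mixMass p q (fun x y => π (f x y)) (π k) := mixMass_pos hp hq' h1
        simp only [predMass]
        rw [Real.log_mul (hp x).ne' h.ne', Real.log_mul (hp x).ne' (by positivity),
          Real.log_mul h1.ne' (by positivity), Real.log_div h2.ne' h3.ne']
        ring
  · rintro ⟨x, k⟩ _ h0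
    by_contra hne
    have h : 0 < fibMass q (f x) k := lt_of_le_of_ne (fibMass_nonneg hq' _ _)
      (fun h => hne (by simp [← h]))
    have h1 := h.trans_le (fibMass_le_comp hq' (f x) π k)
    have h2 : 0 < mixMass p q f k := mixMass_pos hp hq' h
    have h3 : 0 < mixMass p q (fun x y => π (f x y)) (π k) := mixMass_pos hp hq' h1
    have := hp x
    have : 0 < p x * predMass p q f π x k := by unfold predMass; positivity
    exact this.ne' h0
  · rw [Finset.sum_product]
    simp only [← Finset.mul_sum]
    simp [sum_fibMass q (f _) (hS _), sq, sp]
  · rw [Finset.sum_product, Finset.sum_product]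
    simp only [← Finset.mul_sum]
    refine Finset.sum_le_sum fun x _ => mul_le_mul_of_nonneg_left ?_ (hp' x)
    rw [sum_fibMass q (f x) (hS x)]
    refine (sum_mul_mixMass_div_le p q f π (fun K => fibMass q (fun y => π (f x y)) K)
      (fun K => fibMass_nonneg hq' _ _) hS (S' := S.image π)
      (fun k hk => Finset.mem_image_of_mem _ hk)).trans (le_of_eq ?_)
    exact sum_fibMass q (fun y => π (f x y)) fun y => Finset.mem_image_of_mem _ (hS x y)

lemma mutInfo_comp_le {p : α → ℝ} {q : β → ℝ} (hp : ∀ x, 0 < p x)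
    (hq : ∀ y, 0 < q y) (sp : ∑ x, p x = 1) (sq : ∑ y, q y = 1) (f : α → β → ℤ) (π : ℤ → ℤ) :
    (mutInfo p q fun x y => π (f x y)) ≤ mutInfo p q f := by
  have := sq_sum_abs_sub_predMass_le hp hq sp sq f π
    (S := Finset.univ.image fun z : α × β => f z.1 z.2)
    (fun x y => Finset.mem_image_of_mem (fun z : α × β => f z.1 z.2) (Finset.mem_univ (x, y)))
  nlinarith [sq_nonneg (∑ x, p x * ∑ k ∈ Finset.univ.image fun z : α × β => f z.1 z.2,
    |fibMass q (f x) k - predMass p q f π x k|)]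

lemma mutInfo_nonneg {p : α → ℝ} {q : β → ℝ} (hp : ∀ x, 0 < p x)
    (hq : ∀ y, 0 < q y) (sp : ∑ x, p x = 1) (sq : ∑ y, q y = 1) (f : α → β → ℤ) :
    0 ≤ mutInfo p q f := by
  refine le_trans (le_of_eq ?_) (mutInfo_comp_le hp hq sp sq f fun _ => 0)
  simp [mutInfo, mixMass, fibMass, sp, sq]

/-- Comparison of two conditional laws, through their common prediction. -/
lemma sum_abs_fibMass_sub_le {p : α → ℝ} {q : β → ℝ} (hp : ∀ x, 0 ≤ p x)
    (hq : ∀ y, 0 ≤ q y) (f : α → β → ℤ) (π : ℤ → ℤ)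
    {S : Finset ℤ} (hS : ∀ x y, f x y ∈ S) (x x' : α) :
    ∑ k ∈ S, |fibMass q (f x) k - fibMass q (f x') k| ≤
      ∑ k ∈ S, |fibMass q (f x) k - predMass p q f π x k| +
      ∑ k ∈ S, |fibMass q (f x') k - predMass p q f π x' k| +
      2 * ∑ y, if π (f x y) ≠ π (f x' y) then q y else 0 := by
  have h1 : ∑ k ∈ S, |predMass p q f π x k - predMass p q f π x' k| ≤
      2 * ∑ y, if π (f x y) ≠ π (f x' y) then q y else 0 := by
    set g : ℤ → ℝ := fun K =>
      |fibMass q (fun y => π (f x y)) K - fibMass q (fun y => π (f x' y)) K| with hg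
    have h2 : ∀ k, |predMass p q f π x k - predMass p q f π x' k| =
        g (π k) * (mixMass p q f k / mixMass p q (fun x y => π (f x y)) (π k)) := by
      intro k
      rw [predMass, predMass, ← sub_mul, abs_mul, abs_of_nonneg (div_nonneg
        (mixMass_nonneg hp hq _ _) (mixMass_nonneg hp hq _ _))]
    simp only [h2]
    refine (sum_mul_mixMass_div_le p q f π g (fun K => abs_nonneg _) hS (S' := S.image π)
      (fun k hk => Finset.mem_image_of_mem _ hk)).trans ?_
    have h3 : ∀ K, g K ≤ ∑ y, if π (f x y) ≠ π (f x' y) then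
        ((if π (f x y) = K then q y else 0) + (if π (f x' y) = K then q y else 0)) else 0 := by
      intro K
      simp only [hg, fibMass, ← Finset.sum_sub_distrib]
      refine (Finset.abs_sum_le_sum_abs _ _).trans (Finset.sum_le_sum fun y _ => ?_)
      have := hq y
      by_cases h : π (f x y) = π (f x' y)
      · simp [h]
      · rw [if_pos h]
        split_ifs <;> simp [abs_of_nonneg, this]
    refine (Finset.sum_le_sum fun K _ => h3 K).trans ?_
    rw [Finset.sum_comm, Finset.mul_sum]
    refine Finset.sum_le_sum fun y _ => ?_
    by_cases h : π (f x y) = π (f x' y)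
    · simp [h]
    · simp only [ne_eq, h, not_false_eq_true, if_true, Finset.sum_add_distrib, Finset.sum_ite_eq]
      have := hq y
      split_ifs <;> linarith
  have h4 : ∀ k ∈ S, |fibMass q (f x) k - fibMass q (f x') k| ≤
      |fibMass q (f x) k - predMass p q f π x k| + |fibMass q (f x') k - predMass p q f π x' k| +
      |predMass p q f π x k - predMass p q f π x' k| := by
    intro k _
    have e : fibMass q (f x) k - fibMass q (f x') k = (fibMass q (f x) k - predMass p q f π x k) -
      (fibMass q (f x') k - predMass p q f π x' k) +
      (predMass p q f π x k - predMass p q f π x' k) := by ring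
    rw [e]
    exact (abs_add_le _ _).trans (add_le_add_left (abs_sub _ _) _)
  have h5 := Finset.sum_le_sum h4
  rw [Finset.sum_add_distrib, Finset.sum_add_distrib] at h5
  linarith

end FiniteInformation

section Entropy

variable {α : Type*} [Fintype α]

/-- Shannon entropy (natural logarithm) of `f x`, for `x` with weights `p`. -/
def fibEnt (p : α → ℝ) (f : α → ℤ) : ℝ := -∑ x, p x * Real.log (fibMass p f (f x))

lemma fibEnt_sub_comp (p : α → ℝ) (f : α → ℤ) (π : ℤ → ℤ) :
    fibEnt p f - fibEnt p (fun x => π (f x)) =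
      ∑ x, p x * (Real.log (fibMass p (fun x => π (f x)) (π (f x))) -
        Real.log (fibMass p f (f x))) := by
  simp only [fibEnt, mul_sub, Finset.sum_sub_distrib]
  ring

lemma fibEnt_comp_le {p : α → ℝ} (hp : ∀ x, 0 < p x) (f : α → ℤ) (π : ℤ → ℤ) :
    fibEnt p (fun x => π (f x)) ≤ fibEnt p f := by
  rw [← sub_nonneg, fibEnt_sub_comp]
  refine Finset.sum_nonneg fun x _ => mul_nonneg (hp x).le (sub_nonneg.2 ?_)
  exact Real.log_le_log (fibMass_self_pos hp f x) (fibMass_le_comp (fun x => (hp x).le) f π _)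

/-- Gibbs' inequality for conditional entropy. -/
lemma fibEnt_sub_comp_le {p : α → ℝ} (hp : ∀ x, 0 < p x) (f : α → ℤ)
    (π : ℤ → ℤ) (v : ℤ → ℝ) (hv : ∀ k, 0 < v k)
    (hv1 : ∀ K, ∑ k ∈ (Finset.univ.image f) with π k = K, v k ≤ 1) :
    fibEnt p f - fibEnt p (fun x => π (f x)) ≤ ∑ x, p x * (-Real.log (v (f x))) := by
  rw [fibEnt_sub_comp]
  set P := fibMass p f
  set P' := fibMass p fun x => π (f x)
  have hP : ∀ x, 0 < P (f x) := fibMass_self_pos hp f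
  have hP' : ∀ x, 0 < P' (π (f x)) := fibMass_self_pos hp fun x => π (f x)
  have hmem : ∀ x, f x ∈ Finset.univ.image f := fun x => Finset.mem_image_of_mem _ (Finset.mem_univ x)
  have h1 : ∀ x, p x * (Real.log (P' (π (f x))) - Real.log (P (f x))) -
      p x * (-Real.log (v (f x))) ≤ p x * (P' (π (f x)) * v (f x) / P (f x)) - p x := by
    intro x
    have := Real.log_le_sub_one_of_pos (div_pos (mul_pos (hP' x) (hv (f x))) (hP x))
    rw [Real.log_div (mul_pos (hP' x) (hv (f x))).ne' (hP x).ne',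
      Real.log_mul (hP' x).ne' (hv _).ne'] at this
    nlinarith [mul_le_mul_of_nonneg_left this (hp x).le]
  have h2 : ∑ x, p x * (P' (π (f x)) * v (f x) / P (f x)) ≤ ∑ x, p x := by
    rw [← sum_fibMass_mul p f (fun k => P' (π k) * v k / P k) hmem]
    calc ∑ k ∈ Finset.univ.image f, P k * (P' (π k) * v k / P k)
        = ∑ k ∈ Finset.univ.image f, P' (π k) * v k := by
          refine Finset.sum_congr rfl fun k hk => ?_
          obtain ⟨x, -, rfl⟩ := Finset.mem_image.1 hk
          have := (hP x).ne'
          field_simp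
      _ = ∑ K ∈ (Finset.univ.image f).image π, ∑ k ∈ (Finset.univ.image f) with π k = K,
            P' (π k) * v k :=
          (Finset.sum_fiberwise_of_maps_to (fun k hk => Finset.mem_image_of_mem _ hk) _).symm
      _ ≤ ∑ K ∈ (Finset.univ.image f).image π, P' K := by
          refine Finset.sum_le_sum fun K _ => ?_
          have : ∑ k ∈ (Finset.univ.image f) with π k = K, P' (π k) * v k =
              P' K * ∑ k ∈ (Finset.univ.image f) with π k = K, v k := by
            rw [Finset.mul_sum]
            refine Finset.sum_congr rfl fun k hk => ?_
            rw [(Finset.mem_filter.1 hk).2]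
          rw [this]
          exact mul_le_of_le_one_right (fibMass_nonneg (fun x => (hp x).le) _ _) (hv1 K)
      _ = ∑ x, p x := sum_fibMass p _ fun x => Finset.mem_image_of_mem _ (hmem x)
  have h3 := Finset.sum_le_sum fun x (_ : x ∈ Finset.univ) => h1 x
  rw [Finset.sum_sub_distrib, Finset.sum_sub_distrib] at h3
  linarith

lemma ediv_two_pow_add (z : ℤ) (s m : ℕ) : z / 2 ^ (s + m) = z / 2 ^ s / 2 ^ m := by
  rw [Int.ediv_ediv_of_nonneg (by positivity), pow_add]

lemma card_filter_ediv_le (S : Finset ℤ) (M : ℕ) (K : ℤ) :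
    (S.filter fun k => k / 2 ^ M = K).card ≤ 2 ^ M := by
  have : S.filter (fun k => k / 2 ^ M = K) ⊆ Finset.Ico (K * 2 ^ M) (K * 2 ^ M + 2 ^ M) := by
    intro k hk
    have h := (Finset.mem_filter.1 hk).2
    have h2 : (0 : ℤ) < 2 ^ M := by positivity
    have h3 := Int.mul_ediv_add_emod k (2 ^ M)
    have h4 := Int.emod_nonneg k h2.ne'
    have h5 := Int.emod_lt_of_pos k h2
    rw [h] at h3
    rw [Finset.mem_Ico]
    constructor <;> linarith [mul_comm K (2 ^ M)]
  refine (Finset.card_le_card this).trans (le_of_eq ?_)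
  rw [Int.card_Ico, add_sub_cancel_left, show (2 : ℤ) ^ M = ((2 ^ M : ℕ) : ℤ) by push_cast; rfl,
    Int.toNat_natCast]

lemma fibEnt_ediv_sub_le {p : α → ℝ} (hp : ∀ x, 0 < p x) (sp : ∑ x, p x = 1) (X : α → ℤ)
    (s M : ℕ) :
    fibEnt p (fun x => X x / 2 ^ s) - fibEnt p (fun x => X x / 2 ^ (s + M)) ≤
      M * Real.log 2 := by
  simp only [ediv_two_pow_add]
  refine (fibEnt_sub_comp_le hp (fun x => X x / 2 ^ s) (fun k => k / 2 ^ M) (fun _ => (2 ^ M)⁻¹)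
    (fun _ => by positivity) fun K => ?_).trans (le_of_eq ?_)
  · rw [Finset.sum_const, nsmul_eq_mul, ← div_eq_mul_inv]
    refine div_le_one_of_le₀ ?_ (by positivity)
    exact_mod_cast card_filter_ediv_le _ M K
  · rw [← Finset.sum_mul, sp]
    simp

lemma fibEnt_le_log_card {p : α → ℝ} (hp : ∀ x, 0 < p x) (sp : ∑ x, p x = 1) (f : α → ℤ)
    {C : ℝ} (hC : 1 ≤ C) (hcard : ((Finset.univ.image f).card : ℝ) ≤ C) :
    fibEnt p f ≤ Real.log C := by
  have h0 : (0 : ℝ) < C := by linarith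
  have h := fibEnt_sub_comp_le hp f (fun _ => 0) (fun _ => C⁻¹) (fun _ => by positivity) fun K => ?_
  · have h1 : fibEnt p (fun _ => (0 : ℤ)) = 0 := by simp [fibEnt, fibMass, sp]
    rw [h1, ← Finset.sum_mul, sp, Real.log_inv] at h
    linarith
  · rw [Finset.sum_const, nsmul_eq_mul, ← div_eq_mul_inv]
    refine div_le_one_of_le₀ (le_trans ?_ hcard) h0.le
    exact_mod_cast Finset.card_le_card (Finset.filter_subset _ _)

/-- If the conditional entropy of `X` over `M` levels is large, then any set of large mass
contains two points which are far apart relative to the finest of these levels, and close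
relative to the coarsest. -/
lemma exists_far_pair {p : α → ℝ} (hp : ∀ x, 0 < p x) (sp : ∑ x, p x = 1) (X : α → ℤ)
    (s M : ℕ) (hM : 1 ≤ M) (G : α → Prop) [DecidablePred G] {b : ℝ}
    (hG : ∑ x, (if G x then 0 else p x) ≤ b)
    (hent : (2 + b * (M + 1)) * Real.log 2 <
      fibEnt p (fun x => X x / 2 ^ s) - fibEnt p (fun x => X x / 2 ^ (s + M))) :
    ∃ x x', G x ∧ G x' ∧ X x + 2 ^ s ≤ X x' ∧ X x' < X x + 2 ^ (s + M) := by
  classical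
  by_contra! hcon
  refine hent.not_ge ?_
  have hdiff : ∀ x x', G x → G x' → X x / 2 ^ s / 2 ^ M = X x' / 2 ^ s / 2 ^ M →
      X x' / 2 ^ s ≤ X x / 2 ^ s + 1 := by
    intro x x' hx hx' h
    have hs : (0 : ℤ) < 2 ^ s := by positivity
    have h1 : X x' < X x + 2 ^ s := by
      by_contra! h2
      have h3 := hcon x x' hx hx' h2
      rw [← ediv_two_pow_add, ← ediv_two_pow_add] at h
      have h4 : (0 : ℤ) < 2 ^ (s + M) := by positivity
      have e1 := Int.mul_ediv_add_emod (X x) (2 ^ (s + M))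
      have e2 := Int.mul_ediv_add_emod (X x') (2 ^ (s + M))
      have e3 := Int.emod_nonneg (X x) h4.ne'
      have e4 := Int.emod_lt_of_pos (X x') h4
      rw [h] at e1
      linarith
    have h5 := Int.ediv_le_ediv hs h1.le
    have h6 : (X x + 2 ^ s) / 2 ^ s = X x / 2 ^ s + 1 := by
      have := Int.add_mul_ediv_right (X x) 1 hs.ne'
      rwa [one_mul] at this
    rwa [h6] at h5
  set v : ℤ → ℝ := fun k => if ∃ x, G x ∧ X x / 2 ^ s = k then 1 / 4 else (2 ^ (M + 1))⁻¹ with hv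
  simp only [ediv_two_pow_add]
  refine (fibEnt_sub_comp_le hp (fun x => X x / 2 ^ s) (fun k => k / 2 ^ M) v
    (fun _ => by simp only [hv]; split_ifs <;> positivity) fun K => ?_).trans ?_
  · simp only [hv]
    rw [Finset.sum_ite, Finset.sum_const, Finset.sum_const, nsmul_eq_mul, nsmul_eq_mul]
    set A := Finset.filter (fun k => k / 2 ^ M = K) (Finset.univ.image fun x => X x / 2 ^ s)
    have h1 : ((A.filter fun k => ∃ x, G x ∧ X x / 2 ^ s = k).card : ℝ) ≤ 2 := by
      rcases (A.filter fun k => ∃ x, G x ∧ X x / 2 ^ s = k).eq_empty_or_nonempty with h | h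
      · rw [h]; norm_num
      · set k₀ := (A.filter fun k => ∃ x, G x ∧ X x / 2 ^ s = k).min' h
        have hk₀ := Finset.min'_mem _ h
        have : A.filter (fun k => ∃ x, G x ∧ X x / 2 ^ s = k) ⊆ Finset.Icc k₀ (k₀ + 1) := by
          intro k hk
          have h0 := Finset.min'_le _ k hk
          rw [Finset.mem_Icc]
          refine ⟨h0, ?_⟩
          obtain ⟨hkA, x', hx', rfl⟩ := Finset.mem_filter.1 hk
          obtain ⟨hkA₀, x, hx, hxk⟩ := Finset.mem_filter.1 hk₀
          rw [← hxk] at hkA₀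
          have e1 := (Finset.mem_filter.1 hkA).2
          have e2 := (Finset.mem_filter.1 hkA₀).2
          have := hdiff x x' hx hx' (e2.trans e1.symm)
          rwa [hxk] at this
        have := Finset.card_le_card this
        rw [Int.card_Icc] at this
        have h2 : (k₀ + 1 + 1 - k₀).toNat = 2 := by
          have : k₀ + 1 + 1 - k₀ = 2 := by ring
          rw [this]; rfl
        rw [h2] at this
        exact_mod_cast this
    have h2 : ((A.filter fun k => ¬∃ x, G x ∧ X x / 2 ^ s = k).card : ℝ) ≤ 2 ^ M := by
      exact_mod_cast (Finset.card_le_card (Finset.filter_subset _ _)).trans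
        (card_filter_ediv_le _ M K)
    have h3 : ((A.filter fun k => ¬∃ x, G x ∧ X x / 2 ^ s = k).card : ℝ) * (2 ^ (M + 1))⁻¹ ≤
        2 ^ M * (2 ^ (M + 1))⁻¹ := by gcongr
    have h4 : (2 : ℝ) ^ M * (2 ^ (M + 1))⁻¹ = 1 / 2 := by
      rw [pow_succ]; field_simp
    linarith
  · have hl : 0 < Real.log 2 := Real.log_pos (by norm_num)
    have h4 : Real.log (1 / 4) = -(2 * Real.log 2) := by
      rw [show (1 / 4 : ℝ) = ((2 : ℝ) ^ 2)⁻¹ by norm_num, Real.log_inv, Real.log_pow]; norm_num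
    have h5 : Real.log ((2 ^ (M + 1))⁻¹) = -((M + 1) * Real.log 2) := by
      rw [Real.log_inv, Real.log_pow]; push_cast; ring
    have hM' : (1 : ℝ) ≤ M := by exact_mod_cast hM
    have h6 : ∀ x, p x * (-Real.log (v (X x / 2 ^ s))) ≤
        p x * (2 * Real.log 2) + (if G x then 0 else p x) * ((M + 1) * Real.log 2) := by
      intro x
      have := (hp x).le
      by_cases hx : G x
      · have : v (X x / 2 ^ s) = 1 / 4 := if_pos ⟨x, hx, rfl⟩
        rw [this, h4]
        simp [hx]
      · rw [if_neg hx]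
        have h7 : -Real.log (v (X x / 2 ^ s)) ≤ (M + 1) * Real.log 2 := by
          simp only [hv]
          split_ifs
          · rw [h4]; nlinarith
          · rw [h5]; linarith
        have h8 : 0 ≤ p x * (2 * Real.log 2) := by positivity
        nlinarith [mul_le_mul_of_nonneg_left h7 (hp x).le]
    refine (Finset.sum_le_sum fun x _ => h6 x).trans ?_
    rw [Finset.sum_add_distrib, ← Finset.sum_mul, ← Finset.sum_mul, sp]
    nlinarith [mul_le_mul_of_nonneg_right hG (show 0 ≤ (M + 1) * Real.log 2 by positivity)]

end Entropy

section NearInvariance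

variable {β : Type*} [Fintype β]

lemma sum_range_shift_of_periodic {F : ℤ → ℝ} {P : ℕ} (hF : ∀ v, F (v + P) = F v) (v : ℤ) :
    ∑ u ∈ Finset.range P, F (v + u) = ∑ u ∈ Finset.range P, F u := by
  have step : ∀ v : ℤ, ∑ u ∈ Finset.range P, F (v + 1 + u) = ∑ u ∈ Finset.range P, F (v + u) := by
    intro v
    rw [← sub_eq_zero, ← Finset.sum_sub_distrib]
    have := Finset.sum_range_sub (fun u : ℕ => F (v + u)) P
    simp only [Nat.cast_add, Nat.cast_one, Nat.cast_zero, add_zero, hF, sub_self] at this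
    rw [← this]
    refine Finset.sum_congr rfl fun u _ => ?_
    rw [show v + 1 + (u : ℤ) = v + (u + 1) by ring]
  induction v using Int.induction_on with
  | zero => simp
  | succ i ih => rw [step, ih]
  | pred i ih => rw [← ih, ← step]; simp

lemma sum_range_mul_eq (h : ℕ → ℝ) (P Q : ℕ) :
    ∑ u ∈ Finset.range (Q * P), h u =
      ∑ b ∈ Finset.range Q, ∑ j ∈ Finset.range P, h (b * P + j) := by
  induction Q with
  | zero => simp
  | succ Q ih => rw [Nat.succ_mul, Finset.sum_range_add, ih, Finset.sum_range_succ]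

lemma sum_range_mul_of_periodic {F : ℤ → ℝ} {P : ℕ} (hF : ∀ v, F (v + P) = F v) (v : ℤ) (Q : ℕ) :
    ∑ u ∈ Finset.range (Q * P), F (v + u) = Q * ∑ u ∈ Finset.range P, F u := by
  rw [sum_range_mul_eq (fun u => F (v + u))]
  have : ∀ b ∈ Finset.range Q, ∑ j ∈ Finset.range P, F (v + ((b * P + j : ℕ) : ℤ)) =
      ∑ u ∈ Finset.range P, F u := by
    intro b _
    rw [← sum_range_shift_of_periodic hF (v + b * P)]
    refine Finset.sum_congr rfl fun j _ => ?_
    congr 1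
    push_cast
    ring
  rw [Finset.sum_congr rfl this]
  simp

/-- Total variation distance, at resolution `2 ^ s`, between the laws of `Y + v` and
`Y + v + a`. -/
def shiftTV (q : β → ℝ) (Y : β → ℤ) (s a : ℕ) (v : ℤ) : ℝ :=
  ∑' k : ℤ, |fibMass q (fun y => (Y y + v) / 2 ^ s) k - fibMass q (fun y => (Y y + v + a) / 2 ^ s) k|

lemma fibMass_eq_zero {q : β → ℝ} {f : β → ℤ} {S : Finset ℤ} (hS : ∀ y, f y ∈ S) {k : ℤ}
    (hk : k ∉ S) : fibMass q f k = 0 :=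
  Finset.sum_eq_zero fun y _ => if_neg fun (h : f y = k) => hk (h ▸ hS y)

lemma shiftTV_eq_sum (q : β → ℝ) (Y : β → ℤ) (s a : ℕ) (v : ℤ) {S : Finset ℤ}
    (h1 : ∀ y, (Y y + v) / 2 ^ s ∈ S) (h2 : ∀ y, (Y y + v + a) / 2 ^ s ∈ S) :
    shiftTV q Y s a v = ∑ k ∈ S, |fibMass q (fun y => (Y y + v) / 2 ^ s) k -
      fibMass q (fun y => (Y y + v + a) / 2 ^ s) k| := by
  refine tsum_eq_sum fun k hk => ?_
  rw [fibMass_eq_zero h1 hk, fibMass_eq_zero h2 hk]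
  simp

lemma shiftTV_nonneg (q : β → ℝ) (Y : β → ℤ) (s a : ℕ) (v : ℤ) : 0 ≤ shiftTV q Y s a v :=
  tsum_nonneg fun _ => abs_nonneg _

lemma shiftTV_add_two_pow (q : β → ℝ) (Y : β → ℤ) (s a : ℕ) (v : ℤ) :
    shiftTV q Y s a (v + (2 ^ s : ℕ)) = shiftTV q Y s a v := by
  have hs : (2 : ℤ) ^ s ≠ 0 := by positivity
  rw [shiftTV, shiftTV, ← (Equiv.addRight (1 : ℤ)).tsum_eq]
  refine tsum_congr fun k => ?_
  have h : ∀ z : ℤ, (z + 2 ^ s) / 2 ^ s = z / 2 ^ s + 1 := by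
    intro z
    have := Int.add_mul_ediv_right z 1 hs
    rwa [one_mul] at this
  have h1 : ∀ y, (Y y + (v + (2 ^ s : ℕ))) / 2 ^ s = (Y y + v) / 2 ^ s + 1 := fun y => by
    rw [← h]; push_cast; ring_nf
  have h2 : ∀ y, (Y y + (v + (2 ^ s : ℕ)) + a) / 2 ^ s = (Y y + v + a) / 2 ^ s + 1 := fun y => by
    rw [← h]; push_cast; ring_nf
  simp only [fibMass, h1, h2, Equiv.coe_addRight, add_left_inj]

lemma sum_mul_le_add_shiftTV (q : β → ℝ) (Y : β → ℤ) (s a : ℕ) (v : ℤ) {g : ℤ → ℝ} {B : ℝ}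
    (hg : ∀ k, |g k| ≤ B) :
    ∑ y, q y * g ((Y y + v) / 2 ^ s) ≤
      ∑ y, q y * g ((Y y + v + a) / 2 ^ s) + B * shiftTV q Y s a v := by
  classical
  set S : Finset ℤ := (Finset.univ.image fun y => (Y y + v) / 2 ^ s) ∪
    Finset.univ.image fun y => (Y y + v + a) / 2 ^ s
  have h1 : ∀ y, (Y y + v) / 2 ^ s ∈ S := fun y =>
    Finset.mem_union_left _ (Finset.mem_image_of_mem _ (Finset.mem_univ y))
  have h2 : ∀ y, (Y y + v + a) / 2 ^ s ∈ S := fun y =>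
    Finset.mem_union_right _ (Finset.mem_image_of_mem (fun y => (Y y + v + a) / 2 ^ s)
      (Finset.mem_univ y))
  rw [shiftTV_eq_sum q Y s a v h1 h2, ← sum_fibMass_mul q _ g h1, ← sum_fibMass_mul q _ g h2,
    Finset.mul_sum, ← Finset.sum_add_distrib]
  refine Finset.sum_le_sum fun k _ => ?_
  set c := fibMass q (fun y => (Y y + v) / 2 ^ s) k
  set d := fibMass q (fun y => (Y y + v + a) / 2 ^ s) k
  have h3 : (c - d) * g k ≤ |c - d| * |g k| := by rw [← abs_mul]; exact le_abs_self _
  have h4 : |c - d| * |g k| ≤ |c - d| * B := mul_le_mul_of_nonneg_left (hg k) (abs_nonneg _)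
  nlinarith

/-- If `Y` is nearly invariant under translation by `a`, and `g` has small averages along
progressions of step `a`, then `g` has small mean. -/
lemma sum_mean_le_of_shiftTV {q : β → ℝ} (hq : ∀ y, 0 ≤ q y) (sq : ∑ y, q y = 1) (Y : β → ℤ)
    (s a R : ℕ) (hR : 1 ≤ R) {τ : ℝ}
    (hτ : ∑ u ∈ Finset.range (2 ^ s), shiftTV q Y s a u ≤ τ * 2 ^ s)
    {g : ℤ → ℝ} {B b : ℝ} (hg : ∀ k, |g k| ≤ B)
    (hb : ∀ z : ℤ, ∑ r ∈ Finset.range R, g ((z + r * a) / 2 ^ s) ≤ b * R) :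
    ∑ u ∈ Finset.range (2 ^ s), ∑ y, q y * g ((Y y + u) / 2 ^ s) ≤ 2 ^ s * (b + B * R * τ) := by
  have hB : 0 ≤ B := (abs_nonneg _).trans (hg 0)
  set W : ℕ → ℝ := fun r => ∑ u ∈ Finset.range (2 ^ s),
    ∑ y, q y * g ((Y y + (r * a + u : ℤ)) / 2 ^ s) with hW
  have h1 : ∀ r, W r ≤ W (r + 1) + B * (τ * 2 ^ s) := by
    intro r
    have e : ∑ u ∈ Finset.range (2 ^ s), shiftTV q Y s a (r * a + u) ≤ τ * 2 ^ s := by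
      rw [sum_range_shift_of_periodic (shiftTV_add_two_pow q Y s a)]
      exact hτ
    refine le_trans ?_ (add_le_add le_rfl (mul_le_mul_of_nonneg_left e hB))
    simp only [hW]
    rw [Finset.mul_sum, ← Finset.sum_add_distrib]
    refine Finset.sum_le_sum fun u _ => ?_
    refine (sum_mul_le_add_shiftTV q Y s a _ hg).trans (le_of_eq ?_)
    congr 1
    refine Finset.sum_congr rfl fun y _ => ?_
    congr 3
    push_cast
    ring
  have h2 : ∀ r : ℕ, W 0 ≤ W r + r * (B * (τ * 2 ^ s)) := by
    intro r
    induction r with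
    | zero => simp
    | succ r ih => have := h1 r; push_cast; linarith
  have hτ0 : 0 ≤ τ * 2 ^ s := (Finset.sum_nonneg fun _ _ => shiftTV_nonneg _ _ _ _ _).trans hτ
  have h3 : ∀ r ∈ Finset.range R, W 0 ≤ W r + R * (B * (τ * 2 ^ s)) := by
    intro r hr
    refine (h2 r).trans (add_le_add le_rfl (mul_le_mul_of_nonneg_right ?_ (mul_nonneg hB hτ0)))
    exact_mod_cast (Finset.mem_range.1 hr).le
  have h4 := Finset.sum_le_sum h3
  rw [Finset.sum_add_distrib, Finset.sum_const, Finset.sum_const, Finset.card_range,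
    nsmul_eq_mul, nsmul_eq_mul] at h4
  have h5 : ∑ r ∈ Finset.range R, W r ≤ 2 ^ s * (b * R) := by
    simp only [hW]
    rw [Finset.sum_comm]
    have : ∀ u ∈ Finset.range (2 ^ s), ∑ r ∈ Finset.range R,
        ∑ y, q y * g ((Y y + (r * a + u : ℤ)) / 2 ^ s) ≤ b * R := by
      intro u _
      rw [Finset.sum_comm]
      simp only [← Finset.mul_sum]
      have h6 : ∀ y ∈ Finset.univ, q y * ∑ r ∈ Finset.range R,
          g ((Y y + (r * a + u : ℤ)) / 2 ^ s) ≤ q y * (b * R) := by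
        intro y _
        refine mul_le_mul_of_nonneg_left (le_trans (le_of_eq ?_) (hb (Y y + u))) (hq y)
        refine Finset.sum_congr rfl fun r _ => ?_
        congr 2
        ring
      refine (Finset.sum_le_sum h6).trans (le_of_eq ?_)
      rw [← Finset.sum_mul, sq, one_mul]
    refine (Finset.sum_le_sum this).trans (le_of_eq ?_)
    simp
  have hR' : (0 : ℝ) < R := by exact_mod_cast hR
  have h6 : W 0 = ∑ u ∈ Finset.range (2 ^ s), ∑ y, q y * g ((Y y + u) / 2 ^ s) := by
    simp [hW]
  rw [← h6]
  have h7 : R * W 0 ≤ R * (2 ^ s * (b + B * R * τ)) := by nlinarith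
  exact le_of_mul_le_mul_left h7 hR'

end NearInvariance

section Equidistribution

lemma two_pow_mul_add_ediv (K : ℤ) {m b : ℕ} (hb : b < 2 ^ m) : (2 ^ m * K + b : ℤ) / 2 ^ m = K := by
  have h2 : (0 : ℤ) < 2 ^ m := by positivity
  rw [add_comm, Int.add_mul_ediv_left _ _ h2.ne', Int.ediv_eq_zero_of_lt (by positivity)
    (by exact_mod_cast hb), zero_add]

/-- The difference between `φ` and its average over the dyadic block of length `2 ^ m`. -/
def blockFluct (m : ℕ) (φ : ℤ → ℝ) (c : ℤ) : ℝ :=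
  φ c - (2 ^ m)⁻¹ * ∑ b ∈ Finset.range (2 ^ m), φ (2 ^ m * (c / 2 ^ m) + b)

variable {m : ℕ} {φ : ℤ → ℝ}

lemma abs_blockFluct_le (h0 : ∀ k, 0 ≤ φ k) (h1 : ∀ k, φ k ≤ 1) (c : ℤ) :
    |blockFluct m φ c| ≤ 1 := by
  have e1 : 0 ≤ (2 ^ m : ℝ)⁻¹ * ∑ b ∈ Finset.range (2 ^ m), φ (2 ^ m * (c / 2 ^ m) + b) :=
    mul_nonneg (by positivity) (Finset.sum_nonneg fun _ _ => h0 _)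
  have e2 : (2 ^ m : ℝ)⁻¹ * ∑ b ∈ Finset.range (2 ^ m), φ (2 ^ m * (c / 2 ^ m) + b) ≤ 1 := by
    rw [inv_mul_le_iff₀ (by positivity), mul_one]
    refine (Finset.sum_le_sum fun b _ => h1 _).trans ?_
    simp
  rw [abs_le, blockFluct]
  constructor <;> linarith [h0 c, h1 c]

lemma sum_blockFluct_block (K : ℤ) :
    ∑ b ∈ Finset.range (2 ^ m), blockFluct m φ (2 ^ m * K + b) = 0 := by
  have : ∀ b ∈ Finset.range (2 ^ m), blockFluct m φ (2 ^ m * K + b) = φ (2 ^ m * K + b) -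
      (2 ^ m)⁻¹ * ∑ b ∈ Finset.range (2 ^ m), φ (2 ^ m * K + b) := by
    intro b hb
    rw [blockFluct, two_pow_mul_add_ediv K (Finset.mem_range.1 hb)]
  rw [Finset.sum_congr rfl this, Finset.sum_sub_distrib, Finset.sum_const, Finset.card_range,
    nsmul_eq_mul]
  push_cast
  rw [mul_inv_cancel_left₀ (by positivity), sub_self]

lemma sum_blockFluct_ediv_block (t : ℕ) (K : ℤ) :
    ∑ v ∈ Finset.range (2 ^ (t + m)), blockFluct m φ ((2 ^ (t + m) * K + v) / 2 ^ t) = 0 := by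
  have e : (2 : ℕ) ^ (t + m) = 2 ^ m * 2 ^ t := by rw [pow_add, mul_comm]
  rw [e, sum_range_mul_eq (fun v : ℕ => blockFluct m φ ((2 ^ (t + m) * K + v) / 2 ^ t))]
  have : ∀ b ∈ Finset.range (2 ^ m), ∑ j ∈ Finset.range (2 ^ t),
      blockFluct m φ ((2 ^ (t + m) * K + (b * 2 ^ t + j : ℕ)) / 2 ^ t) =
      2 ^ t * blockFluct m φ (2 ^ m * K + b) := by
    intro b _
    have : ∀ j ∈ Finset.range (2 ^ t),
        blockFluct m φ ((2 ^ (t + m) * K + (b * 2 ^ t + j : ℕ)) / 2 ^ t) =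
        blockFluct m φ (2 ^ m * K + b) := by
      intro j hj
      rw [← two_pow_mul_add_ediv (2 ^ m * K + b) (Finset.mem_range.1 hj), pow_add]
      congr 2
      push_cast
      ring
    rw [Finset.sum_congr rfl this, Finset.sum_const, Finset.card_range, nsmul_eq_mul]
    push_cast
    rfl
  rw [Finset.sum_congr rfl this, ← Finset.mul_sum, sum_blockFluct_block, mul_zero]

lemma abs_sum_blockFluct_aligned_le (h0 : ∀ k, 0 ≤ φ k) (h1 : ∀ k, φ k ≤ 1) (t V : ℕ) :
    ∀ K : ℤ, |∑ v ∈ Finset.range V, blockFluct m φ ((2 ^ (t + m) * K + v) / 2 ^ t)| ≤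
      2 ^ (t + m) := by
  induction V using Nat.strong_induction_on with
  | _ V ih =>
    intro K
    by_cases hV : V < 2 ^ (t + m)
    · refine (Finset.abs_sum_le_sum_abs _ _).trans ((Finset.sum_le_sum fun v _ =>
        abs_blockFluct_le h0 h1 _).trans ?_)
      simp only [Finset.sum_const, Finset.card_range, nsmul_eq_mul, mul_one]
      exact_mod_cast hV.le
    · obtain ⟨V', rfl⟩ := Nat.exists_eq_add_of_le (not_lt.1 hV)
      rw [Finset.sum_range_add, sum_blockFluct_ediv_block, zero_add]
      refine le_trans (le_of_eq ?_) (ih V' (by have := Nat.two_pow_pos (t + m); omega) (K + 1))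
      congr 1
      refine Finset.sum_congr rfl fun v _ => ?_
      congr 2
      push_cast
      ring

lemma abs_sum_blockFluct_le (h0 : ∀ k, 0 ≤ φ k) (h1 : ∀ k, φ k ≤ 1) (t V : ℕ) (z : ℤ) :
    |∑ v ∈ Finset.range V, blockFluct m φ ((z + v) / 2 ^ t)| ≤ 2 * 2 ^ (t + m) := by
  have hP : (0 : ℤ) < 2 ^ (t + m) := by positivity
  set K := z / 2 ^ (t + m)
  obtain ⟨ρ, hρ⟩ := Int.eq_ofNat_of_zero_le (Int.emod_nonneg z hP.ne')
  have hz : z = 2 ^ (t + m) * K + ρ := by rw [← hρ]; exact (Int.mul_ediv_add_emod _ _).symm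
  have e := Finset.sum_range_add
    (fun v : ℕ => blockFluct m φ ((2 ^ (t + m) * K + v) / 2 ^ t)) ρ V
  have e2 : ∑ v ∈ Finset.range V, blockFluct m φ ((z + v) / 2 ^ t) =
      ∑ v ∈ Finset.range V, blockFluct m φ ((2 ^ (t + m) * K + (ρ + v : ℕ)) / 2 ^ t) := by
    refine Finset.sum_congr rfl fun v _ => ?_
    rw [hz]
    congr 2
    push_cast
    ring
  rw [e2, ← sub_eq_iff_eq_add'.2 e]
  refine (abs_sub _ _).trans ?_
  linarith [abs_sum_blockFluct_aligned_le h0 h1 t (ρ + V) K (m := m),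
    abs_sum_blockFluct_aligned_le h0 h1 t ρ K (m := m)]

lemma ediv_add_sub_ediv_le (z : ℤ) (V t : ℕ) :
    (((z + V) / 2 ^ t - z / 2 ^ t : ℤ) : ℝ) ≤ V / 2 ^ t + 1 := by
  have hP : (0 : ℤ) < 2 ^ t := by positivity
  have e1 := Int.mul_ediv_add_emod (z + V) (2 ^ t)
  have e2 := Int.mul_ediv_add_emod z (2 ^ t)
  have e3 := Int.emod_nonneg (z + V) hP.ne'
  have e4 := Int.emod_lt_of_pos z hP
  have h : (2 : ℤ) ^ t * ((z + V) / 2 ^ t - z / 2 ^ t) ≤ V + 2 ^ t := by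
    rw [mul_sub]; linarith
  have h' : (2 : ℝ) ^ t * (((z + V) / 2 ^ t - z / 2 ^ t : ℤ) : ℝ) ≤ V + 2 ^ t := by
    exact_mod_cast h
  have : (V : ℝ) / 2 ^ t + 1 = (V + 2 ^ t) / 2 ^ t := by field_simp
  rw [this, le_div_iff₀ (by positivity)]
  linarith

/-- A progression of small step equidistributes among dyadic cells. -/
lemma sum_blockFluct_progression_le (h0 : ∀ k, 0 ≤ φ k) (h1 : ∀ k, φ k ≤ 1) (t a R : ℕ)
    (ha : 1 ≤ a) (z : ℤ) :
    ∑ r ∈ Finset.range R, blockFluct m φ ((z + r * a) / 2 ^ t) ≤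
      2 * 2 ^ (t + m) / a + 2 * (R * a / 2 ^ t + 1) := by
  have hP : (0 : ℤ) < 2 ^ t := by positivity
  have ha' : (0 : ℝ) < a := by exact_mod_cast ha
  set c : ℕ → ℤ := fun r => (z + r * a) / 2 ^ t with hc
  have key : ∀ r : ℕ, a * blockFluct m φ (c r) ≤
      ∑ i ∈ Finset.range a, blockFluct m φ ((z + (r * a + i : ℕ)) / 2 ^ t) +
        2 * a * (c (r + 1) - c r : ℤ) := by
    intro r
    have : ∀ i ∈ Finset.range a, blockFluct m φ (c r) ≤
        blockFluct m φ ((z + (r * a + i : ℕ)) / 2 ^ t) + 2 * (c (r + 1) - c r : ℤ) := by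
      intro i hi
      have hi' : (i : ℤ) < a := by exact_mod_cast Finset.mem_range.1 hi
      have m1 : c r ≤ (z + (r * a + i : ℕ)) / 2 ^ t :=
        Int.ediv_le_ediv hP (by push_cast; linarith)
      have m2 : (z + (r * a + i : ℕ)) / 2 ^ t ≤ c (r + 1) :=
        Int.ediv_le_ediv hP (by push_cast; linarith)
      rcases m1.eq_or_lt with h | h
      · rw [← h]
        have : (0 : ℝ) ≤ (c (r + 1) - c r : ℤ) := by exact_mod_cast (by linarith)
        linarith
      · have : (1 : ℝ) ≤ (c (r + 1) - c r : ℤ) := by exact_mod_cast (by linarith)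
        have b1 := abs_le.1 (abs_blockFluct_le (m := m) h0 h1 (c r))
        have b2 := abs_le.1 (abs_blockFluct_le (m := m) h0 h1 ((z + (r * a + i : ℕ)) / 2 ^ t))
        linarith [b1.2, b2.1]
    have := Finset.sum_le_sum this
    rw [Finset.sum_const, Finset.card_range, nsmul_eq_mul, Finset.sum_add_distrib,
      Finset.sum_const, Finset.card_range, nsmul_eq_mul] at this
    linarith
  have h2 := Finset.sum_le_sum fun r (_ : r ∈ Finset.range R) => key r
  rw [← Finset.mul_sum, Finset.sum_add_distrib, ← Finset.mul_sum, ← Int.cast_sum,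
    Finset.sum_range_sub c R,
    ← sum_range_mul_eq (fun v : ℕ => blockFluct m φ ((z + v) / 2 ^ t))] at h2
  have h3 := (abs_le.1 (abs_sum_blockFluct_le (m := m) h0 h1 t (R * a) z)).2
  have h4 := ediv_add_sub_ediv_le z (R * a) t
  have h5 : ((c R - c 0 : ℤ) : ℝ) ≤ R * a / 2 ^ t + 1 := by
    simpa [hc] using h4
  have h6 : a * ∑ r ∈ Finset.range R, blockFluct m φ (c r) ≤
      2 * 2 ^ (t + m) + 2 * a * (R * a / 2 ^ t + 1) := by
    have := mul_le_mul_of_nonneg_left h5 (by positivity : 0 ≤ 2 * (a : ℝ))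
    linarith
  have h7 : (2 : ℝ) * 2 ^ (t + m) / a + 2 * (R * a / 2 ^ t + 1) =
      (2 * 2 ^ (t + m) + 2 * a * (R * a / 2 ^ t + 1)) / a := by
    field_simp
  rw [h7, le_div_iff₀ ha', mul_comm]
  exact h6

/-- A progression of step at least `2 ^ s` rarely falls in the first `2 ^ s` positions
of a dyadic cell of length `2 ^ (s + d)`. -/
lemma sum_dvd_progression_le (s d a R : ℕ) (ha : 2 ^ s ≤ a) (z : ℤ) :
    ∑ r ∈ Finset.range R, (if (2 : ℤ) ^ d ∣ (z + r * a) / 2 ^ s then (1 : ℝ) else 0) ≤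
      R * a / 2 ^ (s + d) + 1 := by
  have hs : (0 : ℤ) < 2 ^ s := by positivity
  have hP : (0 : ℤ) < 2 ^ (s + d) := by positivity
  have ha' : (2 : ℤ) ^ s ≤ a := by exact_mod_cast ha
  set c : ℕ → ℤ := fun r => (z - a + r * a) / 2 ^ (s + d) with hc
  have key : ∀ r ∈ Finset.range R, (if (2 : ℤ) ^ d ∣ (z + r * a) / 2 ^ s then (1 : ℝ) else 0) ≤
      (c (r + 1) - c r : ℤ) := by
    intro r _
    have m1 : c r ≤ c (r + 1) := Int.ediv_le_ediv hP (by push_cast; linarith)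
    split_ifs with h
    · obtain ⟨e, he⟩ := h
      have h1 : c (r + 1) = e := by
        simp only [hc]
        rw [ediv_two_pow_add]
        rw [show z - a + ((r + 1 : ℕ) : ℤ) * a = z + r * a by push_cast; ring, he]
        exact Int.mul_ediv_cancel_left _ (by positivity)
      have h2 : c r < e := by
        simp only [hc]
        rw [Int.ediv_lt_iff_lt_mul hP]
        have e1 := Int.mul_ediv_add_emod (z + r * a) (2 ^ s)
        have e2 := Int.emod_lt_of_pos (z + r * a) hs
        rw [he] at e1
        have : e * (2 : ℤ) ^ (s + d) = 2 ^ s * (2 ^ d * e) := by rw [pow_add]; ring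
        rw [this]
        linarith
      rw [h1]
      exact_mod_cast (by linarith : (1 : ℤ) ≤ e - c r)
    · exact_mod_cast (by linarith : (0 : ℤ) ≤ c (r + 1) - c r)
  refine (Finset.sum_le_sum key).trans ?_
  rw [← Int.cast_sum, Finset.sum_range_sub c R]
  have h4 := ediv_add_sub_ediv_le (z - a) (R * a) (s + d)
  simpa [hc] using h4

variable {β : Type*} [Fintype β]

/-- Near invariance under translation by `a` makes the law nearly uniform inside dyadic blocks
of length much larger than `a`. -/
lemma sum_blockFluct_le_of_shiftTV {q : β → ℝ} (hq : ∀ y, 0 ≤ q y) (sq : ∑ y, q y = 1) (Y : β → ℤ)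
    (s M l a R : ℕ) (hR : 1 ≤ R) (ha : 2 ^ s ≤ a) (ha' : a ≤ 2 ^ (s + M)) {τ : ℝ}
    (hτ : ∑ u ∈ Finset.range (2 ^ s), shiftTV q Y s a u ≤ τ * 2 ^ s)
    (h0 : ∀ k, 0 ≤ φ k) (h1 : ∀ k, φ k ≤ 1) :
    ∑ y, q y * blockFluct m φ (Y y / 2 ^ (s + (M + l))) ≤
      (2 * 2 ^ (M + l + m) + 4) / R + 4 * (2 ^ l)⁻¹ + 3 * R * τ := by
  set d := M + l with hd
  set g : ℤ → ℝ := fun k => blockFluct m φ (k / 2 ^ d) + 2 * (if (2 : ℤ) ^ d ∣ k then 1 else 0)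
    with hg
  have hgB : ∀ k, |g k| ≤ 3 := by
    intro k
    have := abs_le.1 (abs_blockFluct_le (m := m) h0 h1 (k / 2 ^ d))
    simp only [hg]
    rw [abs_le]
    split_ifs <;> constructor <;> linarith
  have hR' : (0 : ℝ) < R := by exact_mod_cast hR
  have har : (2 : ℝ) ^ s ≤ a := by exact_mod_cast ha
  have har' : (a : ℝ) ≤ 2 ^ (s + M) := by exact_mod_cast ha'
  have ha0 : (0 : ℝ) < a := lt_of_lt_of_le (by positivity) har
  have q1 : (2 : ℝ) * 2 ^ (s + d + m) / a ≤ 2 * 2 ^ (d + m) := by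
    rw [div_le_iff₀ ha0, add_assoc, pow_add]
    have : (0 : ℝ) < 2 ^ (d + m) := by positivity
    nlinarith
  have q2 : (R : ℝ) * a / 2 ^ (s + d) ≤ R * (2 ^ l)⁻¹ := by
    rw [div_le_iff₀ (by positivity), hd, ← add_assoc, pow_add _ (s + M) l, mul_assoc]
    refine mul_le_mul_of_nonneg_left ?_ hR'.le
    rw [mul_comm, mul_inv_cancel_right₀ (by positivity)]
    exact har'
  have hb : ∀ z : ℤ, ∑ r ∈ Finset.range R, g ((z + r * a) / 2 ^ s) ≤
      ((2 * 2 ^ (d + m) + 4) / R + 4 * (2 ^ l)⁻¹) * R := by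
    intro z
    simp only [hg, ← ediv_two_pow_add]
    rw [Finset.sum_add_distrib, ← Finset.mul_sum]
    have e1 := sum_blockFluct_progression_le (m := m) h0 h1 (s + d) a R
      (le_trans Nat.one_le_two_pow ha) z
    have e2 := sum_dvd_progression_le s d a R ha z
    have e3 : ((2 * 2 ^ (d + m) + 4) / R + 4 * (2 ^ l)⁻¹) * (R : ℝ) =
        2 * 2 ^ (d + m) + 4 + 4 * (R * (2 ^ l)⁻¹) := by field_simp
    rw [e3]
    linarith
  have key := sum_mean_le_of_shiftTV hq sq Y s a R hR hτ hgB hb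
  have low : ∀ u ∈ Finset.range (2 ^ s), ∑ y, q y * blockFluct m φ (Y y / 2 ^ (s + d)) ≤
      ∑ y, q y * g ((Y y + u) / 2 ^ s) := by
    intro u hu
    refine Finset.sum_le_sum fun y _ => mul_le_mul_of_nonneg_left ?_ (hq y)
    have hu' : (u : ℤ) < 2 ^ s := by exact_mod_cast Finset.mem_range.1 hu
    have hs : (0 : ℤ) < 2 ^ s := by positivity
    have hP : (0 : ℤ) < 2 ^ (s + d) := by positivity
    simp only [hg, ← ediv_two_pow_add]
    set K := (Y y + u) / 2 ^ (s + d) with hK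
    have m1 : Y y / 2 ^ (s + d) ≤ K := Int.ediv_le_ediv hP (by linarith)
    rcases m1.eq_or_lt with h | h
    · rw [h]
      split_ifs <;> linarith
    · have b1 := abs_le.1 (abs_blockFluct_le (m := m) h0 h1 (Y y / 2 ^ (s + d)))
      have b2 := abs_le.1 (abs_blockFluct_le (m := m) h0 h1 K)
      rw [Int.ediv_lt_iff_lt_mul hP] at h
      have e1 : 2 ^ (s + d) * ((Y y + u) / 2 ^ (s + d)) ≤ Y y + u := by
        linarith [Int.mul_ediv_add_emod (Y y + u) (2 ^ (s + d)), Int.emod_nonneg (Y y + u) hP.ne']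
      have e : K * (2 : ℤ) ^ (s + d) = 2 ^ s * (2 ^ d * K) := by rw [pow_add]; ring
      have : (Y y + u) / 2 ^ s = 2 ^ d * K := by
        apply le_antisymm
        · rw [← Int.lt_add_one_iff, Int.ediv_lt_iff_lt_mul hs]
          linarith
        · rw [Int.le_ediv_iff_mul_le hs]
          rw [← hK] at e1
          linarith [mul_comm K (2 ^ (s + d))]
      rw [this, if_pos (dvd_mul_right _ _)]
      linarith [b1.2, b2.1]
  have low' := Finset.sum_le_sum low
  rw [Finset.sum_const, Finset.card_range, nsmul_eq_mul] at low'
  push_cast at low'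
  exact le_of_mul_le_mul_left (low'.trans key) (by positivity)

end Equidistribution

section Scales

lemma sum_ediv_add_sub_ediv {r N : ℕ} (hr : r ≤ N) (a : ℕ) (z : ℤ) :
    ∑ u ∈ Finset.range (2 ^ N), ((z + u + a) / 2 ^ r - (z + u) / 2 ^ r) = a * 2 ^ (N - r) := by
  induction a generalizing z with
  | zero => simp
  | succ a ih =>
    have h1 : ∑ u ∈ Finset.range (2 ^ N), ((z + u + 1) / 2 ^ r - (z + u) / 2 ^ r) =
        2 ^ (N - r) := by
      have := Finset.sum_range_sub (fun u : ℕ => (z + u) / (2 : ℤ) ^ r) (2 ^ N)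
      rw [← Finset.sum_congr rfl fun u _ => by
        rw [show z + ((u + 1 : ℕ) : ℤ) = z + u + 1 by push_cast; ring]] at this
      rw [this]
      have e : (2 : ℤ) ^ N = 2 ^ r * 2 ^ (N - r) := by rw [← pow_add, Nat.add_sub_cancel' hr]
      push_cast
      rw [e, Int.add_mul_ediv_left _ _ (by positivity)]
      simp
    have h2 := ih (z + 1)
    push_cast
    rw [add_mul, one_mul, ← h2, ← h1, ← Finset.sum_add_distrib]
    refine Finset.sum_congr rfl fun u _ => ?_
    rw [show z + 1 + (u : ℤ) + a = z + u + (a + 1) by ring,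
      show z + 1 + (u : ℤ) = z + u + 1 by ring]
    ring

lemma sum_ite_ediv_ne_le {r N : ℕ} (hr : r ≤ N) (a : ℕ) (z : ℤ) :
    ∑ u ∈ Finset.range (2 ^ N),
      (if (z + u) / 2 ^ r ≠ (z + u + a) / 2 ^ r then (1 : ℝ) else 0) ≤ a * 2 ^ (N - r) := by
  have hP : (0 : ℤ) < 2 ^ r := by positivity
  have key : ∀ u ∈ Finset.range (2 ^ N),
      (if (z + u) / 2 ^ r ≠ (z + u + a) / 2 ^ r then (1 : ℝ) else 0) ≤
        (((z + u + a) / 2 ^ r - (z + u) / 2 ^ r : ℤ) : ℝ) := by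
    intro u _
    have m1 : (z + u) / 2 ^ r ≤ (z + u + a) / 2 ^ r := Int.ediv_le_ediv hP (by linarith)
    split_ifs with h
    · have := lt_of_le_of_ne m1 h
      exact_mod_cast (by linarith : (1 : ℤ) ≤ (z + u + a) / 2 ^ r - (z + u) / 2 ^ r)
    · exact_mod_cast (by linarith : (0 : ℤ) ≤ (z + u + a) / 2 ^ r - (z + u) / 2 ^ r)
  refine (Finset.sum_le_sum key).trans ?_
  rw [← Int.cast_sum, sum_ediv_add_sub_ediv hr]
  push_cast
  rfl

variable {α β : Type*}

/-- The dyadic cell of `X x + Y y + u` at scale `2 ^ s`. -/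
def sumCell (X : α → ℤ) (Y : β → ℤ) (s u : ℕ) (x : α) (y : β) : ℤ := (Y y + (X x + u)) / 2 ^ s

lemma sumCell_add (X : α → ℤ) (Y : β → ℤ) (s L u : ℕ) :
    sumCell X Y (s + L) u = fun x y => sumCell X Y s u x y / 2 ^ L := by
  funext x y
  exact ediv_two_pow_add _ _ _

variable [Fintype α] [Fintype β]

/-- The distance between the conditional law of the cell `sumCell X Y s u x` and its prediction
from the coarser scale `s + L`. -/
def predErr (p : α → ℝ) (q : β → ℝ) (X : α → ℤ) (Y : β → ℤ) (s L u : ℕ) (x : α) : ℝ :=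
  ∑ k ∈ Finset.univ.image fun z : α × β => sumCell X Y s u z.1 z.2,
    |fibMass q (sumCell X Y s u x) k -
      predMass p q (sumCell X Y s u) (fun k => k / 2 ^ L) x k|

lemma predErr_nonneg (p : α → ℝ) (q : β → ℝ) (X : α → ℤ) (Y : β → ℤ) (s L u : ℕ) (x : α) :
    0 ≤ predErr p q X Y s L u x :=
  Finset.sum_nonneg fun _ _ => abs_nonneg _

lemma sumCell_mem (X : α → ℤ) (Y : β → ℤ) (s u : ℕ) (x : α) (y : β) :
    sumCell X Y s u x y ∈ Finset.univ.image fun z : α × β => sumCell X Y s u z.1 z.2 :=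
  Finset.mem_image_of_mem (fun z : α × β => sumCell X Y s u z.1 z.2) (Finset.mem_univ (x, y))

/-- The average of `predErr` over translations and over `x`, up to the factor `2 ^ N`. -/
def scaleErr (p : α → ℝ) (q : β → ℝ) (X : α → ℤ) (Y : β → ℤ) (N L s : ℕ) : ℝ :=
  ∑ u ∈ Finset.range (2 ^ N), ∑ x, p x * predErr p q X Y s L u x

lemma sum_shift_telescope_le {J : ℕ → ℝ} (hJ : Antitone J) (h0 : ∀ s, 0 ≤ J s) (L n : ℕ) :
    ∑ s ∈ Finset.range n, (J s - J (s + L)) ≤ L * J 0 := by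
  have e1 := Finset.sum_range_add J n L
  have e2 := Finset.sum_range_add J L n
  rw [add_comm L n, e1] at e2
  have e3 : ∑ s ∈ Finset.range n, J (s + L) = ∑ s ∈ Finset.range n, J (L + s) :=
    Finset.sum_congr rfl fun s _ => by rw [add_comm]
  rw [Finset.sum_sub_distrib, e3]
  have e4 : ∑ s ∈ Finset.range L, J s ≤ L * J 0 := by
    refine (Finset.sum_le_sum fun s _ => hJ (Nat.zero_le s)).trans ?_
    simp
  have e5 : 0 ≤ ∑ s ∈ Finset.range L, J (n + s) := Finset.sum_nonneg fun _ _ => h0 _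
  linarith

variable {p : α → ℝ} {q : β → ℝ}

lemma sum_sq_scaleErr_le (hp : ∀ x, 0 < p x) (hq : ∀ y, 0 < q y) (sp : ∑ x, p x = 1)
    (sq : ∑ y, q y = 1) (X : α → ℤ) (Y : β → ℤ) (N L n : ℕ) :
    ∑ s ∈ Finset.range n, (scaleErr p q X Y N L s / 2 ^ N) ^ 2 ≤
      4 * L * mutInfo p q (fun x y => X x + Y y) := by
  set J : ℕ → ℕ → ℝ := fun u s => mutInfo p q (sumCell X Y s u) with hJ
  have hmono : ∀ u s L, J u (s + L) ≤ J u s := by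
    intro u s L
    simp only [hJ, sumCell_add]
    exact mutInfo_comp_le hp hq sp sq _ (fun k => k / 2 ^ L)
  have hanti : ∀ u, Antitone (J u) := fun u => antitone_nat_of_succ_le fun s => hmono u s 1
  have h0 : ∀ u s, 0 ≤ J u s := fun u s => mutInfo_nonneg hp hq sp sq _
  have htop : ∀ u, J u 0 ≤ mutInfo p q (fun x y => X x + Y y) := by
    intro u
    have := mutInfo_comp_le hp hq sp sq (fun x y => X x + Y y) (fun k => k + u)
    refine le_trans (le_of_eq ?_) this
    simp only [hJ]
    congr 1
    funext x y
    simp [sumCell]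
    ring
  have h1 : ∀ s, (scaleErr p q X Y N L s) ^ 2 ≤
      2 ^ N * ∑ u ∈ Finset.range (2 ^ N), 4 * (J u s - J u (s + L)) := by
    intro s
    have c := sq_sum_le_card_mul_sum_sq (s := Finset.range (2 ^ N))
      (f := fun u => ∑ x, p x * predErr p q X Y s L u x)
    rw [Finset.card_range] at c
    push_cast at c
    refine c.trans (mul_le_mul_of_nonneg_left (Finset.sum_le_sum fun u _ => ?_) (by positivity))
    simp only [hJ, sumCell_add]
    exact sq_sum_abs_sub_predMass_le hp hq sp sq (sumCell X Y s u) (fun k => k / 2 ^ L)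
      (sumCell_mem X Y s u)
  have h2 : ∑ s ∈ Finset.range n, (scaleErr p q X Y N L s) ^ 2 ≤
      2 ^ N * (2 ^ N * (4 * L * mutInfo p q (fun x y => X x + Y y))) := by
    refine (Finset.sum_le_sum fun s _ => h1 s).trans ?_
    rw [← Finset.mul_sum, Finset.sum_comm]
    refine mul_le_mul_of_nonneg_left ?_ (by positivity)
    have : ∀ u ∈ Finset.range (2 ^ N), ∑ s ∈ Finset.range n, 4 * (J u s - J u (s + L)) ≤
        4 * L * mutInfo p q (fun x y => X x + Y y) := by
      intro u _
      rw [← Finset.mul_sum, mul_assoc]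
      refine mul_le_mul_of_nonneg_left ((sum_shift_telescope_le (hanti u) (h0 u) L n).trans ?_)
        (by norm_num)
      exact mul_le_mul_of_nonneg_left (htop u) (by positivity)
    refine (Finset.sum_le_sum this).trans ?_
    simp
  simp only [div_pow]
  rw [← Finset.sum_div, div_le_iff₀ (by positivity)]
  linarith

/-- At a scale where the sum is well predicted from coarser scales, and where the first variable
has enough entropy, the second variable is nearly invariant under some translation. -/
lemma exists_shiftTV_le (hp : ∀ x, 0 < p x) (hq : ∀ y, 0 < q y) (sp : ∑ x, p x = 1)
    (sq : ∑ y, q y = 1) (X : α → ℤ) (Y : β → ℤ) {s L N M : ℕ} (hN : s + L ≤ N) (hM : 1 ≤ M)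
    {κ b : ℝ} (hb : 0 < b) (hκ : 0 < κ) (hE : scaleErr p q X Y N L s / 2 ^ N ≤ κ)
    (hent : (2 + b * (M + 1)) * Real.log 2 <
      fibEnt p (fun x => X x / 2 ^ s) - fibEnt p (fun x => X x / 2 ^ (s + M))) :
    ∃ a : ℕ, 2 ^ s ≤ a ∧ a ≤ 2 ^ (s + M) ∧
      ∑ u ∈ Finset.range (2 ^ s), shiftTV q Y s a u ≤ (2 * (κ / b) + 2 * (2 ^ M / 2 ^ L)) * 2 ^ s := by
  classical
  set E : α → ℝ := fun x => ∑ u ∈ Finset.range (2 ^ N), predErr p q X Y s L u x with hEdef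
  have hE0 : ∀ x, 0 ≤ E x := fun x => Finset.sum_nonneg fun u _ => predErr_nonneg _ _ _ _ _ _ _ _
  have hsum : ∑ x, p x * E x ≤ κ * 2 ^ N := by
    rw [div_le_iff₀ (by positivity)] at hE
    refine le_trans (le_of_eq ?_) hE
    simp only [hEdef, scaleErr, Finset.mul_sum]
    rw [Finset.sum_comm]
  have hG : ∑ x, (if E x ≤ κ / b * 2 ^ N then 0 else p x) ≤ b := by
    have h1 : ∑ x, (if E x ≤ κ / b * 2 ^ N then 0 else p x) * (κ / b * 2 ^ N) ≤
        ∑ x, p x * E x := by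
      refine Finset.sum_le_sum fun x _ => ?_
      split_ifs with h
      · simpa using mul_nonneg (hp x).le (hE0 x)
      · exact mul_le_mul_of_nonneg_left (not_le.1 h).le (hp x).le
    rw [← Finset.sum_mul] at h1
    have h2 := h1.trans hsum
    have h3 : κ * 2 ^ N = b * (κ / b * 2 ^ N) := by field_simp
    rw [h3] at h2
    exact le_of_mul_le_mul_right h2 (by positivity)
  obtain ⟨x, x', gx, gx', l1, l2⟩ := exists_far_pair hp sp X s M hM
    (fun x => E x ≤ κ / b * 2 ^ N) hG hent
  have hpos : (0 : ℤ) < 2 ^ s := by positivity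
  obtain ⟨a, ha⟩ := Int.eq_ofNat_of_zero_le (by linarith : 0 ≤ X x' - X x)
  have ha1 : (2 : ℤ) ^ s ≤ a := by linarith
  have ha2 : (a : ℤ) ≤ 2 ^ (s + M) := by linarith
  have ha1' : 2 ^ s ≤ a := by exact_mod_cast ha1
  have ha2' : a ≤ 2 ^ (s + M) := by exact_mod_cast ha2
  refine ⟨a, ha1', ha2', ?_⟩
  have hX : X x' = X x + a := by linarith
  have hstep : ∀ u : ℕ, shiftTV q Y s a (X x + u) ≤ predErr p q X Y s L u x +
      predErr p q X Y s L u x' +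
      2 * ∑ y, q y * (if (Y y + X x + u) / 2 ^ (s + L) ≠ (Y y + X x + u + a) / 2 ^ (s + L)
        then 1 else 0) := by
    intro u
    have := sum_abs_fibMass_sub_le (fun x => (hp x).le) (fun y => (hq y).le) (sumCell X Y s u)
      (fun k => k / 2 ^ L) (sumCell_mem X Y s u) x x'
    have e' : ∀ y, Y y + (X x + u) + a = Y y + (X x' + u) := fun y => by rw [hX]; ring
    rw [shiftTV_eq_sum q Y s a (X x + u)
      (S := Finset.univ.image fun z : α × β => sumCell X Y s u z.1 z.2)
      (fun y => sumCell_mem X Y s u x y) (fun y => by rw [e']; exact sumCell_mem X Y s u x' y)]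
    simp only [e']
    refine this.trans (le_of_eq ?_)
    congr 2
    refine Finset.sum_congr rfl fun y _ => ?_
    simp only [sumCell, ← ediv_two_pow_add]
    rw [show Y y + X x + u = Y y + (X x + u) by ring, e', mul_ite, mul_one, mul_zero]
  have hper := sum_range_mul_of_periodic (F := shiftTV q Y s a) (P := 2 ^ s)
    (shiftTV_add_two_pow q Y s a) (X x) (2 ^ (N - s))
  rw [← pow_add, Nat.sub_add_cancel (by omega : s ≤ N)] at hper
  have hcross : ∑ u ∈ Finset.range (2 ^ N), ∑ y, q y *
      (if (Y y + X x + u) / 2 ^ (s + L) ≠ (Y y + X x + u + a) / 2 ^ (s + L) then (1 : ℝ) else 0) ≤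
      a * 2 ^ (N - (s + L)) := by
    rw [Finset.sum_comm]
    simp only [← Finset.mul_sum]
    refine (Finset.sum_le_sum fun y _ => mul_le_mul_of_nonneg_left
      (sum_ite_ediv_ne_le hN a (Y y + X x)) (hq y).le).trans ?_
    rw [← Finset.sum_mul, sq, one_mul]
  have htot : ∑ u ∈ Finset.range (2 ^ N), shiftTV q Y s a (X x + u) ≤
      κ / b * 2 ^ N + κ / b * 2 ^ N + 2 * (a * 2 ^ (N - (s + L))) := by
    refine (Finset.sum_le_sum fun u _ => hstep u).trans ?_
    rw [Finset.sum_add_distrib, Finset.sum_add_distrib, ← Finset.mul_sum]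
    have g1 : ∑ u ∈ Finset.range (2 ^ N), predErr p q X Y s L u x ≤ κ / b * 2 ^ N := gx
    have g2 : ∑ u ∈ Finset.range (2 ^ N), predErr p q X Y s L u x' ≤ κ / b * 2 ^ N := gx'
    linarith
  rw [hper] at htot
  push_cast at htot
  have ar : (a : ℝ) ≤ 2 ^ (s + M) := by exact_mod_cast ha2'
  have e1 : (2 : ℝ) ^ N = 2 ^ (N - s) * 2 ^ s := by rw [← pow_add, Nat.sub_add_cancel (by omega)]
  have e2 : (2 : ℝ) ^ (N - s) = 2 ^ (N - (s + L)) * 2 ^ L := by rw [← pow_add]; congr 1; omega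
  have hPs : (0 : ℝ) < 2 ^ (N - s) := by positivity
  refine le_of_mul_le_mul_left (htot.trans ?_) hPs
  have e3 : (2 : ℝ) ^ (N - s) * ((2 * (κ / b) + 2 * (2 ^ M / 2 ^ L)) * 2 ^ s) =
      κ / b * 2 ^ N + κ / b * 2 ^ N + 2 * (2 ^ (s + M) * 2 ^ (N - (s + L))) := by
    rw [e1, e2, pow_add 2 s M]
    field_simp
    ring
  rw [e3]
  have := mul_le_mul_of_nonneg_right ar (by positivity : (0 : ℝ) ≤ 2 ^ (N - (s + L)))
  linarith

lemma mutInfo_add (sp : ∑ x, p x = 1) (X : α → ℤ) (Y : β → ℤ) :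
    mutInfo p q (fun x y => X x + Y y) =
      fibEnt (fun z : α × β => p z.1 * q z.2) (fun z => X z.1 + Y z.2) - fibEnt q Y := by
  have h1 : ∀ x y, fibMass q (fun y => X x + Y y) (X x + Y y) = fibMass q Y (Y y) := by
    intro x y
    simp [fibMass]
  have h2 : ∀ k, mixMass p q (fun x y => X x + Y y) k =
      fibMass (fun z : α × β => p z.1 * q z.2) (fun z => X z.1 + Y z.2) k := by
    intro k
    simp only [mixMass, fibMass]
    rw [Fintype.sum_prod_type]
    simp [Finset.mul_sum]
  simp only [mutInfo, fibEnt, h1, h2]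
  rw [Fintype.sum_prod_type]
  simp only [mul_sub, Finset.sum_sub_distrib]
  rw [← Finset.sum_mul, sp, one_mul]
  simp only [Finset.mul_sum, mul_assoc]
  ring

end Scales

section Components

variable {β : Type*} [Fintype β]

lemma sum_range_ite_eq_block (z K : ℤ) (m : ℕ) (c : ℝ) :
    ∑ b ∈ Finset.range (2 ^ m), (if z = 2 ^ m * K + b then c else 0) =
      if z / 2 ^ m = K then c else 0 := by
  have hP : (0 : ℤ) < 2 ^ m := by positivity
  split_ifs with h
  · obtain ⟨r, hr⟩ := Int.eq_ofNat_of_zero_le (Int.emod_nonneg z hP.ne')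
    have h1 := Int.mul_ediv_add_emod z (2 ^ m)
    have h2 := Int.emod_lt_of_pos z hP
    rw [hr, h] at h1
    rw [hr] at h2
    have h2' : r < 2 ^ m := by exact_mod_cast h2
    rw [Finset.sum_eq_single_of_mem r (Finset.mem_range.2 h2'), if_pos h1.symm]
    intro b _ hbr
    rw [if_neg]
    intro h3
    apply hbr
    have : (b : ℤ) = r := by linarith
    exact_mod_cast this
  · refine Finset.sum_eq_zero fun b hb => if_neg fun h3 => h ?_
    rw [h3, two_pow_mul_add_ediv K (Finset.mem_range.1 hb)]

lemma sum_block_fibMass_mul (q : β → ℝ) (f : β → ℤ) (g : ℤ → ℝ) (m : ℕ) (K : ℤ) :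
    ∑ b ∈ Finset.range (2 ^ m), fibMass q f (2 ^ m * K + b) * g (2 ^ m * K + b) =
      ∑ y, if f y / 2 ^ m = K then q y * g (f y) else 0 := by
  simp only [fibMass, Finset.sum_mul]
  rw [Finset.sum_comm]
  refine Finset.sum_congr rfl fun y _ => ?_
  rw [← sum_range_ite_eq_block]
  refine Finset.sum_congr rfl fun b _ => ?_
  split_ifs with h
  · rw [h]
  · simp

/-- The conditional probability of the cell `k` given its dyadic ancestor `m` levels up. -/
def cellProb (q : β → ℝ) (f : β → ℤ) (m : ℕ) (k : ℤ) : ℝ :=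
  fibMass q f k / fibMass q (fun y => f y / 2 ^ m) (k / 2 ^ m)

/-- The entropy at relative level `m` of the component in the cell `K`
(natural logarithms). -/
def compEnt (q : β → ℝ) (f : β → ℤ) (m : ℕ) (K : ℤ) : ℝ :=
  ∑ b ∈ Finset.range (2 ^ m), Real.negMulLog (cellProb q f m (2 ^ m * K + b))

variable {q : β → ℝ}

lemma cellProb_nonneg (hq : ∀ y, 0 ≤ q y) (f : β → ℤ) (m : ℕ) (k : ℤ) : 0 ≤ cellProb q f m k :=
  div_nonneg (fibMass_nonneg hq _ _) (fibMass_nonneg hq _ _)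

lemma cellProb_le_one (hq : ∀ y, 0 ≤ q y) (f : β → ℤ) (m : ℕ) (k : ℤ) : cellProb q f m k ≤ 1 :=
  div_le_one_of_le₀ (fibMass_le_comp hq f (fun k => k / 2 ^ m) k) (fibMass_nonneg hq _ _)

lemma cellProb_self_pos (hq : ∀ y, 0 < q y) (f : β → ℤ) (m : ℕ) (y : β) :
    0 < cellProb q f m (f y) :=
  div_pos (fibMass_self_pos hq f y) (fibMass_self_pos hq (fun y => f y / 2 ^ m) y)

lemma sum_cellProb (hq : ∀ y, 0 < q y) (f : β → ℤ) (m : ℕ) (y : β) :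
    ∑ b ∈ Finset.range (2 ^ m), cellProb q f m (2 ^ m * (f y / 2 ^ m) + b) = 1 := by
  have h1 := sum_block_fibMass_mul q f (fun _ => 1) m (f y / 2 ^ m)
  have h2 : ∀ b ∈ Finset.range (2 ^ m), cellProb q f m (2 ^ m * (f y / 2 ^ m) + b) =
      fibMass q f (2 ^ m * (f y / 2 ^ m) + b) * 1 / fibMass q (fun y => f y / 2 ^ m) (f y / 2 ^ m) := by
    intro b hb
    rw [cellProb, two_pow_mul_add_ediv _ (Finset.mem_range.1 hb), mul_one]
  rw [Finset.sum_congr rfl h2, ← Finset.sum_div, h1]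
  simp only [mul_one]
  exact div_self (fibMass_self_pos hq (fun y => f y / 2 ^ m) y).ne'

lemma compEnt_le (hq : ∀ y, 0 < q y) (f : β → ℤ) (m : ℕ) (y : β) :
    compEnt q f m (f y / 2 ^ m) ≤ m * Real.log 2 := by
  have h : ∀ x : ℝ, 0 ≤ x → Real.negMulLog x ≤ x * (m * Real.log 2) + ((2 ^ m)⁻¹ - x) := by
    intro x hx
    rcases hx.eq_or_lt with rfl | hx
    · simp
    · have := Real.log_le_sub_one_of_pos (by positivity : 0 < (2 ^ m * x)⁻¹)
      rw [Real.log_inv, Real.log_mul (by positivity) hx.ne', Real.log_pow] at this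
      have h2 := mul_le_mul_of_nonneg_left this hx.le
      have h3 : x * ((2 ^ m * x)⁻¹ - 1) = (2 ^ m)⁻¹ - x := by field_simp
      rw [h3] at h2
      rw [Real.negMulLog]
      linarith
  refine (Finset.sum_le_sum fun b _ => h _ (cellProb_nonneg (fun y => (hq y).le) f m _)).trans ?_
  rw [Finset.sum_add_distrib, ← Finset.sum_mul, Finset.sum_sub_distrib, sum_cellProb hq]
  simp

lemma sum_mul_compEnt (hq : ∀ y, 0 < q y) (f : β → ℤ) (m : ℕ) :
    ∑ y, q y * compEnt q f m (f y / 2 ^ m) = ∑ y, q y * (-Real.log (cellProb q f m (f y))) := by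
  have hS : ∀ y, f y / 2 ^ m ∈ Finset.univ.image fun y => f y / 2 ^ m := fun y =>
    Finset.mem_image_of_mem _ (Finset.mem_univ y)
  rw [← sum_fibMass_mul q (fun y => f y / 2 ^ m) (compEnt q f m) hS]
  have h : ∀ K ∈ Finset.univ.image (fun y => f y / 2 ^ m),
      fibMass q (fun y => f y / 2 ^ m) K * compEnt q f m K =
      ∑ y, if f y / 2 ^ m = K then q y * (-Real.log (cellProb q f m (f y))) else 0 := by
    intro K hK
    obtain ⟨y, _, hy⟩ := Finset.mem_image.1 hK
    have hpos : 0 < fibMass q (fun y => f y / 2 ^ m) K := by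
      rw [← hy]; exact fibMass_self_pos hq (fun y => f y / 2 ^ m) y
    rw [← sum_block_fibMass_mul q f (fun k => -Real.log (cellProb q f m k)), compEnt,
      Finset.mul_sum]
    refine Finset.sum_congr rfl fun b hb => ?_
    have : fibMass q f (2 ^ m * K + b) =
        fibMass q (fun y => f y / 2 ^ m) K * cellProb q f m (2 ^ m * K + b) := by
      rw [cellProb, two_pow_mul_add_ediv _ (Finset.mem_range.1 hb), mul_div_cancel₀ _ hpos.ne']
    rw [this, Real.negMulLog]
    ring
  rw [Finset.sum_congr rfl h, Finset.sum_comm]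
  refine Finset.sum_congr rfl fun y _ => ?_
  rw [Finset.sum_ite_eq, if_pos (hS y)]

/-- If the conditional cell probabilities are nearly uniform, then most components have
nearly full entropy. -/
lemma sum_ite_compEnt_lt_le (hq : ∀ y, 0 < q y) (f : β → ℤ) {m : ℕ}
    (hm : 1 ≤ m) {ε ζ : ℝ} (hε : 0 < ε)
    (hζ : ∑ y, q y * blockFluct m (cellProb q f m) (f y) ≤ ζ)
    (hζ2 : 2 ^ m * ζ ≤ ε * (m * Real.log 2) / 2) :
    ∑ y, (if compEnt q f m (f y / 2 ^ m) < (1 - ε) * (m * Real.log 2) then q y else 0) ≤ 1 / 2 := by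
  have hlog : 0 < (m : ℝ) * Real.log 2 :=
    mul_pos (by exact_mod_cast hm) (Real.log_pos (by norm_num))
  have hfl : ∀ y, blockFluct m (cellProb q f m) (f y) = cellProb q f m (f y) - (2 ^ m)⁻¹ := by
    intro y
    rw [blockFluct, sum_cellProb hq, mul_one]
  have h1 : ∀ y, q y * (m * Real.log 2) - q y * (-Real.log (cellProb q f m (f y))) ≤
      2 ^ m * (q y * blockFluct m (cellProb q f m) (f y)) := by
    intro y
    have hpos := cellProb_self_pos hq f m y
    have := Real.log_le_sub_one_of_pos (by positivity : 0 < 2 ^ m * cellProb q f m (f y))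
    rw [Real.log_mul (by positivity) hpos.ne', Real.log_pow] at this
    have h2 := mul_le_mul_of_nonneg_left this (hq y).le
    rw [hfl]
    have h3 : 2 ^ m * (q y * (cellProb q f m (f y) - (2 ^ m)⁻¹)) =
      q y * (2 ^ m * cellProb q f m (f y) - 1) := by field_simp
    rw [h3]
    linarith
  have h2 := Finset.sum_le_sum fun y (_ : y ∈ Finset.univ) => h1 y
  rw [← Finset.mul_sum, Finset.sum_sub_distrib, ← sum_mul_compEnt hq] at h2
  have h3 : ∀ y ∈ Finset.univ, (if compEnt q f m (f y / 2 ^ m) < (1 - ε) * (m * Real.log 2)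
      then q y else 0) * (ε * (m * Real.log 2)) ≤
      q y * (m * Real.log 2) - q y * compEnt q f m (f y / 2 ^ m) := by
    intro y _
    have := compEnt_le hq f m y
    split_ifs with h
    · rw [← mul_sub]
      exact mul_le_mul_of_nonneg_left (by linarith) (hq y).le
    · have := mul_le_mul_of_nonneg_left this (hq y).le
      linarith
  have h4 := Finset.sum_le_sum h3
  rw [← Finset.sum_mul, Finset.sum_sub_distrib] at h4
  have h5 : (2 : ℝ) ^ m * ∑ y, q y * blockFluct m (cellProb q f m) (f y) ≤ 2 ^ m * ζ :=
    mul_le_mul_of_nonneg_left hζ (by positivity)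
  have h6 := h4.trans (h2.trans (h5.trans hζ2))
  have h7 : ε * (m * Real.log 2) / 2 = 1 / 2 * (ε * (m * Real.log 2)) := by ring
  rw [h7] at h6
  exact le_of_mul_le_mul_right h6 (by positivity)

end Components

section Discrete

variable {α β : Type*} [Fintype α] [Fintype β] {p : α → ℝ} {q : β → ℝ}

lemma sum_ite_compEnt_le_of_scale (hp : ∀ x, 0 < p x) (hq : ∀ y, 0 < q y) (sp : ∑ x, p x = 1)
    (sq : ∑ y, q y = 1) (X : α → ℤ) (Y : β → ℤ) {s L N M l R m : ℕ} (hN : s + L ≤ N)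
    (hM : 1 ≤ M) (hR : 1 ≤ R) (hm : 1 ≤ m) {ε κ b : ℝ} (hε : 0 < ε) (hb : 0 < b) (hκ : 0 < κ)
    (hE : scaleErr p q X Y N L s / 2 ^ N ≤ κ)
    (hent : (2 + b * (M + 1)) * Real.log 2 <
      fibEnt p (fun x => X x / 2 ^ s) - fibEnt p (fun x => X x / 2 ^ (s + M)))
    (hζ : (2 * 2 ^ (M + l + m) + 4) / (R : ℝ) + 4 * (2 ^ l)⁻¹ +
      3 * R * (2 * (κ / b) + 2 * (2 ^ M / 2 ^ L)) ≤ ε / (4 * 2 ^ m)) :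
    ∑ y, (if compEnt q (fun y => Y y / 2 ^ (s + (M + l))) m (Y y / 2 ^ (s + (M + l)) / 2 ^ m) <
      (1 - ε) * (m * Real.log 2) then q y else 0) ≤ 1 / 2 := by
  obtain ⟨a, ha, ha', hτ⟩ := exists_shiftTV_le hp hq sp sq X Y hN hM hb hκ hE hent
  have hq' : ∀ y, 0 ≤ q y := fun y => (hq y).le
  have key := sum_blockFluct_le_of_shiftTV (m := m)
    (φ := cellProb q (fun y => Y y / 2 ^ (s + (M + l))) m) hq' sq Y s M l a R hR ha ha' hτ
    (cellProb_nonneg hq' _ _) (cellProb_le_one hq' _ _)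
  refine sum_ite_compEnt_lt_le hq (fun y => Y y / 2 ^ (s + (M + l))) hm hε (key.trans hζ) ?_
  have hlog := Real.log_two_gt_d9
  have hm' : (1 : ℝ) ≤ m := by exact_mod_cast hm
  have h1 : 2 ^ m * (ε / (4 * 2 ^ m)) = ε / 4 := by field_simp
  rw [h1]
  have h2 : 1 / 2 ≤ m * Real.log 2 := by nlinarith
  nlinarith

/-- A positive proportion of the scales carry a positive proportion of the entropy. -/
lemma card_scales_ge (hp : ∀ x, 0 < p x) (sp : ∑ x, p x = 1) (X : α → ℤ) {M n : ℕ} (hM : 1 ≤ M)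
    {ε C : ℝ} (hε : 0 < ε) (hC : 1 ≤ C)
    (hcard : ((Finset.univ.image fun x => X x / 2 ^ n).card : ℝ) ≤ C)
    (hX : ε * n * Real.log 2 < fibEnt p X)
    (hn : M * Real.log 2 + Real.log C ≤ ε * n * Real.log 2 / 4) :
    ε * n / 4 ≤ ((Finset.range n).filter fun s => ε / 2 * (M * Real.log 2) ≤
      fibEnt p (fun x => X x / 2 ^ s) - fibEnt p (fun x => X x / 2 ^ (s + M))).card := by
  set h : ℕ → ℝ := fun s => fibEnt p fun x => X x / 2 ^ s with hh
  have hlog : 0 < Real.log 2 := Real.log_pos (by norm_num)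
  have hM' : (0 : ℝ) < M := by exact_mod_cast hM
  have hstep : ∀ s k, h (s + k) ≤ h s := by
    intro s k
    simp only [hh, ediv_two_pow_add _ s k]
    exact fibEnt_comp_le hp _ (fun z => z / 2 ^ k)
  have hanti : Antitone h := antitone_nat_of_succ_le fun s => hstep s 1
  have hlip : ∀ s k, h s - h (s + k) ≤ k * Real.log 2 := fun s k =>
    fibEnt_ediv_sub_le hp sp X s k
  have htop : h 0 = fibEnt p X := by simp [hh]
  have hbot : h n ≤ Real.log C := fibEnt_le_log_card hp sp _ hC hcard
  have e1 := Finset.sum_range_add h n M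
  have e2 := Finset.sum_range_add h M n
  rw [add_comm M n, e1] at e2
  have e3 : ∑ s ∈ Finset.range n, h (s + M) = ∑ s ∈ Finset.range n, h (M + s) :=
    Finset.sum_congr rfl fun s _ => by rw [add_comm]
  have e4 : M * (h 0 - M * Real.log 2) ≤ ∑ s ∈ Finset.range M, h s := by
    have : ∀ s ∈ Finset.range M, h 0 - M * Real.log 2 ≤ h s := by
      intro s hs
      have h1 := hlip 0 M
      have h2 := hanti (Finset.mem_range.1 hs).le
      rw [zero_add] at h1
      linarith
    have := Finset.sum_le_sum this
    rwa [Finset.sum_const, Finset.card_range, nsmul_eq_mul] at this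
  have e5 : ∑ s ∈ Finset.range M, h (n + s) ≤ M * Real.log C := by
    have : ∀ s ∈ Finset.range M, h (n + s) ≤ Real.log C := fun s _ => (hstep n s).trans hbot
    simpa using Finset.sum_le_sum this
  have e6 : M * (3 / 4 * (ε * n * Real.log 2)) ≤ ∑ s ∈ Finset.range n, (h s - h (s + M)) := by
    rw [Finset.sum_sub_distrib, e3]
    have : M * (3 / 4 * (ε * n * Real.log 2)) ≤ M * (h 0 - M * Real.log 2 - Real.log C) :=
      mul_le_mul_of_nonneg_left (by linarith) hM'.le
    linarith
  have e7 : ∑ s ∈ Finset.range n, (h s - h (s + M)) ≤ ∑ s ∈ Finset.range n,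
      ((if ε / 2 * (M * Real.log 2) ≤ h s - h (s + M) then M * Real.log 2 else 0) +
        ε / 2 * (M * Real.log 2)) := by
    refine Finset.sum_le_sum fun s _ => ?_
    have h1 := hlip s M
    have h2 : 0 ≤ ε / 2 * (M * Real.log 2) := by positivity
    split_ifs with h3 <;> linarith
  rw [Finset.sum_add_distrib, ← Finset.sum_filter, Finset.sum_const, Finset.sum_const,
    Finset.card_range, nsmul_eq_mul, nsmul_eq_mul] at e7
  have e8 := e6.trans e7
  have hpos : 0 < M * Real.log 2 := by positivity
  refine le_of_mul_le_mul_right ?_ hpos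
  linarith

/-- If the sum of two independent integer variables gains little entropy, and the first one has
large entropy, then at many scales most components of the second one have nearly full entropy. -/
theorem exists_full_scales {ε : ℝ} (hε : 0 < ε) (hε1 : ε < 1) {m : ℕ} (hm : 1 ≤ m) :
    ∃ δ : ℝ, 0 < δ ∧ ∃ N : ℕ, ∀ n : ℕ, N ≤ n →
      ∀ (α β : Type) [Fintype α] [Fintype β] (p : α → ℝ) (q : β → ℝ), (∀ x, 0 < p x) →
      (∀ y, 0 < q y) → ∑ x, p x = 1 → ∑ y, q y = 1 → ∀ (X : α → ℤ) (Y : β → ℤ),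
      ((Finset.univ.image fun x => X x / 2 ^ n).card : ℝ) ≤ ε⁻¹ + 2 →
      ε * n * Real.log 2 < fibEnt p X →
      mutInfo p q (fun x y => X x + Y y) ≤ δ * n →
      ∃ T : Finset ℕ, ε * n / 8 ≤ T.card ∧ ∀ t ∈ T, t + m ≤ n ∧
        ∑ y, (if compEnt q (fun y => Y y / 2 ^ t) m (Y y / 2 ^ t / 2 ^ m) <
          (1 - ε) * (m * Real.log 2) then q y else 0) ≤ 1 / 2 := by
  have hlog : 0 < Real.log 2 := Real.log_pos (by norm_num)
  obtain ⟨M, hM⟩ := exists_nat_ge (16 / ε)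
  have hεM : 16 ≤ ε * M := by rwa [div_le_iff₀' hε] at hM
  have hM1 : 1 ≤ M := by
    by_contra h
    have : M = 0 := by omega
    rw [this] at hεM
    norm_num at hεM
  set b : ℝ := ε / 8 with hb
  have hb0 : 0 < b := by positivity
  set ζ : ℝ := ε / (4 * 2 ^ m) with hζ
  have hζ0 : 0 < ζ := by positivity
  obtain ⟨l, hl⟩ := exists_pow_lt_of_lt_one (by positivity : 0 < ζ / 12)
    (by norm_num : (2 : ℝ)⁻¹ < 1)
  obtain ⟨R, hR⟩ := exists_nat_ge ((2 * 2 ^ (M + l + m) + 4) / (ζ / 3))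
  have hR0 : (0 : ℝ) < R := lt_of_lt_of_le (by positivity) hR
  have hR1 : 1 ≤ R := by exact_mod_cast hR0
  set τ : ℝ := ζ / (9 * R) with hτ
  have hτ0 : 0 < τ := by positivity
  set κ : ℝ := τ * b / 4 with hκ
  have hκ0 : 0 < κ := by positivity
  obtain ⟨L, hL⟩ := exists_pow_lt_of_lt_one (by positivity : 0 < τ / (4 * 2 ^ M))
    (by norm_num : (2 : ℝ)⁻¹ < 1)
  have hζ' : (2 * 2 ^ (M + l + m) + 4) / (R : ℝ) + 4 * (2 ^ l)⁻¹ +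
      3 * R * (2 * (κ / b) + 2 * (2 ^ M / 2 ^ L)) ≤ ε / (4 * 2 ^ m) := by
    rw [← hζ]
    have h1 : (2 * 2 ^ (M + l + m) + 4) / (R : ℝ) ≤ ζ / 3 := by
      rw [div_le_iff₀ hR0]
      rw [div_le_iff₀ (by positivity)] at hR
      linarith
    have h2 : 4 * ((2 : ℝ) ^ l)⁻¹ ≤ ζ / 3 := by
      rw [inv_pow] at hl; linarith
    have h3 : (2 : ℝ) ^ M / 2 ^ L ≤ τ / 4 := by
      rw [inv_pow, lt_div_iff₀ (by positivity)] at hL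
      rw [div_eq_mul_inv]
      linarith
    have h4 : κ / b = τ / 4 := by rw [hκ]; field_simp
    have h5 : 3 * R * (2 * (κ / b) + 2 * (2 ^ M / 2 ^ L)) ≤ 3 * R * τ :=
      mul_le_mul_of_nonneg_left (by rw [h4]; linarith) (by positivity)
    have h6 : 3 * R * τ = ζ / 3 := by rw [hτ]; field_simp; norm_num
    linarith
  obtain ⟨N₁, hN₁⟩ := exists_nat_ge
    ((M * Real.log 2 + Real.log (ε⁻¹ + 2)) / (ε * Real.log 2 / 4))
  obtain ⟨N₂, hN₂⟩ := exists_nat_ge (((M + l + m : ℕ) : ℝ) / (ε / 16))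
  refine ⟨ε * κ ^ 2 / (64 * (L + 1)), by positivity, max N₁ N₂, ?_⟩
  intro n hn α β _ _ p q hp hq sp sq X Y hcard hX hI
  have hn1 : (N₁ : ℝ) ≤ n := by exact_mod_cast (le_max_left _ _).trans hn
  have hn2 : (N₂ : ℝ) ≤ n := by exact_mod_cast (le_max_right _ _).trans hn
  have hN1 := hN₁.trans hn1
  have hN2 := hN₂.trans hn2
  rw [div_le_iff₀ (by positivity)] at hN1 hN2
  classical
  set A := (Finset.range n).filter fun s => ε / 2 * (M * Real.log 2) ≤
      fibEnt p (fun x => X x / 2 ^ s) - fibEnt p (fun x => X x / 2 ^ (s + M)) with hA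
  set B := (Finset.range n).filter fun s => κ < scaleErr p q X Y (n + L) L s / 2 ^ (n + L) with hB
  set D := (Finset.range n).filter fun s => n < s + (M + l + m) with hD
  have cA : ε * n / 4 ≤ A.card :=
    card_scales_ge hp sp X hM1 hε (by linarith [inv_pos.2 hε]) hcard hX (by linarith)
  have cB : (B.card : ℝ) ≤ ε * n / 16 := by
    have h1 := sum_sq_scaleErr_le hp hq sp sq X Y (n + L) L n
    have h2 : (B.card : ℝ) * κ ^ 2 ≤
        ∑ s ∈ Finset.range n, (scaleErr p q X Y (n + L) L s / 2 ^ (n + L)) ^ 2 := by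
      rw [← nsmul_eq_mul, ← Finset.sum_const]
      refine (Finset.sum_le_sum fun s hs => ?_).trans (Finset.sum_le_sum_of_subset_of_nonneg
        (Finset.filter_subset _ _) fun s _ _ => sq_nonneg _)
      have := (Finset.mem_filter.1 hs).2
      exact pow_le_pow_left₀ hκ0.le this.le 2
    have h3 : 4 * L * mutInfo p q (fun x y => X x + Y y) ≤
        4 * (L + 1) * (ε * κ ^ 2 / (64 * (L + 1)) * n) := by
      refine (mul_le_mul_of_nonneg_left hI (by positivity)).trans
        (mul_le_mul_of_nonneg_right (by linarith) (by positivity))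
    have h4 : 4 * ((L : ℝ) + 1) * (ε * κ ^ 2 / (64 * (L + 1)) * n) = ε * n / 16 * κ ^ 2 := by
      field_simp
      ring
    rw [h4] at h3
    exact le_of_mul_le_mul_right (h2.trans (h1.trans h3)) (by positivity)
  have cD : (D.card : ℝ) ≤ ε * n / 16 := by
    have : D ⊆ Finset.Ico (n - (M + l + m)) n := by
      intro s hs
      have h1 := Finset.mem_filter.1 hs
      have h2 := Finset.mem_range.1 h1.1
      rw [Finset.mem_Ico]
      omega
    have h3 := Finset.card_le_card this
    rw [Nat.card_Ico] at h3
    have h4 : D.card ≤ M + l + m := by omega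
    have h5 : (D.card : ℝ) ≤ (M + l + m : ℕ) := by exact_mod_cast h4
    linarith
  have cG : ε * n / 8 ≤ ((A \ B) \ D).card := by
    have h1 := Finset.le_card_sdiff B A
    have h2 := Finset.le_card_sdiff D (A \ B)
    have h3 : A.card ≤ ((A \ B) \ D).card + B.card + D.card := by omega
    have h4 : (A.card : ℝ) ≤ ((A \ B) \ D).card + B.card + D.card := by exact_mod_cast h3
    linarith
  refine ⟨((A \ B) \ D).image (· + (M + l)), ?_, ?_⟩
  · rwa [Finset.card_image_of_injective _ (add_left_injective _)]
  · intro t ht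
    obtain ⟨s, hs, rfl⟩ := Finset.mem_image.1 ht
    simp only [Finset.mem_sdiff, hA, hB, hD, Finset.mem_filter, Finset.mem_range, not_and,
      not_lt] at hs
    obtain ⟨⟨⟨hs1, hs2⟩, hs3⟩, hs4⟩ := hs
    refine ⟨by have := hs4 hs1; omega, ?_⟩
    refine sum_ite_compEnt_le_of_scale hp hq sp sq X Y (N := n + L) (by omega) hM1 hR1 hm hε hb0
      hκ0 (hs3 hs1) (lt_of_lt_of_le ?_ hs2) hζ'
    rw [← mul_assoc]
    refine mul_lt_mul_of_pos_right ?_ hlog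
    rw [hb]
    nlinarith

end Discrete

section Atoms

variable {T : Type*} [MeasurableSpace T]

/-- A finite measure carried by a finite set is carried by its atoms. -/
lemma exists_finset_atoms (ν : Measure T) [IsFiniteMeasure ν] (F : Finset T)
    (hF : ν ((F : Set T)ᶜ) = 0) :
    ∃ G : Finset T, (∀ c ∈ G, 0 < ν.real {c}) ∧ ν ((G : Set T)ᶜ) = 0 := by
  classical
  refine ⟨F.filter fun c => ν {c} ≠ 0, fun c hc => ?_, ?_⟩
  · exact ENNReal.toReal_pos (Finset.mem_filter.1 hc).2 (measure_ne_top _ _)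
  · have hsub : (((F.filter fun c => ν {c} ≠ 0 : Finset T) : Set T)ᶜ) ⊆
        (F : Set T)ᶜ ∪ ⋃ c ∈ F.filter (fun c => ν {c} = 0), {c} := by
      intro c hc
      by_cases h : c ∈ F
      · right
        simp only [Finset.coe_filter, mem_compl_iff, Set.mem_ofPred_eq, not_and, not_not] at hc
        simp only [Set.mem_iUnion]
        exact ⟨c, Finset.mem_filter.2 ⟨h, hc h⟩, rfl⟩
      · exact Or.inl (by simpa using h)
    refine measure_mono_null hsub (measure_union_null hF ?_)
    refine (measure_biUnion_null_iff (Finset.countable_toSet _)).2 fun c hc => ?_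
    exact (Finset.mem_filter.1 hc).2

variable [MeasurableSingletonClass T]

open scoped Classical in
lemma measureReal_eq_sum_atoms (ν : Measure T) [IsFiniteMeasure ν] {G : Finset T}
    (hG : ν ((G : Set T)ᶜ) = 0) (B : Set T) :
    ν.real B = ∑ c ∈ G, if c ∈ B then ν.real {c} else 0 := by
  have h1 : ν.real B = ν.real ((G.filter fun c => c ∈ B : Finset T) : Set T) := by
    refine measureReal_congr (Filter.eventuallyEq_set.2 ?_)
    have : ∀ᵐ c ∂ν, c ∈ (G : Set T) := hG
    filter_upwards [this] with c hc
    simp only [Finset.coe_filter, Set.mem_ofPred_eq]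
    exact ⟨fun h => ⟨hc, h⟩, fun h => h.2⟩
  rw [h1, ← sum_measureReal_singleton, Finset.sum_filter]

lemma fibMass_atoms (ν : Measure T) [IsFiniteMeasure ν] {G : Finset T}
    (hG : ν ((G : Set T)ᶜ) = 0) (f : T → ℤ) (k : ℤ) :
    fibMass (fun c : G => ν.real {c.1}) (fun c => f c.1) k = ν.real {c | f c = k} := by
  classical
  rw [measureReal_eq_sum_atoms ν hG, fibMass,
    Finset.sum_coe_sort G fun c => if f c = k then ν.real {c} else 0]
  exact Finset.sum_congr rfl fun c _ => by simp

lemma sum_atoms (ν : Measure T) [IsProbabilityMeasure ν] {G : Finset T}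
    (hG : ν ((G : Set T)ᶜ) = 0) : ∑ c : G, ν.real {c.1} = 1 := by
  classical
  have := measureReal_eq_sum_atoms ν hG Set.univ
  rw [Finset.sum_coe_sort G fun c => ν.real {c}]
  simpa using this.symm

lemma fibMass_prod_atoms (ν₁ ν₂ : Measure ℤ) [IsProbabilityMeasure ν₁] [IsProbabilityMeasure ν₂]
    {G₁ G₂ : Finset ℤ} (h₁ : ν₁ ((G₁ : Set ℤ)ᶜ) = 0) (h₂ : ν₂ ((G₂ : Set ℤ)ᶜ) = 0) (k : ℤ) :
    fibMass (fun z : G₁ × G₂ => ν₁.real {z.1.1} * ν₂.real {z.2.1}) (fun z => z.1.1 + z.2.1) k =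
      (ν₁.prod ν₂).real {c | c.1 + c.2 = k} := by
  classical
  have hG : (ν₁.prod ν₂) (((G₁ ×ˢ G₂ : Finset (ℤ × ℤ)) : Set (ℤ × ℤ))ᶜ) = 0 := by
    have : ((G₁ ×ˢ G₂ : Finset (ℤ × ℤ)) : Set (ℤ × ℤ))ᶜ ⊆
        ((G₁ : Set ℤ)ᶜ ×ˢ Set.univ) ∪ (Set.univ ×ˢ (G₂ : Set ℤ)ᶜ) := by
      rintro ⟨a, b⟩ h
      simp only [Finset.coe_product, mem_compl_iff, Set.mem_prod, not_and_or] at h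
      simpa using h
    refine measure_mono_null this (measure_union_null ?_ ?_)
    · rw [Measure.prod_prod, h₁, zero_mul]
    · rw [Measure.prod_prod, h₂, mul_zero]
  rw [measureReal_eq_sum_atoms _ hG, Finset.sum_product, fibMass, Fintype.sum_prod_type,
    Finset.sum_coe_sort G₁ fun a => ∑ b : G₂,
      if a + b.1 = k then ν₁.real {a} * ν₂.real {b.1} else 0]
  refine Finset.sum_congr rfl fun a _ => ?_
  rw [Finset.sum_coe_sort G₂ fun b => if a + b = k then ν₁.real {a} * ν₂.real {b} else 0]
  refine Finset.sum_congr rfl fun b _ => ?_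
  have : (ν₁.prod ν₂).real {(a, b)} = ν₁.real {a} * ν₂.real {b} := by
    rw [← Set.singleton_prod_singleton, measureReal_def, Measure.prod_prod, ENNReal.toReal_mul]
    rfl
  rw [this]
  by_cases h : a + b = k <;> simp [h]

end Atoms

section EntropyBounds

variable {α β : Type*} [Fintype α] [Fintype β]

lemma fibEnt_eq_sum (q : β → ℝ) (f : β → ℤ) {S : Finset ℤ} (hS : ∀ y, f y ∈ S) :
    fibEnt q f = -∑ k ∈ S, fibMass q f k * Real.log (fibMass q f k) := by
  rw [sum_fibMass_mul q f (fun k => Real.log (fibMass q f k)) hS, fibEnt]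

lemma fibEnt_congr {p : α → ℝ} {q : β → ℝ} {f : α → ℤ} {g : β → ℤ}
    (h : ∀ k, fibMass p f k = fibMass q g k) : fibEnt p f = fibEnt q g := by
  have h1 : ∀ x, f x ∈ Finset.univ.image f ∪ Finset.univ.image g := fun x =>
    Finset.mem_union_left _ (Finset.mem_image_of_mem _ (Finset.mem_univ x))
  have h2 : ∀ x, g x ∈ Finset.univ.image f ∪ Finset.univ.image g := fun x =>
    Finset.mem_union_right _ (Finset.mem_image_of_mem _ (Finset.mem_univ x))
  rw [fibEnt_eq_sum p f h1, fibEnt_eq_sum q g h2]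
  simp only [h]

/-- Rounding up by at most one changes the entropy by at most one bit. -/
lemma fibEnt_le_add_log_two {r : α → ℝ} (hr : ∀ x, 0 < r x) (sr : ∑ x, r x = 1) (U V : α → ℤ)
    (hUV : ∀ x, V x = U x ∨ V x = U x + 1) : fibEnt r U ≤ fibEnt r V + Real.log 2 := by
  have hr' : ∀ x, 0 ≤ r x := fun x => (hr x).le
  have key : ∀ x, r x * (-Real.log (fibMass r U (U x))) ≤ r x * (-Real.log (fibMass r V (V x))) +
      (r x * ((fibMass r V (U x) + fibMass r V (U x + 1)) / fibMass r U (U x)) / 2 - r x) +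
      r x * Real.log 2 := by
    intro x
    have ha := fibMass_self_pos hr U x
    have hb := fibMass_self_pos hr V x
    have h1 := Real.log_le_sub_one_of_pos
      (by positivity : 0 < fibMass r V (V x) / fibMass r U (U x) / 2)
    rw [Real.log_div (by positivity) (by norm_num), Real.log_div hb.ne' ha.ne'] at h1
    have h2 : fibMass r V (V x) ≤ fibMass r V (U x) + fibMass r V (U x + 1) := by
      have e1 := fibMass_nonneg hr' V (U x)
      have e2 := fibMass_nonneg hr' V (U x + 1)
      rcases hUV x with h | h <;> rw [h] <;> linarith
    have h3 := div_le_div_of_nonneg_right h2 ha.le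
    have h4 : -Real.log (fibMass r U (U x)) ≤ -Real.log (fibMass r V (V x)) +
        ((fibMass r V (U x) + fibMass r V (U x + 1)) / fibMass r U (U x) / 2 - 1) +
        Real.log 2 := by linarith
    have := mul_le_mul_of_nonneg_left h4 (hr' x)
    linarith
  have hS : ∀ x, U x ∈ Finset.univ.image U := fun x =>
    Finset.mem_image_of_mem _ (Finset.mem_univ x)
  have h5 : ∑ x, r x * ((fibMass r V (U x) + fibMass r V (U x + 1)) / fibMass r U (U x)) ≤ 2 := by
    rw [← sum_fibMass_mul r U (fun k => (fibMass r V k + fibMass r V (k + 1)) / fibMass r U k) hS]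
    have h6 : ∀ k ∈ Finset.univ.image U, fibMass r U k *
        ((fibMass r V k + fibMass r V (k + 1)) / fibMass r U k) =
        fibMass r V k + fibMass r V (k + 1) := by
      intro k hk
      obtain ⟨x, _, rfl⟩ := Finset.mem_image.1 hk
      rw [mul_div_cancel₀ _ (fibMass_self_pos hr U x).ne']
    have h7 : ∀ W : Finset ℤ, ∑ k ∈ W, fibMass r V k ≤ 1 := by
      intro W
      rw [← sr, ← sum_fibMass r V (S := W ∪ Finset.univ.image V) fun x =>
        Finset.mem_union_right _ (Finset.mem_image_of_mem _ (Finset.mem_univ x))]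
      exact Finset.sum_le_sum_of_subset_of_nonneg Finset.subset_union_left
        fun k _ _ => fibMass_nonneg hr' _ _
    rw [Finset.sum_congr rfl h6, Finset.sum_add_distrib]
    have h8 := h7 ((Finset.univ.image U).image (· + 1))
    rw [Finset.sum_image fun a _ b _ h => add_right_cancel h] at h8
    linarith [h7 (Finset.univ.image U)]
  have h9 := Finset.sum_le_sum fun x (_ : x ∈ Finset.univ) => key x
  rw [Finset.sum_add_distrib, Finset.sum_add_distrib, Finset.sum_sub_distrib, ← Finset.sum_div,
    ← Finset.sum_mul, sr] at h9
  simp only [fibEnt, ← Finset.sum_neg_distrib, ← mul_neg]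
  linarith

end EntropyBounds

section DyadicCells

/-- The index of the level-`k` dyadic cell containing `x`. -/
def cellIndex (k : ℕ) (x : ℝ) : ℤ := ⌊x * 2 ^ k⌋

@[fun_prop]
lemma measurable_cellIndex (k : ℕ) : Measurable (cellIndex k) :=
  Int.measurable_floor.comp (measurable_id.mul_const _)

/-- The law of the index of the level-`k` dyadic cell. -/
def cellLaw (k : ℕ) (θ : Measure ℝ) : Measure ℤ := θ.map (cellIndex k)

instance (k : ℕ) (θ : Measure ℝ) [IsProbabilityMeasure θ] : IsProbabilityMeasure (cellLaw k θ) :=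
  Measure.isProbabilityMeasure_map (measurable_cellIndex k).aemeasurable

lemma cellIndex_add (j t : ℕ) (x : ℝ) : cellIndex (j + t) x / 2 ^ t = cellIndex j x := by
  have := Int.floor_div_natCast (x * 2 ^ (j + t)) (2 ^ t)
  push_cast at this
  rw [cellIndex, cellIndex, ← this, pow_add, ← mul_assoc,
    mul_div_cancel_right₀ _ (by positivity)]

lemma dyadIco_eq (j : ℕ) (c : ℤ) : dyadIco j c = {x | cellIndex j x = c} := by
  ext x
  simp only [dyadIco, mem_Ico, cellIndex, Set.mem_ofPred_eq]
  rw [Int.floor_eq_iff, div_le_iff₀ (by positivity), lt_div_iff₀ (by positivity)]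

lemma cellLaw_real_apply (k : ℕ) (θ : Measure ℝ) (B : Set ℤ) :
    (cellLaw k θ).real B = (θ {x | cellIndex k x ∈ B}).toReal := by
  rw [cellLaw, map_measureReal_apply (measurable_cellIndex k) (MeasurableSet.of_discrete)]
  rfl

lemma exists_atoms_of_isCompact (k : ℕ) (θ : Measure ℝ) [IsProbabilityMeasure θ] {S : Set ℝ}
    (hS : IsCompact S) (h : θ Sᶜ = 0) :
    ∃ G : Finset ℤ, (∀ c ∈ G, 0 < (cellLaw k θ).real {c}) ∧ cellLaw k θ ((G : Set ℤ)ᶜ) = 0 := by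
  obtain ⟨a, ha⟩ := hS.bddBelow
  obtain ⟨b, hb⟩ := hS.bddAbove
  refine exists_finset_atoms (cellLaw k θ) (Finset.Icc (cellIndex k a) (cellIndex k b)) ?_
  rw [cellLaw, Measure.map_apply (measurable_cellIndex k) (MeasurableSet.of_discrete)]
  have hsub : cellIndex k ⁻¹' ((Finset.Icc (cellIndex k a) (cellIndex k b) : Finset ℤ) : Set ℤ)ᶜ ⊆
      Sᶜ := by
    intro x hx hxS
    apply hx
    simp only [Finset.coe_Icc, Set.mem_Icc]
    have h1 := ha hxS
    have h2 := hb hxS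
    exact ⟨Int.floor_le_floor (by gcongr), Int.floor_le_floor (by gcongr)⟩
  exact measure_mono_null hsub h

lemma toReal_dyadIco (j t : ℕ) (θ : Measure ℝ) [IsProbabilityMeasure θ] {G : Finset ℤ}
    (hG : cellLaw (j + t) θ ((G : Set ℤ)ᶜ) = 0) (c : ℤ) :
    (θ (dyadIco j c)).toReal =
      fibMass (fun z : G => (cellLaw (j + t) θ).real {z.1}) (fun z => z.1 / 2 ^ t) c := by
  rw [fibMass_atoms _ hG (fun z => z / 2 ^ t), cellLaw_real_apply, dyadIco_eq]
  simp only [Set.mem_ofPred_eq, cellIndex_add]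

variable {β : Type*} [Fintype β]

lemma ent1_eq_fibEnt {j : ℕ} {θ : Measure ℝ} {q : β → ℝ} {f : β → ℤ}
    (h : ∀ c, (θ (dyadIco j c)).toReal = fibMass q f c) : ent1 j θ = fibEnt q f / Real.log 2 := by
  have hS : ∀ y, f y ∈ Finset.univ.image f := fun y =>
    Finset.mem_image_of_mem _ (Finset.mem_univ y)
  rw [fibEnt_eq_sum q f hS, ent1, tsum_eq_sum (s := Finset.univ.image f), neg_div,
    Finset.sum_div]
  · refine congrArg _ (Finset.sum_congr rfl fun c _ => ?_)
    rw [h, Real.logb, mul_div_assoc]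
  · intro c hc
    rw [h, fibMass_eq_zero (S := Finset.univ.image f) hS hc, zero_mul]

lemma ent1_dcomp (j m t : ℕ) (θ : Measure ℝ) [IsProbabilityMeasure θ] {G : Finset ℤ}
    (hG : cellLaw (j + m + t) θ ((G : Set ℤ)ᶜ) = 0) (x : ℝ) :
    ent1 (j + m) (dcomp θ x j) =
      compEnt (fun z : G => (cellLaw (j + m + t) θ).real {z.1}) (fun z => z.1 / 2 ^ t) m
        (cellIndex (j + m + t) x / 2 ^ t / 2 ^ m) / Real.log 2 := by
  set q : G → ℝ := fun z : G => (cellLaw (j + m + t) θ).real {z.1} with hq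
  set K : ℤ := cellIndex j x with hK
  have hKx : cellIndex (j + m + t) x / 2 ^ t / 2 ^ m = K := by
    rw [cellIndex_add, cellIndex_add]
  have hcell : dcell j x = dyadIco j K := rfl
  have hden : (θ (dyadIco j K)).toReal =
      fibMass q (fun z => z.1 / 2 ^ t / 2 ^ m) K := by
    have hG' : cellLaw (j + (t + m)) θ ((G : Set ℤ)ᶜ) = 0 := by
      rwa [← add_assoc, add_right_comm]
    have := toReal_dyadIco j (t + m) θ hG' K
    rw [this, hq]
    simp only [← ediv_two_pow_add]
    rw [show j + m + t = j + (t + m) by ring]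
  have hmeas : ∀ (i : ℕ) c, MeasurableSet (dyadIco i c) := fun i c => measurableSet_Ico
  have hval : ∀ c, (dcomp θ x j (dyadIco (j + m) c)).toReal =
      if c / 2 ^ m = K then cellProb q (fun z => z.1 / 2 ^ t) m c else 0 := by
    intro c
    rw [dcomp, hcell, Measure.smul_apply, smul_eq_mul, ENNReal.toReal_mul, ENNReal.toReal_inv,
      Measure.restrict_apply (hmeas _ _)]
    split_ifs with h
    · have hsub : dyadIco (j + m) c ∩ dyadIco j K = dyadIco (j + m) c := by
        refine inter_eq_left.2 fun y hy => ?_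
        rw [dyadIco_eq, Set.mem_ofPred_eq] at hy ⊢
        rw [← cellIndex_add j m, hy, h]
      rw [hsub, toReal_dyadIco (j + m) t θ hG, hden, cellProb, h, div_eq_inv_mul]
    · have hsub : dyadIco (j + m) c ∩ dyadIco j K = ∅ := by
        rw [Set.eq_empty_iff_forall_notMem]
        rintro y ⟨hy1, hy2⟩
        rw [dyadIco_eq, Set.mem_ofPred_eq] at hy1 hy2
        rw [← cellIndex_add j m, hy1] at hy2
        exact h hy2
      rw [hsub]
      simp
  rw [hKx, ent1, tsum_eq_sum (s := (Finset.range (2 ^ m)).image fun b : ℕ => 2 ^ m * K + (b : ℤ)),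
    Finset.sum_image (fun a _ b _ h => by simpa using h), compEnt, Finset.sum_div,
    ← Finset.sum_neg_distrib]
  · refine Finset.sum_congr rfl fun b hb => ?_
    rw [hval, if_pos (two_pow_mul_add_ediv K (Finset.mem_range.1 hb)), Real.negMulLog, Real.logb]
    ring
  · intro c hc
    rw [hval, if_neg, zero_mul]
    intro h
    apply hc
    have hP : (0 : ℤ) < 2 ^ m := by positivity
    obtain ⟨r, hr⟩ := Int.eq_ofNat_of_zero_le (Int.emod_nonneg c hP.ne')
    have h1 := Int.mul_ediv_add_emod c (2 ^ m)
    have h2 := Int.emod_lt_of_pos c hP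
    rw [hr] at h1 h2
    refine Finset.mem_image.2 ⟨r, Finset.mem_range.2 (by exact_mod_cast h2), ?_⟩
    rw [← h, h1]

/-- The probability that a component has small entropy, in terms of the atoms. -/
lemma toReal_setOf_ent1_dcomp_lt (j t : ℕ) {m : ℕ} (hm : 1 ≤ m) (θ : Measure ℝ)
    [IsProbabilityMeasure θ] {G : Finset ℤ} (hG : cellLaw (j + m + t) θ ((G : Set ℤ)ᶜ) = 0)
    (c : ℝ) :
    (θ {x | (1 / (m : ℝ)) * ent1 (j + m) (dcomp θ x j) < c}).toReal =
      ∑ y : G, if compEnt (fun z : G => (cellLaw (j + m + t) θ).real {z.1}) (fun z => z.1 / 2 ^ t)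
        m (y.1 / 2 ^ t / 2 ^ m) < c * (m * Real.log 2) then (cellLaw (j + m + t) θ).real {y.1}
        else 0 := by
  classical
  have hm' : (0 : ℝ) < m := by exact_mod_cast hm
  have hlog : 0 < Real.log 2 := Real.log_pos (by norm_num)
  set g := compEnt (fun z : G => (cellLaw (j + m + t) θ).real {z.1}) (fun z => z.1 / 2 ^ t) m
    with hg
  have hset : {x | (1 / (m : ℝ)) * ent1 (j + m) (dcomp θ x j) < c} =
      {x | cellIndex (j + m + t) x ∈ {z : ℤ | g (z / 2 ^ t / 2 ^ m) < c * (m * Real.log 2)}} := by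
    ext x
    simp only [Set.mem_ofPred_eq]
    rw [ent1_dcomp j m t θ hG, ← hg, one_div_mul_eq_div, div_div, div_lt_iff₀ (by positivity),
      mul_comm (Real.log 2)]
  rw [hset, ← cellLaw_real_apply, measureReal_eq_sum_atoms _ hG,
    Finset.sum_coe_sort G fun z => if g (z / 2 ^ t / 2 ^ m) < c * (m * Real.log 2) then
      (cellLaw (j + m + t) θ).real {z} else 0]
  exact Finset.sum_congr rfl fun z _ => by simp only [Set.mem_ofPred_eq]

/-- Passing from the sum of the discretizations to the convolution costs at most one bit. -/
lemma fibEnt_sum_atoms_le (k : ℕ) (ξ θ : Measure ℝ) [IsProbabilityMeasure ξ]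
    [IsProbabilityMeasure θ] {G₁ G₂ : Finset ℤ} (h₁ : cellLaw k ξ ((G₁ : Set ℤ)ᶜ) = 0)
    (h₂ : cellLaw k θ ((G₂ : Set ℤ)ᶜ) = 0) :
    fibEnt (fun z : G₁ × G₂ => (cellLaw k ξ).real {z.1.1} * (cellLaw k θ).real {z.2.1})
      (fun z => z.1.1 + z.2.1) ≤ ent1 k (mconv ξ θ) * Real.log 2 + Real.log 2 := by
  classical
  set D : ℝ × ℝ → ℤ × ℤ := fun z => (cellIndex k z.1 + cellIndex k z.2, cellIndex k (z.1 + z.2))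
    with hD
  have hDm : Measurable D := by
    refine Measurable.prodMk ?_ ((measurable_cellIndex k).comp (by fun_prop))
    exact ((measurable_cellIndex k).comp measurable_fst).add
      ((measurable_cellIndex k).comp measurable_snd)
  set ν := (ξ.prod θ).map D with hν
  have : IsProbabilityMeasure ν := Measure.isProbabilityMeasure_map hDm.aemeasurable
  have hround : ∀ z : ℝ × ℝ, (D z).2 = (D z).1 ∨ (D z).2 = (D z).1 + 1 := by
    intro z
    simp only [hD, cellIndex, add_mul]
    have h1 := Int.le_floor_add (z.1 * 2 ^ k) (z.2 * 2 ^ k)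
    have h2 := Int.le_floor_add_floor (z.1 * 2 ^ k) (z.2 * 2 ^ k)
    omega
  have hfst : ∀ u, ν.real {c | c.1 = u} =
      ((cellLaw k ξ).prod (cellLaw k θ)).real {c | c.1 + c.2 = u} := by
    intro u
    rw [cellLaw, cellLaw, Measure.map_prod_map _ _ (measurable_cellIndex k)
      (measurable_cellIndex k), hν, map_measureReal_apply hDm (MeasurableSet.of_discrete),
      map_measureReal_apply ((measurable_cellIndex k).prodMap (measurable_cellIndex k))
      (MeasurableSet.of_discrete)]
    rfl
  set F : Finset (ℤ × ℤ) := (G₁ ×ˢ G₂).image (fun c => (c.1 + c.2, c.1 + c.2)) ∪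
    (G₁ ×ˢ G₂).image (fun c => (c.1 + c.2, c.1 + c.2 + 1)) with hF
  have hFnull : ν ((F : Set (ℤ × ℤ))ᶜ) = 0 := by
    have e1 : ∀ᵐ x ∂ξ, cellIndex k x ∈ (G₁ : Set ℤ) :=
      ae_of_ae_map (measurable_cellIndex k).aemeasurable h₁
    have e2 : ∀ᵐ y ∂θ, cellIndex k y ∈ (G₂ : Set ℤ) :=
      ae_of_ae_map (measurable_cellIndex k).aemeasurable h₂
    have e3 := Measure.quasiMeasurePreserving_fst (μ := ξ) (ν := θ) |>.ae e1
    have e4 := Measure.quasiMeasurePreserving_snd (μ := ξ) (ν := θ) |>.ae e2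
    have e5 : ∀ᵐ z ∂(ξ.prod θ), D z ∈ (F : Set (ℤ × ℤ)) := by
      filter_upwards [e3, e4] with z hz1 hz2
      have hmem : (cellIndex k z.1, cellIndex k z.2) ∈ G₁ ×ˢ G₂ := Finset.mem_product.2 ⟨hz1, hz2⟩
      have hr := hround z
      simp only [hF, Finset.coe_union, Set.mem_union, Finset.mem_coe, Finset.mem_image]
      rcases hr with h | h
      · exact Or.inl ⟨_, hmem, Prod.ext rfl h.symm⟩
      · exact Or.inr ⟨_, hmem, Prod.ext rfl h.symm⟩
    rw [hν, Measure.map_apply hDm (MeasurableSet.of_discrete)]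
    exact e5
  obtain ⟨G, hG0, hG⟩ := exists_finset_atoms ν F hFnull
  set r : G → ℝ := fun c => ν.real {c.1} with hr
  have hr0 : ∀ c, 0 < r c := fun c => hG0 c.1 c.2
  have hUV : ∀ c : G, c.1.2 = c.1.1 ∨ c.1.2 = c.1.1 + 1 := by
    intro c
    have h1 := hG0 c.1 c.2
    rw [hν, map_measureReal_apply hDm (MeasurableSet.of_discrete)] at h1
    have h2 : (D ⁻¹' {c.1}).Nonempty := by
      rw [Set.nonempty_iff_ne_empty]
      intro h
      rw [h] at h1
      simp at h1
    obtain ⟨z, hz⟩ := h2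
    have h3 : D z = c.1 := hz
    rw [← h3]
    exact hround z
  have key := fibEnt_le_add_log_two hr0 (sum_atoms ν hG) (fun c => c.1.1) (fun c => c.1.2) hUV
  have hU : fibEnt (fun z : G₁ × G₂ => (cellLaw k ξ).real {z.1.1} * (cellLaw k θ).real {z.2.1})
      (fun z => z.1.1 + z.2.1) = fibEnt r (fun c => c.1.1) := by
    refine fibEnt_congr fun u => ?_
    rw [fibMass_prod_atoms _ _ h₁ h₂, ← hfst, hr, fibMass_atoms ν hG (fun c => c.1)]
  have hV : ent1 k (mconv ξ θ) = fibEnt r (fun c => c.1.2) / Real.log 2 := by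
    refine ent1_eq_fibEnt fun v => ?_
    have hadd : Measurable fun q : ℝ × ℝ => q.1 + q.2 := measurable_fst.add measurable_snd
    rw [hr, fibMass_atoms ν hG (fun c => c.2), hν,
      map_measureReal_apply hDm (MeasurableSet.of_discrete), mconv,
      Measure.map_apply hadd
        (show MeasurableSet (dyadIco k v) from measurableSet_Ico), dyadIco_eq]
    rfl
  rw [hU, hV, div_mul_cancel₀ _ (Real.log_pos (by norm_num)).ne']
  exact key

lemma card_le_of_sub_le {G : Finset ℤ} {W : ℝ} (hW : 0 ≤ W)
    (h : ∀ a ∈ G, ∀ b ∈ G, ((a - b : ℤ) : ℝ) ≤ W) : (G.card : ℝ) ≤ W + 1 := by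
  rcases G.eq_empty_or_nonempty with rfl | hne
  · simp; linarith
  · have h1 : G ⊆ Finset.Icc (G.min' hne) (G.max' hne) := fun a ha =>
      Finset.mem_Icc.2 ⟨G.min'_le a ha, G.le_max' a ha⟩
    have h2 := Finset.card_le_card h1
    rw [Int.card_Icc] at h2
    have h3 := h _ (G.max'_mem hne) _ (G.min'_mem hne)
    have h4 : G.min' hne ≤ G.max' hne := G.min'_le _ (G.max'_mem hne)
    have h5 : (G.card : ℤ) ≤ G.max' hne - G.min' hne + 1 := by omega
    have h6 : (G.card : ℝ) ≤ ((G.max' hne - G.min' hne : ℤ) : ℝ) + 1 := by exact_mod_cast h5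
    linarith

lemma msupp_eq_support (ξ : Measure ℝ) : msupp ξ = ξ.support := by
  rw [Measure.support_eq_forall_isOpen]
  ext x
  simp only [msupp, Set.mem_ofPred_eq, pos_iff_ne_zero]
  exact ⟨fun h U hx hU => h U hU hx, fun h U hU hx => h U hx hU⟩

/-- A measure whose support has small diameter charges few dyadic cells. -/
lemma card_image_atoms_le (i n : ℕ) (ξ : Measure ℝ) {S : Set ℝ} (hS : IsCompact S)
    (h : ξ Sᶜ = 0) {G : Finset ℤ} (hG : ∀ c ∈ G, 0 < (cellLaw (i + n) ξ).real {c}) {C : ℝ}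
    (hC : 0 ≤ C) (hdiam : Metric.diam (msupp ξ) ≤ C * (2 : ℝ) ^ (-(i : ℤ))) :
    ((Finset.univ.image fun x : G => x.1 / 2 ^ n).card : ℝ) ≤ C + 2 := by
  have hbdd : Bornology.IsBounded ξ.support :=
    hS.isBounded.subset (Measure.support_subset_of_isClosed hS.isClosed h)
  have hrep : ∀ c ∈ G, ∃ x ∈ ξ.support, cellIndex i x = c / 2 ^ n := by
    intro c hc
    have h1 := hG c hc
    rw [cellLaw_real_apply] at h1
    obtain ⟨x, hx1, hx2⟩ := Measure.nonempty_inter_support_of_pos (ENNReal.toReal_pos_iff.1 h1).1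
    refine ⟨x, hx2, ?_⟩
    rw [← cellIndex_add i n, show cellIndex (i + n) x = c from hx1]
  rw [show C + 2 = (C + 1) + 1 by ring]
  refine card_le_of_sub_le (by linarith) fun a ha b hb => ?_
  obtain ⟨a', _, rfl⟩ := Finset.mem_image.1 ha
  obtain ⟨b', _, rfl⟩ := Finset.mem_image.1 hb
  obtain ⟨x, hx, ex⟩ := hrep a' a'.2
  obtain ⟨y, hy, ey⟩ := hrep b' b'.2
  rw [← ex, ← ey]
  rw [msupp_eq_support] at hdiam
  have h1 := (Metric.dist_le_diam_of_mem hbdd hx hy).trans hdiam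
  rw [Real.dist_eq, zpow_neg, zpow_natCast] at h1
  have h2 : (x - y) * 2 ^ i ≤ C := by
    have := mul_le_mul_of_nonneg_right ((le_abs_self _).trans h1)
      (by positivity : (0 : ℝ) ≤ 2 ^ i)
    rwa [inv_mul_cancel_right₀ (by positivity)] at this
  have h3 := Int.floor_le (x * 2 ^ i)
  have h4 := Int.lt_floor_add_one (y * 2 ^ i)
  push_cast
  simp only [cellIndex]
  linarith

end DyadicCells

lemma sum_Icc_le_of_half {i n m : ℕ} {P : ℕ → ℝ} (hP : ∀ j, P j ≤ 1) {T : Finset ℕ}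
    (hT : ∀ t ∈ T, t + m ≤ n ∧ P (i + n - m - t) ≤ 1 / 2) :
    ∑ j ∈ Finset.Icc i (i + n), P j ≤ n + 1 - T.card / 2 := by
  have hinj : Set.InjOn (fun t => i + n - m - t) T := by
    intro a ha b hb h
    have h1 := (hT a ha).1
    have h2 := (hT b hb).1
    simp only at h
    omega
  have hsub : T.image (fun t => i + n - m - t) ⊆ Finset.Icc i (i + n) := by
    intro j hj
    obtain ⟨t, ht, rfl⟩ := Finset.mem_image.1 hj
    have h1 := (hT t ht).1
    exact Finset.mem_Icc.2 ⟨by omega, by omega⟩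
  have h1 : ∑ j ∈ Finset.Icc i (i + n), (1 - P j) ≥
      ∑ j ∈ T.image (fun t => i + n - m - t), (1 - P j) :=
    Finset.sum_le_sum_of_subset_of_nonneg hsub fun j _ _ => sub_nonneg.2 (hP j)
  rw [Finset.sum_image hinj] at h1
  have h2 : ∑ t ∈ T, (1 / 2 : ℝ) ≤ ∑ t ∈ T, (1 - P (i + n - m - t)) :=
    Finset.sum_le_sum fun t ht => by linarith [(hT t ht).2]
  rw [Finset.sum_const, nsmul_eq_mul] at h2
  rw [Finset.sum_sub_distrib, Finset.sum_const, nsmul_eq_mul, Nat.card_Icc, mul_one,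
    show i + n + 1 - i = n + 1 by omega] at h1
  push_cast at h1
  linarith

theorem entropy_growth_convolution :
    ∀ ε : ℝ, 0 < ε → ε < 1 →
      ∃ η₀ : ℝ, 0 < η₀ ∧ ∀ m : ℕ, 1 ≤ m → ∀ η : ℝ, 0 < η → η < η₀ →
        ∃ δ : ℝ, 0 < δ ∧ ∃ N : ℕ, 1 ≤ N ∧ ∀ n : ℕ, N ≤ n →
          ∀ i : ℕ, 1 ≤ i →
            ∀ ξ θ : Measure ℝ, IsProbabilityMeasure ξ → IsProbabilityMeasure θ →
              (∃ S : Set ℝ, IsCompact S ∧ ξ Sᶜ = 0) →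
              (∃ S : Set ℝ, IsCompact S ∧ θ Sᶜ = 0) →
              Metric.diam (msupp ξ) ≤ ε⁻¹ * (2 : ℝ) ^ (-(i : ℤ)) →
              Metric.diam (msupp θ) ≤ ε⁻¹ * (2 : ℝ) ^ (-(i : ℤ)) →
              ε < (1 / (n : ℝ)) * ent1 (i + n) ξ →
              1 - η < ((n : ℝ) + 1)⁻¹ * ∑ j ∈ Finset.Icc i (i + n),
                (θ {x | (1 / (m : ℝ)) * ent1 (j + m) (dcomp θ x j) < 1 - ε}).toReal →
              (1 / (n : ℝ)) * ent1 (i + n) θ + δ ≤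
                (1 / (n : ℝ)) * ent1 (i + n) (mconv ξ θ) := by
  intro ε hε hε1
  refine ⟨ε / 32, by positivity, fun m hm η _ hη => ?_⟩
  obtain ⟨δ, hδ, N, hN⟩ := exists_full_scales hε hε1 hm
  have hlog : 0 < Real.log 2 := Real.log_pos (by norm_num)
  refine ⟨δ / (2 * Real.log 2), by positivity, max (max N ⌈2 * Real.log 2 / δ⌉₊) 1,
    le_max_right _ _, fun n hn i _ ξ θ _ _ ⟨S₁, hS₁, hξ⟩ ⟨S₂, hS₂, hθ⟩ hdiam _ hent hprob => ?_⟩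
  have hn1 : 1 ≤ n := (le_max_right _ _).trans hn
  have hnN : N ≤ n := (le_max_left _ _).trans ((le_max_left _ _).trans hn)
  have hnδ : 2 * Real.log 2 / δ ≤ n :=
    (Nat.le_ceil _).trans (by exact_mod_cast (le_max_right _ _).trans ((le_max_left _ _).trans hn))
  have hn0 : (1 : ℝ) ≤ n := by exact_mod_cast hn1
  obtain ⟨G₁, hG₁, h₁⟩ := exists_atoms_of_isCompact (i + n) ξ hS₁ hξ
  obtain ⟨G₂, hG₂, h₂⟩ := exists_atoms_of_isCompact (i + n) θ hS₂ hθ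
  have hX : ent1 (i + n) ξ =
      fibEnt (fun z : G₁ => (cellLaw (i + n) ξ).real {z.1}) (fun z => z.1) / Real.log 2 :=
    ent1_eq_fibEnt fun c => by simpa using toReal_dyadIco (i + n) 0 ξ h₁ c
  have hY : ent1 (i + n) θ =
      fibEnt (fun z : G₂ => (cellLaw (i + n) θ).real {z.1}) (fun z => z.1) / Real.log 2 :=
    ent1_eq_fibEnt fun c => by simpa using toReal_dyadIco (i + n) 0 θ h₂ c
  have hconv := fibEnt_sum_atoms_le (i + n) ξ θ h₁ h₂
  have hmut := mutInfo_add (q := fun z : G₂ => (cellLaw (i + n) θ).real {z.1})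
    (sum_atoms (cellLaw (i + n) ξ) h₁) (fun z => z.1) (fun z => z.1)
  by_cases hI : mutInfo (fun z : G₁ => (cellLaw (i + n) ξ).real {z.1})
      (fun z : G₂ => (cellLaw (i + n) θ).real {z.1}) (fun x y => x.1 + y.1) ≤ δ * n
  · exfalso
    have hentX : ε * n * Real.log 2 <
        fibEnt (fun z : G₁ => (cellLaw (i + n) ξ).real {z.1}) (fun z => z.1) := by
      rw [hX, one_div_mul_eq_div, div_div, lt_div_iff₀ (by positivity)] at hent
      linarith
    obtain ⟨T, hT, hTt⟩ := hN n hnN G₁ G₂ _ _ (fun x => hG₁ x.1 x.2) (fun y => hG₂ y.1 y.2)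
      (sum_atoms _ h₁) (sum_atoms _ h₂) (fun z => z.1) (fun z => z.1)
      (card_image_atoms_le i n ξ hS₁ hξ hG₁ (inv_pos.2 hε).le hdiam) hentX hI
    have hsum := sum_Icc_le_of_half (i := i) (n := n) (m := m) (T := T)
      (P := fun j => (θ {x | (1 / (m : ℝ)) * ent1 (j + m) (dcomp θ x j) < 1 - ε}).toReal)
      (fun j => measureReal_le_one) fun t ht => ⟨(hTt t ht).1, by
        have htn := (hTt t ht).1
        have hk : i + n - m - t + m + t = i + n := by omega
        have := toReal_setOf_ent1_dcomp_lt (i + n - m - t) t hm θ (G := G₂) (by rwa [hk]) (1 - ε)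
        rw [this, hk]
        exact (hTt t ht).2⟩
    rw [inv_mul_eq_div, lt_div_iff₀ (by positivity)] at hprob
    nlinarith
  · rw [hmut] at hI
    rw [div_le_iff₀ hδ] at hnδ
    have hgain : ent1 (i + n) θ + n * (δ / (2 * Real.log 2)) ≤ ent1 (i + n) (mconv ξ θ) := by
      rw [hY, ← sub_nonneg, ← mul_nonneg_iff_of_pos_right hlog]
      have e1 : fibEnt (fun z : G₂ => (cellLaw (i + n) θ).real {z.1}) (fun z => z.1) /
          Real.log 2 * Real.log 2 = fibEnt (fun z : G₂ => (cellLaw (i + n) θ).real {z.1})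
          (fun z => z.1) := div_mul_cancel₀ _ hlog.ne'
      have e2 : n * (δ / (2 * Real.log 2)) * Real.log 2 = n * δ / 2 := by field_simp
      rw [sub_mul, add_mul, e1, e2]
      linarith
    have := mul_le_mul_of_nonneg_left hgain (by positivity : (0 : ℝ) ≤ 1 / n)
    rwa [mul_add, ← mul_assoc (1 / (n : ℝ)), one_div_mul_cancel (by positivity), one_mul] at this
end
end
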